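/- Let Δ ⊆ ℝ⁴ be a 4-dimensional reflexive polytope with dual reflexive polytope Δ*. Then 12 · (|∂Δ ∩ ℤ⁴| + |∂Δ* ∩ ℤ⁴|) = 2 · (v(Δ) + v(Δ*)) + Σ_θ v(θ)·v(θ*), where the sum runs over all faces θ of Δ with dim θ ∈ {1, 2}, θ* is the dual face of Δ*, and |∂Δ ∩ ℤ⁴|, |∂Δ* ∩ ℤ⁴| denote the numbers of lattice points on the boundaries of Δ and Δ*. -/

import Mathlib

open MeasureTheory Filter Pointwise

noncomputable section

/-- The canonical embedding of a lattice point of `ℤ^d` into `ℝ^d`. -/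
def coeLat {d : ℕ} (n : Fin d → ℤ) : Fin d → ℝ := fun i => (n i : ℝ)

/-- The set of lattice points lying in a subset `S ⊆ ℝ^d`. -/
def latticePoints {d : ℕ} (S : Set (Fin d → ℝ)) : Set (Fin d → ℤ) :=
  {n | coeLat n ∈ S}

/-- A lattice polytope: the convex hull of finitely many points of `ℤ^d`. -/
def IsLatticePolytope {d : ℕ} (P : Set (Fin d → ℝ)) : Prop :=
  ∃ V : Finset (Fin d → ℤ), P = convexHull ℝ (coeLat '' (V : Set (Fin d → ℤ)))

/-- The dual (polar) body `P* = {y | ⟨y,x⟩ ≥ -1 ∀ x ∈ P}`. -/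
def polarDual {d : ℕ} (P : Set (Fin d → ℝ)) : Set (Fin d → ℝ) :=
  {y | ∀ x ∈ P, -1 ≤ ∑ i, y i * x i}

/-- Dimension of a subset of `ℝ^d`: the dimension of its affine span. -/
def dimSet {d : ℕ} (S : Set (Fin d → ℝ)) : ℕ :=
  Module.finrank ℝ (affineSpan ℝ S).direction

/-- A reflexive polytope: a lattice polytope containing the origin in its interior
whose dual is again a lattice polytope. -/
def IsReflexive {d : ℕ} (P : Set (Fin d → ℝ)) : Prop :=
  IsLatticePolytope P ∧ (0 : Fin d → ℝ) ∈ interior P ∧ IsLatticePolytope (polarDual P)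

/-- A (nonempty, exposed) face of dimension `k` of a polytope `P`. -/
def IsFaceOfDim {d : ℕ} (P : Set (Fin d → ℝ)) (k : ℕ) (θ : Set (Fin d → ℝ)) : Prop :=
  IsExposed ℝ P θ ∧ θ.Nonempty ∧ dimSet θ = k

/-- The dual face `θ* = {y ∈ P* | ⟨y,x⟩ = -1 ∀ x ∈ θ}` of a face `θ` of `P`. -/
def dualFace {d : ℕ} (P θ : Set (Fin d → ℝ)) : Set (Fin d → ℝ) :=
  {y ∈ polarDual P | ∀ x ∈ θ, ∑ i, y i * x i = -1}

/-- The normalized volume of a `k`-dimensional lattice polytope `θ ⊆ ℝ^d`: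
`lim_{m → ∞} k! ⬝ |mθ ∩ ℤ^d| / m^k`. -/
def normVol {d : ℕ} (k : ℕ) (θ : Set (Fin d → ℝ)) : ℝ :=
  limUnder atTop
    (fun m : ℕ => (Nat.factorial k : ℝ) * (latticePoints ((m : ℝ) • θ)).ncard / (m : ℝ) ^ k)

section


/-! ## Counting estimates -/

/-- `g n = O(n^2)` for integer valued sequences. -/
def O2 (g : ℕ → ℤ) : Prop := ∃ C : ℤ, ∀ᶠ n : ℕ in atTop, |g n| ≤ C * (n : ℤ) ^ 2

lemma O2.add {g h : ℕ → ℤ} (hg : O2 g) (hh : O2 h) : O2 (fun n => g n + h n) := by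
  obtain ⟨C, hC⟩ := hg
  obtain ⟨D, hD⟩ := hh
  refine ⟨C + D, ?_⟩
  filter_upwards [hC, hD] with n h1 h2
  have := abs_add_le (g n) (h n)
  linarith [add_mul C D ((n:ℤ)^2)]

lemma O2.const_mul {g : ℕ → ℤ} (hg : O2 g) (c : ℤ) : O2 (fun n => c * g n) := by
  obtain ⟨C, hC⟩ := hg
  refine ⟨|c| * C, ?_⟩
  filter_upwards [hC] with n h1
  rw [abs_mul, mul_assoc]
  exact mul_le_mul_of_nonneg_left h1 (abs_nonneg c)

lemma O2.mono {g h : ℕ → ℤ} (hg : O2 g) (hh : ∀ᶠ n in atTop, |h n| ≤ |g n|) : O2 h := by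
  obtain ⟨C, hC⟩ := hg
  refine ⟨C, ?_⟩
  filter_upwards [hC, hh] with n h1 h2
  linarith

lemma O2.congr {g h : ℕ → ℤ} (hg : O2 g) (hh : ∀ᶠ n in atTop, h n = g n) : O2 h :=
  hg.mono (hh.mono fun n hn => by rw [hn])

lemma O2.zero : O2 (fun _ => 0) := ⟨0, by simp⟩

lemma O2.sum {ι : Type*} {s : Finset ι} {g : ι → ℕ → ℤ} (h : ∀ i ∈ s, O2 (g i)) :
    O2 (fun n => ∑ i ∈ s, g i n) := by
  classical
  induction s using Finset.induction_on with
  | empty => simpa using O2.zero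
  | insert a s ha ih =>
    have h1 := (h a (Finset.mem_insert_self a s)).add
      (ih fun i hi => h i (Finset.mem_insert_of_mem hi))
    refine h1.congr (Eventually.of_forall fun n => ?_)
    rw [Finset.sum_insert ha]

lemma O2.neg {g : ℕ → ℤ} (hg : O2 g) : O2 (fun n => - g n) := by
  refine hg.mono (Eventually.of_forall fun n => by simp)

lemma O2.sub {g h : ℕ → ℤ} (hg : O2 g) (hh : O2 h) : O2 (fun n => g n - h n) :=
  (hg.add hh.neg).congr (Eventually.of_forall fun n => by ring)

lemma O2.comp_double {g : ℕ → ℤ} (hg : O2 g) : O2 (fun n => g (2 * n)) := by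
  obtain ⟨C, hC⟩ := hg
  refine ⟨4 * C, ?_⟩
  have : Tendsto (fun n : ℕ => 2 * n) atTop atTop :=
    tendsto_atTop_mono (fun n => by simp only [id]; omega) tendsto_id
  filter_upwards [this.eventually hC] with n h
  push_cast at h
  linarith

/-- The lattice points of the cube `[-M,M]^4`. -/
def bx (M : ℤ) : Finset (Fin 4 → ℤ) := Fintype.piFinset fun _ => Finset.Icc (-M) M

lemma mem_bx {M : ℤ} {x : Fin 4 → ℤ} : x ∈ bx M ↔ ∀ i, |x i| ≤ M := by
  simp [bx, abs_le]

lemma two_con_card (a b : Fin 4 → ℤ) (i j : Fin 4) (hab : a i * b j - a j * b i ≠ 0)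
    (α β R M : ℤ) (hR : 0 ≤ R) (hM : 0 ≤ M) :
    (((bx M).filter fun x => |a ⬝ᵥ x - α| ≤ R ∧ |b ⬝ᵥ x - β| ≤ R).card : ℤ)
      ≤ (2 * R + 1) ^ 2 * (2 * M + 1) ^ 2 := by
  classical
  have hij : i ≠ j := by rintro rfl; apply hab; ring
  let S : Fin 4 → Finset ℤ := fun k => if k = i then Finset.Icc (α - R) (α + R) else
    if k = j then Finset.Icc (β - R) (β + R) else Finset.Icc (-M) M
  let φ : (Fin 4 → ℤ) → (Fin 4 → ℤ) := fun x k => if k = i then a ⬝ᵥ x else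
    if k = j then b ⬝ᵥ x else x k
  have h1 : ((bx M).filter fun x => |a ⬝ᵥ x - α| ≤ R ∧ |b ⬝ᵥ x - β| ≤ R).card
      ≤ (Fintype.piFinset S).card := by
    apply Finset.card_le_card_of_injOn φ
    · intro x hx
      simp only [Finset.coe_filter, Set.mem_ofPred_eq, mem_bx] at hx
      obtain ⟨h0, h1, h2⟩ := hx
      simp only [Finset.mem_coe, Fintype.mem_piFinset]
      intro k
      rw [abs_le] at h1 h2
      have h0 := h0 k
      rw [abs_le] at h0
      by_cases hk : k = i
      · simp only [S, φ, hk, if_true, Finset.mem_Icc]; constructor <;> linarith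
      · by_cases hk' : k = j
        · simp only [S, φ, hk', hij.symm, if_true, if_false, Finset.mem_Icc]
          constructor <;> linarith
        · simp only [S, φ, hk, hk', if_false, Finset.mem_Icc]; exact h0
    · intro x _ x' _ hxx
      have hz : ∀ k, k ≠ i ∧ k ≠ j → (x - x') k = 0 := by
        intro k hk
        have := congrFun hxx k
        simp only [φ, hk.1, hk.2, if_false] at this
        simp [this]
      have ha : a ⬝ᵥ (x - x') = 0 := by
        have := congrFun hxx i
        simp only [φ, if_true] at this
        rw [dotProduct_sub, this, sub_self]
      have hb : b ⬝ᵥ (x - x') = 0 := by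
        have := congrFun hxx j
        simp only [φ, hij.symm, if_true, if_false] at this
        rw [dotProduct_sub, this, sub_self]
      have e1 : a ⬝ᵥ (x - x') = a i * (x - x') i + a j * (x - x') j := by
        unfold dotProduct
        apply Finset.sum_eq_add_of_mem i j (Finset.mem_univ _) (Finset.mem_univ _) hij
        intro k _ hk; rw [hz k hk, mul_zero]
      have e2 : b ⬝ᵥ (x - x') = b i * (x - x') i + b j * (x - x') j := by
        unfold dotProduct
        apply Finset.sum_eq_add_of_mem i j (Finset.mem_univ _) (Finset.mem_univ _) hij
        intro k _ hk; rw [hz k hk, mul_zero]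
      rw [ha] at e1
      rw [hb] at e2
      have q1 : (x - x') i = 0 := by
        have : (a i * b j - a j * b i) * (x - x') i = 0 := by
          linear_combination (-b j) * e1 + a j * e2
        exact (mul_eq_zero.mp this).resolve_left hab
      have q2 : (x - x') j = 0 := by
        have : (a i * b j - a j * b i) * (x - x') j = 0 := by
          linear_combination (b i) * e1 - a i * e2
        exact (mul_eq_zero.mp this).resolve_left hab
      have : x - x' = 0 := by
        funext k
        by_cases hk : k = i
        · rw [hk]; exact q1
        · by_cases hk' : k = j
          · rw [hk']; exact q2
          · exact hz k ⟨hk, hk'⟩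
      exact sub_eq_zero.mp this
  have h2 : ((Fintype.piFinset S).card : ℤ) = (2 * R + 1) ^ 2 * (2 * M + 1) ^ 2 := by
    rw [Fintype.card_piFinset, ← Finset.mul_prod_erase _ _ (Finset.mem_univ i),
      ← Finset.mul_prod_erase _ _ (Finset.mem_erase.mpr ⟨hij.symm, Finset.mem_univ j⟩)]
    have h3 : ∀ k ∈ (Finset.univ.erase i).erase j, (S k).card = (Finset.Icc (-M) M).card := by
      intro k hk
      simp only [Finset.mem_erase, Finset.mem_univ, and_true] at hk
      simp only [S, hk.1, hk.2, if_false]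
    rw [Finset.prod_congr rfl h3, Finset.prod_const, Finset.card_erase_of_mem
      (Finset.mem_erase.mpr ⟨hij.symm, Finset.mem_univ j⟩), Finset.card_erase_of_mem
      (Finset.mem_univ i)]
    have h4 : (((S i).card : ℕ) : ℤ) = 2 * R + 1 := by
      simp only [S, if_true, Int.card_Icc]
      rw [Int.toNat_of_nonneg (by linarith)]; ring
    have h5 : (((S j).card : ℕ) : ℤ) = 2 * R + 1 := by
      simp only [S, hij.symm, if_true, if_false, Int.card_Icc]
      rw [Int.toNat_of_nonneg (by linarith)]; ring
    have h6 : (((Finset.Icc (-M) M).card : ℕ) : ℤ) = 2 * M + 1 := by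
      rw [Int.card_Icc, Int.toNat_of_nonneg (by linarith)]; ring
    push_cast
    rw [h4, h5, h6]
    simp
    ring
  calc _ ≤ ((Fintype.piFinset S).card : ℤ) := by exact_mod_cast h1
    _ = _ := h2

/-- Two independent linear constraints leave `O(n^2)` lattice points. -/
lemma two_con (a b : Fin 4 → ℤ) (hab : ∃ i j, a i * b j - a j * b i ≠ 0) (α β : ℕ → ℤ)
    (R C : ℤ) :
    O2 (fun n => (((bx (C * n)).filter fun x => |a ⬝ᵥ x - α n| ≤ R ∧ |b ⬝ᵥ x - β n| ≤ R).card : ℤ))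
    := by
  obtain ⟨i, j, hab⟩ := hab
  refine ⟨(2 * |R| + 1) ^ 2 * (2 * |C| + 1) ^ 2, ?_⟩
  filter_upwards [eventually_ge_atTop 1] with n hn
  have hn' : (1 : ℤ) ≤ n := by exact_mod_cast hn
  rw [abs_of_nonneg (by positivity)]
  have h1 := two_con_card a b i j hab (α n) (β n) |R| (|C| * n) (abs_nonneg _) (by positivity)
  have h2 : (((bx (C * n)).filter fun x => |a ⬝ᵥ x - α n| ≤ R ∧ |b ⬝ᵥ x - β n| ≤ R).card : ℤ) ≤
      (((bx (|C| * n)).filter fun x => |a ⬝ᵥ x - α n| ≤ |R| ∧ |b ⬝ᵥ x - β n| ≤ |R|).card : ℤ) := by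
    norm_cast
    apply Finset.card_le_card
    intro x hx
    simp only [Finset.mem_filter, mem_bx] at hx ⊢
    refine ⟨fun i => (hx.1 i).trans ?_, hx.2.1.trans (le_abs_self R), hx.2.2.trans (le_abs_self R)⟩
    exact mul_le_mul_of_nonneg_right (le_abs_self C) (by positivity)
  refine h2.trans (h1.trans ?_)
  have h3 : 2 * (|C| * n) + 1 ≤ (2 * |C| + 1) * n := by nlinarith
  rw [mul_assoc, ← mul_pow (2 * |C| + 1)]
  gcongr

lemma dot_shift (a x z : Fin 4 → ℤ) : a ⬝ᵥ (x + z) = a ⬝ᵥ x + a ⬝ᵥ z := dotProduct_add a x z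

/-- `(-1)^k` as an integer. -/
def sg (k : ℤ) : ℤ := ((k.negOnePow : ℤˣ) : ℤ)

lemma sg_add (a b : ℤ) : sg (a + b) = sg a * sg b := by
  simp [sg, Int.negOnePow_add]

lemma sg_even {a : ℤ} (h : Even a) : sg a = 1 := by simp [sg, Int.negOnePow_even a h]

lemma sg_odd {a : ℤ} (h : Odd a) : sg a = -1 := by simp [sg, Int.negOnePow_odd a h]

lemma sg_abs (a : ℤ) : |sg a| = 1 := Int.abs_negOnePow a

/-- The alternating sum of a second difference of `|·|`. -/
lemma alt_tent (m : ℕ) : ∀ K : ℕ, 2 * m + 1 ≤ K → ∑ j ∈ Finset.Icc (-(K:ℤ)) K, sg j *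
    (|j + (2 * m + 1)| + |j - (2 * m + 1)| - 2 * |j|) = 2 := by
  have key : ∀ K : ℕ, ∀ g : ℤ → ℤ, ∑ j ∈ Finset.Icc (-((K+1:ℕ):ℤ)) (K+1:ℕ), g j =
      ∑ j ∈ Finset.Icc (-(K:ℤ)) K, g j + g (K+1) + g (-(K+1)) := by
    intro K g
    have : Finset.Icc (-((K+1:ℕ):ℤ)) (K+1:ℕ) =
      insert (-((K:ℤ)+1)) (insert ((K:ℤ)+1) (Finset.Icc (-(K:ℤ)) K)) := by
      ext j; simp only [Finset.mem_Icc, Finset.mem_insert]; push_cast; omega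
    rw [this, Finset.sum_insert, Finset.sum_insert]
    · ring
    · simp
    · simp only [Finset.mem_Icc, Finset.mem_insert]; omega
  have sgneg : ∀ a : ℤ, sg (-a) = sg a := by intro a; simp [sg, Int.negOnePow_neg]
  have sg1 : ∀ a : ℤ, sg (a + 1) = - sg a := by
    intro a; rw [sg_add, sg_odd (a := 1) (by decide)]; ring
  have part : ∀ K : ℕ, K ≤ 2 * m + 1 → ∑ j ∈ Finset.Icc (-(K:ℤ)) K, sg j *
      (|j + (2 * m + 1)| + |j - (2 * m + 1)| - 2 * |j|) = sg K * (2 * (2 * m + 1) - 2 * K - 1) + 1 := by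
    intro K
    induction K with
    | zero =>
      intro _
      have : |-1 + -(2 * (m : ℤ))| = 2 * m + 1 := by rw [abs_of_neg] <;> omega
      have h2 : |2 * (m : ℤ) + 1| = 2 * m + 1 := by rw [abs_of_pos] ; omega
      have h0 : sg 0 = 1 := rfl
      simp [h0, this, h2]
      ring
    | succ K ih =>
      intro hK
      rw [key, ih (by omega), sgneg, sg1]
      have e1 : |(K:ℤ) + 1 + (2 * m + 1)| = K + 1 + (2 * m + 1) := abs_of_nonneg (by omega)
      have e2 : |(K:ℤ) + 1 - (2 * m + 1)| = - (K + 1 - (2 * m + 1)) := abs_of_nonpos (by omega)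
      have e3 : |-((K:ℤ) + 1) + (2 * m + 1)| = -(K + 1) + (2 * m + 1) := abs_of_nonneg (by omega)
      have e4 : |-((K:ℤ) + 1) - (2 * m + 1)| = - (-(K + 1) - (2 * m + 1)) :=
        abs_of_nonpos (by omega)
      have e5 : |(K:ℤ) + 1| = K + 1 := abs_of_nonneg (by omega)
      have e6 : |-((K:ℤ) + 1)| = K + 1 := by rw [abs_neg, e5]
      rw [e1, e2, e3, e4, e5, e6]
      push_cast
      rw [sg1]
      ring
  intro K hK
  induction K, hK using Nat.le_induction with
  | base =>
    rw [part _ le_rfl]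
    push_cast
    rw [sg_odd ⟨(m:ℤ), rfl⟩]
    ring
  | succ K hK ih =>
    rw [key, ih, sgneg]
    have e1 : |(K:ℤ) + 1 + (2 * m + 1)| = K + 1 + (2 * m + 1) := abs_of_nonneg (by omega)
    have e2 : |(K:ℤ) + 1 - (2 * m + 1)| = (K + 1 - (2 * m + 1)) := abs_of_nonneg (by omega)
    have e3 : |-((K:ℤ) + 1) + (2 * m + 1)| = - (-(K + 1) + (2 * m + 1)) :=
      abs_of_nonpos (by omega)
    have e4 : |-((K:ℤ) + 1) - (2 * m + 1)| = - (-(K + 1) - (2 * m + 1)) :=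
      abs_of_nonpos (by omega)
    have e5 : |(K:ℤ) + 1| = K + 1 := abs_of_nonneg (by omega)
    have e6 : |-((K:ℤ) + 1)| = K + 1 := by rw [abs_neg, e5]
    rw [e1, e2, e3, e4, e5, e6]
    ring

lemma alt_tent_odd (s : ℤ) (hs : Odd s) (K : ℤ) (hK : |s| ≤ K) :
    ∑ j ∈ Finset.Icc (-K) K, sg j * (|j + s| + |j - s| - 2 * |j|) = 2 := by
  have hK0 : 0 ≤ K := (abs_nonneg s).trans hK
  obtain ⟨K', rfl⟩ := Int.eq_ofNat_of_zero_le hK0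
  obtain ⟨m, hm⟩ : ∃ m : ℕ, |s| = 2 * m + 1 := by
    have h1 : Odd |s| := by rwa [odd_abs]
    obtain ⟨k, hk⟩ := h1
    have : 0 ≤ k := by have := abs_nonneg s; omega
    obtain ⟨m, rfl⟩ := Int.eq_ofNat_of_zero_le this
    exact ⟨m, hk⟩
  have := alt_tent m K' (by omega)
  rw [← hm] at this
  refine Eq.trans ?_ this
  apply Finset.sum_congr rfl
  intro j _
  rcases abs_choice s with h | h <;> rw [h]
  rw [← sub_eq_add_neg, sub_neg_eq_add, add_comm |j - s|]

end

section


/-! ## Pieces of the piecewise linear function -/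

/-- linear part of a piece -/
def lin (p : Option (Fin 4 → ℤ)) : Fin 4 → ℤ := p.elim 0 (fun y => - y)
/-- coefficient of `n` in a piece -/
def cn (p : Option (Fin 4 → ℤ)) : ℤ := p.elim 0 (fun _ => 1)
/-- value of a piece -/
def pv (n : ℤ) (p : Option (Fin 4 → ℤ)) (x : Fin 4 → ℤ) : ℤ := lin p ⬝ᵥ x + cn p * n

@[simp] lemma pv_none (n : ℤ) (x : Fin 4 → ℤ) : pv n none x = 0 := by
  simp [pv, lin, cn]

@[simp] lemma pv_some (n : ℤ) (y x : Fin 4 → ℤ) : pv n (some y) x = n - y ⬝ᵥ x := by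
  simp [pv, lin, cn]; ring

lemma pv_shift (n : ℤ) (p : Option (Fin 4 → ℤ)) (x z : Fin 4 → ℤ) :
    pv n p (x + z) = pv n p x + lin p ⬝ᵥ z := by
  simp only [pv, dotProduct_add]; ring

/-- Hypotheses on the finite set `Y` of vertices of the (negated) dual polytope. -/
structure CoreHyp (Y : Finset (Fin 4 → ℤ)) (C : ℤ) : Prop where
  cpos : 0 ≤ C
  bd : ∀ (x : Fin 4 → ℤ) (i : Fin 4), ∃ y ∈ Y, |x i| ≤ C * (y ⬝ᵥ x)
  ncol : ∀ y₁ ∈ Y, ∀ y₂ ∈ Y, ∀ y₃ ∈ Y, y₁ ≠ y₂ → y₁ ≠ y₃ → y₂ ≠ y₃ →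
    ∃ i j, (y₁ - y₂) i * (y₁ - y₃) j - (y₁ - y₂) j * (y₁ - y₃) i ≠ 0
  prim : ∀ y ∈ Y, ∃ x, y ⬝ᵥ x = 1

/-- comparison relation of a piece -/
def rel (n : ℤ) (r : Option (Fin 4 → ℤ)) (x : Fin 4 → ℤ) (v : ℤ) : Prop :=
  match r with
  | none => 0 ≤ v
  | some y => v ≤ n - y ⬝ᵥ x

lemma triple_none {Y : Finset (Fin 4 → ℤ)} {C : ℤ} (hY : CoreHyp Y C) {y₁ y₂ : Fin 4 → ℤ}
    (h1 : y₁ ∈ Y) (h2 : y₂ ∈ Y) (h12 : y₁ ≠ y₂) (R M : ℤ) :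
    O2 (fun n => (((bx (M * n)).filter fun x => |pv n none x - pv n (some y₁) x| ≤ R ∧
      |pv n none x - pv n (some y₂) x| ≤ R).card : ℤ)) := by
  by_cases hind : ∃ i j, y₁ i * y₂ j - y₁ j * y₂ i ≠ 0
  · refine (two_con y₁ y₂ hind (fun n => n) (fun n => n) R M).congr (Eventually.of_forall fun n => ?_)
    congr 2
    ext x
    simp
  · push Not at hind
    obtain ⟨z, hz⟩ := hY.prim y₁ h1
    set μ := y₂ ⬝ᵥ z with hμ
    have hy2 : y₂ = μ • y₁ := by
      funext j
      have : y₂ j * (y₁ ⬝ᵥ z) = (y₂ ⬝ᵥ z) * y₁ j := by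
        simp only [dotProduct, Finset.mul_sum, Finset.sum_mul]
        apply Finset.sum_congr rfl
        intro i _
        linear_combination z i * hind i j
      rw [hz, mul_one] at this
      rw [this]; simp [hμ]
    have hμ1 : μ - 1 ≠ 0 := by
      intro h
      apply h12
      rw [hy2, show μ = 1 by linarith, one_smul]
    refine O2.zero.congr ?_
    filter_upwards [eventually_gt_atTop (3 * R).toNat] with n hn
    rw [Nat.cast_eq_zero, Finset.card_eq_zero, Finset.filter_eq_empty_iff]
    rintro x - ⟨ha, hb⟩
    rw [hy2] at hb
    simp only [pv_none, pv_some, smul_dotProduct, smul_eq_mul] at ha hb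
    set k := y₁ ⬝ᵥ x
    have hc : |(μ - 1) * k| ≤ 2 * R := by
      have : (μ - 1) * k = (0 - (n - μ * k)) - (0 - (n - k)) := by ring
      rw [this]
      exact (abs_sub _ _).trans (by linarith)
    rw [abs_mul] at hc
    have hd : 1 ≤ |μ - 1| := Int.one_le_abs hμ1
    have he : |k| ≤ 2 * R := by nlinarith [abs_nonneg k]
    rw [abs_le] at ha he
    have hn' : 3 * R < n := by
      have := Int.self_le_toNat (3 * R)
      omega
    omega

lemma triple {Y : Finset (Fin 4 → ℤ)} {C : ℤ} (hY : CoreHyp Y C) {p q r : Option (Fin 4 → ℤ)}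
    (hp : p ∈ Finset.insertNone Y) (hq : q ∈ Finset.insertNone Y) (hr : r ∈ Finset.insertNone Y)
    (hpq : p ≠ q) (hpr : p ≠ r) (hqr : q ≠ r) (R M : ℤ) :
    O2 (fun n => (((bx (M * n)).filter fun x => |pv n p x - pv n q x| ≤ R ∧
      |pv n p x - pv n r x| ≤ R).card : ℤ)) := by
  have mono : ∀ {P Q : ℕ → (Fin 4 → ℤ) → Prop} [∀ n, DecidablePred (P n)]
    [∀ n, DecidablePred (Q n)], (∀ n x, P n x → Q n x) →
    O2 (fun n => (((bx (M * n)).filter (Q n)).card : ℤ)) →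
    O2 (fun n => (((bx (M * n)).filter (P n)).card : ℤ)) := by
    intro P Q _ _ h hQ
    refine hQ.mono (Eventually.of_forall fun n => ?_)
    rw [abs_of_nonneg (by positivity), abs_of_nonneg (by positivity)]
    norm_cast
    exact Finset.card_le_card (Finset.monotone_filter_right _ fun x _ hx => h n x hx)
  rcases p with _ | p <;> rcases q with _ | q <;> rcases r with _ | r <;>
    simp only [Finset.mem_insertNone, Option.mem_def, Option.some.injEq, ne_eq, not_true,
      forall_eq'] at hp hq hr hpq hpr hqr
  · exact triple_none hY hq hr hqr R M
  · refine mono ?_ (triple_none hY hp hr hpr (2 * R) M)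
    simp only [pv_none, pv_some, abs_le]
    intro n x; omega
  · refine mono ?_ (triple_none hY hp hq hpq (2 * R) M)
    simp only [pv_none, pv_some, abs_le]
    intro n x; omega
  · refine mono ?_ (two_con _ _ (hY.ncol p hp q hq r hr hpq hpr hqr) (fun n => 0) (fun n => 0) R M)
    simp only [pv_some, abs_le, sub_dotProduct]
    intro n x; omega

open Classical in
/-- exceptional points near three pieces -/
def excp (Y : Finset (Fin 4 → ℤ)) (R M : ℤ) (n : ℕ) : Finset (Fin 4 → ℤ) :=
  (bx (M * n)).filter fun x => ∃ p ∈ Finset.insertNone Y, ∃ q ∈ Finset.insertNone Y,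
    ∃ r ∈ Finset.insertNone Y, p ≠ q ∧ p ≠ r ∧ q ≠ r ∧ |pv n p x - pv n q x| ≤ R ∧
      |pv n p x - pv n r x| ≤ R

lemma excp_O2 {Y : Finset (Fin 4 → ℤ)} {C : ℤ} (hY : CoreHyp Y C) (R M : ℤ) :
    O2 (fun n => ((excp Y R M n).card : ℤ)) := by
  classical
  have h : O2 (fun n : ℕ => ∑ p ∈ Finset.insertNone Y, ∑ q ∈ (Finset.insertNone Y),
    ∑ r ∈ Finset.insertNone Y, (if p ≠ q ∧ p ≠ r ∧ q ≠ r then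
      (((bx (M * n)).filter fun x => |pv n p x - pv n q x| ≤ R ∧
      |pv n p x - pv n r x| ≤ R).card : ℤ) else 0)) := by
    refine O2.sum fun p hp => O2.sum fun q hq => O2.sum fun r hr => ?_
    by_cases hd : p ≠ q ∧ p ≠ r ∧ q ≠ r
    · simp only [if_pos hd]
      exact triple hY hp hq hr hd.1 hd.2.1 hd.2.2 R M
    · simp only [if_neg hd]
      exact O2.zero
  refine h.mono (Eventually.of_forall fun n => ?_)
  rw [abs_of_nonneg (by positivity)]
  refine le_trans ?_ (le_abs_self _)
  have : excp Y R M n ⊆ (Finset.insertNone Y).biUnion fun p => (Finset.insertNone Y).biUnion fun q =>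
      (Finset.insertNone Y).biUnion fun r => if p ≠ q ∧ p ≠ r ∧ q ≠ r then
      ((bx (M * n)).filter fun x => |pv n p x - pv n q x| ≤ R ∧
      |pv n p x - pv n r x| ≤ R) else ∅ := by
    intro x hx
    simp only [excp, Finset.mem_filter] at hx
    obtain ⟨hx, p, hp, q, hq, r, hr, h1, h2, h3, h4⟩ := hx
    simp only [Finset.mem_biUnion]
    refine ⟨p, hp, q, hq, r, hr, ?_⟩
    rw [if_pos ⟨h1, h2, h3⟩, Finset.mem_filter]
    exact ⟨hx, h4⟩
  have h5 := (Finset.card_le_card this).trans (Finset.card_biUnion_le.trans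
    (Finset.sum_le_sum fun p _ => Finset.card_biUnion_le.trans
      (Finset.sum_le_sum fun q _ => Finset.card_biUnion_le)))
  refine le_trans (Int.ofNat_le.mpr h5) (le_of_eq ?_)
  push_cast
  refine Finset.sum_congr rfl fun p _ => Finset.sum_congr rfl fun q _ =>
    Finset.sum_congr rfl fun r _ => ?_
  split_ifs <;> simp

end

section


/-- the points at level `k` of the wall between two pieces -/
def TC (Y : Finset (Fin 4 → ℤ)) (n : ℤ) (p q : Option (Fin 4 → ℤ)) (k : ℤ) (x : Fin 4 → ℤ) : Prop :=
  pv n p x - pv n q x = k ∧ ∀ r ∈ Finset.insertNone Y, r ≠ p → r ≠ q →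
    rel n r x (pv n p x) ∧ rel n r x (pv n q x)

open Classical in
/-- the finite set of points at level `k` of the wall between two pieces -/
def TT (Y : Finset (Fin 4 → ℤ)) (M : ℤ) (p q : Option (Fin 4 → ℤ)) (k : ℤ) (n : ℕ) :
    Finset (Fin 4 → ℤ) := (bx (M * n)).filter (TC Y n p q k)

lemma TC_bound {Y : Finset (Fin 4 → ℤ)} {n K k : ℤ} {p q : Option (Fin 4 → ℤ)} {x : Fin 4 → ℤ}
    (hpq : p ≠ q) (hk : |k| ≤ K) (h : TC Y n p q k x) : ∀ y ∈ Y, y ⬝ᵥ x ≤ n + K := by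
  obtain ⟨h1, h2⟩ := h
  rw [abs_le] at hk
  intro y hy
  have hyP : some y ∈ Finset.insertNone Y := by simpa using hy
  have hnP : none ∈ Finset.insertNone Y := by simp
  have h3 := h2 none hnP
  have h4 := h2 (some y) hyP
  rcases p with _ | p <;> rcases q with _ | q
  · exact absurd rfl hpq
  · by_cases hyq : y = q
    · subst hyq; simp only [pv_none, pv_some] at h1; omega
    · have := (h4 (by simp) (by simpa using hyq)).1
      simp only [rel, pv_none] at this; omega
  · by_cases hyp : y = p
    · subst hyp; simp only [pv_none, pv_some] at h1; omega
    · have := (h4 (by simpa using hyp) (by simp)).2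
      simp only [rel, pv_none] at this; omega
  · have h5 := h3 (by simp) (by simp)
    simp only [rel, pv_some] at h5
    by_cases hyp : y = p
    · subst hyp; omega
    · by_cases hyq : y = q
      · subst hyq; omega
      · have := (h4 (by simpa using hyp) (by simpa using hyq)).1
        simp only [rel, pv_some] at this; omega

lemma bx_of_bound {Y : Finset (Fin 4 → ℤ)} {C : ℤ} (hY : CoreHyp Y C) {n : ℕ} {K : ℤ} (hK : 0 ≤ K)
    (hn : 1 ≤ n) {x : Fin 4 → ℤ} (h : ∀ y ∈ Y, y ⬝ᵥ x ≤ n + K) : x ∈ bx (C * (1 + K) * n) := by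
  rw [mem_bx]
  intro i
  obtain ⟨y, hy, h1⟩ := hY.bd x i
  have hn' : (1 : ℤ) ≤ n := by exact_mod_cast hn
  have h2 := h y hy
  have h3 : (n : ℤ) + K ≤ (1 + K) * n := by nlinarith
  calc |x i| ≤ C * (y ⬝ᵥ x) := h1
    _ ≤ C * ((1 + K) * n) := mul_le_mul_of_nonneg_left (h2.trans h3) hY.cpos
    _ = _ := by ring

lemma mem_TT {Y : Finset (Fin 4 → ℤ)} {C : ℤ} (hY : CoreHyp Y C) {n : ℕ} {K k M : ℤ}
    {p q : Option (Fin 4 → ℤ)} {x : Fin 4 → ℤ}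
    (hpq : p ≠ q) (hk : |k| ≤ K) (hn : 1 ≤ n) (hM : C * (1 + K) ≤ M) :
    x ∈ TT Y M p q k n ↔ TC Y n p q k x := by
  classical
  simp only [TT, Finset.mem_filter]
  refine ⟨fun h => h.2, fun h => ⟨?_, h⟩⟩
  have := bx_of_bound hY ((abs_nonneg k).trans hk) hn (TC_bound hpq hk h)
  rw [mem_bx] at this ⊢
  intro i
  exact (this i).trans (mul_le_mul_of_nonneg_right hM (by positivity))

lemma rel_near {n D : ℤ} {r : Option (Fin 4 → ℤ)} {x x' : Fin 4 → ℤ} {v v' : ℤ}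
    (h : rel n r x v) (h' : ¬ rel n r x' v') (hv : |v - v'| ≤ D) (hr : |pv n r x - pv n r x'| ≤ D) :
    |v - pv n r x| ≤ 2 * D := by
  rw [abs_le] at *
  rcases r with _ | r
  · simp only [rel, pv_none, not_le] at *; omega
  · simp only [rel, pv_some, not_le] at *; omega

lemma sum_sdiff_bound {ι : Type*} [DecidableEq ι] (A B : Finset ι) (g : ι → ℤ) (hg : ∀ x, |g x| ≤ 1) :
    |∑ x ∈ A, g x - ∑ x ∈ B, g x| ≤ (A \ B).card + (B \ A).card := by
  have h1 := Finset.sum_inter_add_sum_sdiff A B g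
  have h2 := Finset.sum_inter_add_sum_sdiff B A g
  rw [Finset.inter_comm] at h2
  have h3 : ∑ x ∈ A, g x - ∑ x ∈ B, g x = ∑ x ∈ A \ B, g x - ∑ x ∈ B \ A, g x := by linarith
  have bd : ∀ S : Finset ι, |∑ x ∈ S, g x| ≤ S.card := by
    intro S
    refine (Finset.abs_sum_le_sum_abs _ _).trans ((Finset.sum_le_sum fun x _ => hg x).trans ?_)
    simp
  rw [h3]
  exact (abs_sub _ _).trans (add_le_add (bd _) (bd _))

/-- signed count -/
def UU (Y : Finset (Fin 4 → ℤ)) (M : ℤ) (ξ : Fin 4 → ℤ) (p q : Option (Fin 4 → ℤ)) (k : ℤ) (n : ℕ) :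
    ℤ := ∑ x ∈ TT Y M p q k n, sg (ξ ⬝ᵥ x)

lemma shift_fail {Y : Finset (Fin 4 → ℤ)} {n : ℕ} {K k k' D M : ℤ}
    {p q : Option (Fin 4 → ℤ)} {x z : Fin 4 → ℤ} (hp : p ∈ Finset.insertNone Y)
    (hq : q ∈ Finset.insertNone Y)
    (hpq : p ≠ q) (hk : |k| ≤ K) (hz : ∀ r ∈ Finset.insertNone Y, |lin r ⬝ᵥ z| ≤ D)
    (hκ : (lin p - lin q) ⬝ᵥ z = k' - k)
    (hx : TC Y n p q k x) (hx' : ¬ TC Y n p q k' (x + z)) (hxb : x ∈ bx (M * n)) :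
    x ∈ excp Y (2 * D + K) M n := by
  classical
  simp only [excp, Finset.mem_filter]
  refine ⟨hxb, ?_⟩
  have hD : 0 ≤ D := (abs_nonneg _).trans (hz p hp)
  have h1 : pv n p (x + z) - pv n q (x + z) = k' := by
    rw [pv_shift, pv_shift]
    rw [sub_dotProduct] at hκ
    linarith [hx.1]
  simp only [TC, h1, true_and] at hx'
  push Not at hx'
  obtain ⟨r, hr, hrp, hrq, hrel⟩ := hx'
  obtain ⟨ha, hb⟩ := hx.2 r hr hrp hrq
  refine ⟨p, hp, q, hq, r, hr, hpq, hrp.symm, hrq.symm, ?_, ?_⟩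
  · rw [hx.1]; linarith
  · have sh : ∀ s ∈ Finset.insertNone Y, |pv n s x - pv n s (x + z)| ≤ D := by
      intro s hs
      rw [pv_shift, show pv n s x - (pv n s x + lin s ⬝ᵥ z) = - (lin s ⬝ᵥ z) by ring, abs_neg]
      exact hz s hs
    by_cases hc : rel n r (x + z) (pv n p (x + z))
    · have := rel_near hb (hrel hc) (sh q hq) (sh r hr)
      have h0 := hx.1
      rw [abs_le] at *
      omega
    · have := rel_near ha hc (sh p hp) (sh r hr)
      have := (abs_nonneg k).trans hk
      linarith

lemma UU_shift {Y : Finset (Fin 4 → ℤ)} {C : ℤ} (hY : CoreHyp Y C) {K k k' M : ℤ} {ξ : Fin 4 → ℤ}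
    {p q : Option (Fin 4 → ℤ)} (hp : p ∈ Finset.insertNone Y) (hq : q ∈ Finset.insertNone Y)
    (hpq : p ≠ q) (hk : |k| ≤ K) (hk' : |k'| ≤ K) (hM : C * (1 + K) ≤ M) (z : Fin 4 → ℤ)
    (hκ : (lin p - lin q) ⬝ᵥ z = k' - k) :
    O2 (fun n => UU Y M ξ p q k' n - sg (ξ ⬝ᵥ z) * UU Y M ξ p q k n) := by
  classical
  set D : ℤ := ∑ r ∈ Finset.insertNone Y, |lin r ⬝ᵥ z| with hD
  have hz : ∀ r ∈ Finset.insertNone Y, |lin r ⬝ᵥ z| ≤ D := fun r hr =>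
    Finset.single_le_sum (f := fun r => |lin r ⬝ᵥ z|) (fun _ _ => abs_nonneg _) hr
  have hO := (excp_O2 hY (2 * D + K) M).const_mul 2
  refine hO.mono ?_
  filter_upwards [eventually_ge_atTop 1] with n hn
  set B := (TT Y M p q k n).image (fun x => x + z) with hB
  have e1 : sg (ξ ⬝ᵥ z) * UU Y M ξ p q k n = ∑ x ∈ B, sg (ξ ⬝ᵥ x) := by
    rw [hB, Finset.sum_image (by intro a _ b _ h; simpa using h), UU, Finset.mul_sum]
    refine Finset.sum_congr rfl fun x _ => ?_
    rw [dotProduct_add, sg_add, mul_comm]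
  rw [e1, UU]
  refine (sum_sdiff_bound _ _ (fun x => sg (ξ ⬝ᵥ x)) (fun x => (sg_abs _).le)).trans ?_
  refine le_trans ?_ (le_abs_self _)
  have c1 : (TT Y M p q k' n \ B).card ≤ (excp Y (2 * D + K) M n).card := by
    apply Finset.card_le_card
    intro x hx
    rw [Finset.mem_sdiff] at hx
    obtain ⟨hx1, hx2⟩ := hx
    have hx3 : ¬ TC Y n p q k (x + -z) := by
      intro h
      apply hx2
      rw [hB, Finset.mem_image]
      exact ⟨x + -z, (mem_TT hY hpq hk hn hM).mpr h, by simp⟩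
    refine shift_fail hp hq hpq hk' ?_ ?_ ((mem_TT hY hpq hk' hn hM).mp hx1) hx3
      (Finset.mem_filter.mp hx1).1
    · intro r hr; rw [dotProduct_neg, abs_neg]; exact hz r hr
    · rw [dotProduct_neg, hκ]; ring
  have c2 : (B \ TT Y M p q k' n).card ≤ (excp Y (2 * D + K) M n).card := by
    have : B \ TT Y M p q k' n ⊆ (excp Y (2 * D + K) M n).image (fun x => x + z) := by
      intro x hx
      rw [Finset.mem_sdiff, hB, Finset.mem_image] at hx
      obtain ⟨⟨x', hx', rfl⟩, hx2⟩ := hx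
      rw [Finset.mem_image]
      refine ⟨x', ?_, rfl⟩
      rw [mem_TT hY hpq hk' hn hM] at hx2
      exact shift_fail hp hq hpq hk hz hκ ((mem_TT hY hpq hk hn hM).mp hx') hx2
        (Finset.mem_filter.mp hx').1
    exact (Finset.card_le_card this).trans Finset.card_image_le
  have c1' : (((TT Y M p q k' n \ B).card : ℕ) : ℤ) ≤ ((excp Y (2 * D + K) M n).card : ℤ) := by
    exact_mod_cast c1
  have c2' : (((B \ TT Y M p q k' n).card : ℕ) : ℤ) ≤ ((excp Y (2 * D + K) M n).card : ℤ) := by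
    exact_mod_cast c2
  linarith

end

section


/-- lattice length (content) of an integer vector -/
def gl (d : Fin 4 → ℤ) : ℤ := Finset.univ.gcd d
/-- primitive vector in the direction of `d` -/
def prv (d : Fin 4 → ℤ) : Fin 4 → ℤ := fun i => d i / gl d

lemma gl_dvd (d : Fin 4 → ℤ) (i : Fin 4) : gl d ∣ d i := Finset.gcd_dvd (Finset.mem_univ i)

lemma gl_pos {d : Fin 4 → ℤ} (hd : d ≠ 0) : 1 ≤ gl d := by
  have h0 : gl d ≠ 0 := by
    intro h
    apply hd
    rw [gl, Finset.gcd_eq_zero_iff] at h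
    funext i; exact h i (Finset.mem_univ i)
  have h1 : 0 ≤ gl d := by
    have : normalize (gl d) = gl d := Finset.normalize_gcd
    rw [← this, ← Int.abs_eq_normalize]; exact abs_nonneg _
  omega

lemma gl_smul (d : Fin 4 → ℤ) : d = gl d • prv d := by
  funext i
  simp [prv, Int.mul_ediv_cancel' (gl_dvd d i)]

lemma prv_prim {d : Fin 4 → ℤ} (hd : d ≠ 0) : ∃ z, prv d ⬝ᵥ z = 1 := by
  obtain ⟨g, hg⟩ := Finset.gcd_eq_sum_mul Finset.univ d
  refine ⟨g, ?_⟩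
  have h1 : d ⬝ᵥ g = gl d := by
    rw [gl, hg, dotProduct]
  have h2 := gl_pos hd
  rw [gl_smul d, smul_dotProduct, ← gl_smul d, smul_eq_mul] at h1
  have : gl d * (prv d ⬝ᵥ g) = gl d * 1 := by rw [h1, mul_one]
  exact mul_left_cancel₀ (by omega) this

lemma gl_eq_one {d : Fin 4 → ℤ} (h : ∃ z, d ⬝ᵥ z = 1 ∨ d ⬝ᵥ z = -1) : gl d = 1 := by
  obtain ⟨z, hz⟩ := h
  have hd : d ≠ 0 := by rintro rfl; simp at hz
  have h1 := gl_pos hd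
  have h2 : gl d ∣ d ⬝ᵥ z := Finset.dvd_sum fun i _ => Dvd.dvd.mul_right (gl_dvd d i) _
  have h3 : gl d ∣ 1 := by rcases hz with h | h <;> rw [h] at h2 <;> simpa using h2
  exact le_antisymm (Int.le_of_dvd one_pos h3) h1

/-- resonance of a character with a wall -/
def res (ξ d : Fin 4 → ℤ) : Prop := ∀ i, Even (ξ i - prv d i)

lemma res_dot {ξ d : Fin 4 → ℤ} (h : res ξ d) (x : Fin 4 → ℤ) : Even (ξ ⬝ᵥ x - prv d ⬝ᵥ x) := by
  rw [← sub_dotProduct]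
  refine Finset.even_sum _ fun i _ => Even.mul_right (h i) _

lemma res_sg {ξ d : Fin 4 → ℤ} (h : res ξ d) (x : Fin 4 → ℤ) : sg (ξ ⬝ᵥ x) = sg (prv d ⬝ᵥ x) := by
  have := sg_add (ξ ⬝ᵥ x - prv d ⬝ᵥ x) (prv d ⬝ᵥ x)
  rw [sg_even (res_dot h x)] at this
  simpa using this

lemma dot_single_sub (a z : Fin 4 → ℤ) (i : Fin 4) (t : ℤ) :
    a ⬝ᵥ (Pi.single i 1 - t • z) = a i - t * (a ⬝ᵥ z) := by
  rw [dotProduct_sub, dotProduct_smul, dotProduct_single, mul_one, smul_eq_mul]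

lemma nonres_vec {ξ d : Fin 4 → ℤ} (hd : d ≠ 0) (hξ : ∃ i, Odd (ξ i)) (h : ¬ res ξ d) :
    ∃ z, prv d ⬝ᵥ z = 0 ∧ Odd (ξ ⬝ᵥ z) := by
  obtain ⟨z1, hz1⟩ := prv_prim hd
  by_cases hev : Even (ξ ⬝ᵥ z1)
  · obtain ⟨j, hj⟩ := hξ
    refine ⟨Pi.single j 1 - prv d j • z1, ?_, ?_⟩
    · rw [dot_single_sub, hz1]; ring
    · rw [dot_single_sub]; exact hj.sub_even (hev.mul_left _)
  · simp only [res, not_forall] at h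
    obtain ⟨i, hi⟩ := h
    refine ⟨Pi.single i 1 - prv d i • z1, ?_, ?_⟩
    · rw [dot_single_sub, hz1]; ring
    · rw [dot_single_sub]
      rw [Int.not_even_iff_odd] at hi hev
      obtain ⟨a, ha⟩ := hi
      obtain ⟨b, hb⟩ := hev
      refine ⟨a - prv d i * b, ?_⟩
      rw [hb]; linear_combination ha

section
lemma UU_nonres {Y : Finset (Fin 4 → ℤ)} {C : ℤ} (hY : CoreHyp Y C) {K M : ℤ} {ξ : Fin 4 → ℤ}
    {p q : Option (Fin 4 → ℤ)} (hp : p ∈ Finset.insertNone Y) (hq : q ∈ Finset.insertNone Y)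
    (hpq : p ≠ q) (hM : C * (1 + K) ≤ M) (hd : lin p - lin q ≠ 0)
    (hξ : ∃ i, Odd (ξ i)) (h : ¬ res ξ (lin p - lin q)) (k : ℤ) (hk : |k| ≤ K) :
    O2 (UU Y M ξ p q k) := by
  obtain ⟨z, hz, hodd⟩ := nonres_vec hd hξ h
  have h1 := UU_shift hY hp hq hpq hk hk hM z (ξ := ξ) (by
    rw [gl_smul (lin p - lin q), smul_dotProduct, hz]; simp)
  refine h1.mono (Eventually.of_forall fun n => ?_)
  rw [sg_odd hodd]
  rw [show UU Y M ξ p q k n - -1 * UU Y M ξ p q k n = 2 * UU Y M ξ p q k n by ring, abs_mul]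
  have := abs_nonneg (UU Y M ξ p q k n)
  norm_num
  linarith

lemma UU_res {Y : Finset (Fin 4 → ℤ)} {C : ℤ} (hY : CoreHyp Y C) {K M : ℤ} {ξ : Fin 4 → ℤ}
    {p q : Option (Fin 4 → ℤ)} (hp : p ∈ Finset.insertNone Y) (hq : q ∈ Finset.insertNone Y)
    (hpq : p ≠ q) (hM : C * (1 + K) ≤ M) (hd : lin p - lin q ≠ 0)
    (h : res ξ (lin p - lin q)) (j : ℤ) (hk : |gl (lin p - lin q) * j| ≤ K) :
    O2 (fun n => UU Y M ξ p q (gl (lin p - lin q) * j) n - sg j * UU Y M ξ p q 0 n) := by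
  obtain ⟨z1, hz1⟩ := prv_prim hd
  have h1 := UU_shift hY hp hq hpq (k := 0) (by simpa using (abs_nonneg _).trans hk) hk hM (j • z1)
    (ξ := ξ) (by
      rw [dotProduct_smul]
      nth_rewrite 1 [gl_smul (lin p - lin q)]
      rw [smul_dotProduct, hz1]; simp; ring)
  rw [res_sg h, dotProduct_smul, hz1] at h1
  simpa using h1

lemma UU_zero {Y : Finset (Fin 4 → ℤ)} {C : ℤ} (hY : CoreHyp Y C) {M : ℤ} {ξ : Fin 4 → ℤ}
    {p q : Option (Fin 4 → ℤ)} (hd : lin p - lin q ≠ 0)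
    (hp : p ∈ Finset.insertNone Y) (hq : q ∈ Finset.insertNone Y) 
    (h : res ξ (lin p - lin q)) (n : ℕ) (hn : Even n) :
    UU Y M ξ p q 0 n = (TT Y M p q 0 n).card := by
  classical
  rw [UU]
  have : ∀ x ∈ TT Y M p q 0 n, sg (ξ ⬝ᵥ x) = 1 := by
    intro x hx
    have h1 := (Finset.mem_filter.mp hx).2.1
    rw [res_sg h]
    apply sg_even
    have hl := gl_pos hd
    have h2 : gl (lin p - lin q) * (prv (lin p - lin q) ⬝ᵥ x) = - ((cn p - cn q) * n) := by
      rw [← smul_eq_mul, ← smul_dotProduct, ← gl_smul, sub_dotProduct]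
      simp only [pv] at h1
      linarith
    have hnz : Even (n : ℤ) := by exact_mod_cast hn
    have hc : cn p = cn q ∨ gl (lin p - lin q) = 1 := by
      rcases p with _ | p <;> rcases q with _ | q
      · left; rfl
      · right
        obtain ⟨z, hz⟩ := hY.prim q (by simpa using hq)
        exact gl_eq_one ⟨z, Or.inl (by simpa [lin] using hz)⟩
      · right
        obtain ⟨z, hz⟩ := hY.prim p (by simpa using hp)
        exact gl_eq_one ⟨z, Or.inr (by simpa [lin] using hz)⟩
      · left; rfl
    rcases hc with hc | hc
    · rw [hc, sub_self, zero_mul, neg_zero] at h2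
      rw [(mul_eq_zero.mp h2).resolve_left (by omega)]
      exact Even.zero
    · rw [hc, one_mul] at h2
      rw [h2]
      exact (hnz.mul_left _).neg
  rw [Finset.sum_congr rfl this]
  simp

end

/-- weighted wall sum -/
def WW (Y : Finset (Fin 4 → ℤ)) (M J : ℤ) (ξ c : Fin 4 → ℤ) (p q : Option (Fin 4 → ℤ)) (n : ℕ) : ℤ :=
  ∑ j ∈ Finset.Icc (-J) J, ∑ x ∈ TT Y M p q (gl (lin p - lin q) * j) n, sg (ξ ⬝ᵥ x) *
    (|gl (lin p - lin q) * j + (lin p - lin q) ⬝ᵥ c| + |gl (lin p - lin q) * j -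
      (lin p - lin q) ⬝ᵥ c| - 2 * |gl (lin p - lin q) * j|)

lemma WW_eq (Y : Finset (Fin 4 → ℤ)) (M J : ℤ) (ξ c : Fin 4 → ℤ) (p q : Option (Fin 4 → ℤ))
    (hd : lin p - lin q ≠ 0) (n : ℕ) :
    WW Y M J ξ c p q n = ∑ j ∈ Finset.Icc (-J) J, (gl (lin p - lin q) *
      (|j + prv (lin p - lin q) ⬝ᵥ c| + |j - prv (lin p - lin q) ⬝ᵥ c| - 2 * |j|)) *
      UU Y M ξ p q (gl (lin p - lin q) * j) n := by
  rw [WW]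
  refine Finset.sum_congr rfl fun j _ => ?_
  rw [← Finset.sum_mul, UU, mul_comm]
  congr 1
  have h1 : (lin p - lin q) ⬝ᵥ c = gl (lin p - lin q) * (prv (lin p - lin q) ⬝ᵥ c) := by
    rw [← smul_eq_mul, ← smul_dotProduct, ← gl_smul]
  have h2 : ∀ a : ℤ, |gl (lin p - lin q) * a| = gl (lin p - lin q) * |a| := by
    intro a
    rw [abs_mul, abs_of_nonneg]
    have := gl_pos hd
    omega
  rw [h1, ← mul_add, ← mul_sub, h2, h2, h2]
  ring

lemma WW_asymp {Y : Finset (Fin 4 → ℤ)} {C : ℤ} (hY : CoreHyp Y C) {K M J : ℤ} {ξ c : Fin 4 → ℤ}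
    {p q : Option (Fin 4 → ℤ)} (hp : p ∈ Finset.insertNone Y) (hq : q ∈ Finset.insertNone Y)
    (hpq : p ≠ q) (hM : C * (1 + K) ≤ M) (hd : lin p - lin q ≠ 0)
    (hJ : |prv (lin p - lin q) ⬝ᵥ c| ≤ J) (hK : gl (lin p - lin q) * J ≤ K)
    (hξ : ∃ i, Odd (ξ i)) (hc : Odd (ξ ⬝ᵥ c)) :
    (res ξ (lin p - lin q) → O2 (fun n => WW Y M J ξ c p q n -
      2 * gl (lin p - lin q) * UU Y M ξ p q 0 n)) ∧
    (¬ res ξ (lin p - lin q) → O2 (fun n => WW Y M J ξ c p q n)) := by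
  have hl := gl_pos hd
  have hjK : ∀ j ∈ Finset.Icc (-J) J, |gl (lin p - lin q) * j| ≤ K := by
    intro j hj
    rw [Finset.mem_Icc, ← abs_le] at hj
    rw [abs_mul, abs_of_nonneg (by omega : 0 ≤ gl (lin p - lin q))]
    exact (mul_le_mul_of_nonneg_left hj (by omega)).trans hK
  constructor
  · intro h
    have hodd : Odd (prv (lin p - lin q) ⬝ᵥ c) := by
      have := res_dot h c
      have h2 := hc.sub_even this
      simpa using h2
    have h1 := O2.sum (s := Finset.Icc (-J) J) fun j hj =>
      (UU_res hY hp hq hpq hM hd h j (hjK j hj)).const_mul (gl (lin p - lin q) *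
      (|j + prv (lin p - lin q) ⬝ᵥ c| + |j - prv (lin p - lin q) ⬝ᵥ c| - 2 * |j|))
    refine h1.congr (Eventually.of_forall fun n => ?_)
    rw [WW_eq _ _ _ _ _ _ _ hd]
    have h3 := alt_tent_odd _ hodd J hJ
    simp only [mul_sub _ (UU Y M ξ p q (gl (lin p - lin q) * _) n)]
    rw [Finset.sum_sub_distrib]
    congr 1
    rw [mul_comm 2, ← h3, Finset.mul_sum, Finset.sum_mul]
    refine Finset.sum_congr rfl fun j _ => ?_
    rw [h3]
    ring
  · intro h
    have h1 := O2.sum (s := Finset.Icc (-J) J) fun j hj =>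
      (UU_nonres hY hp hq hpq hM hd hξ h _ (hjK j hj)).const_mul (gl (lin p - lin q) *
      (|j + prv (lin p - lin q) ⬝ᵥ c| + |j - prv (lin p - lin q) ⬝ᵥ c| - 2 * |j|))
    refine h1.congr (Eventually.of_forall fun n => ?_)
    rw [WW_eq _ _ _ _ _ _ _ hd]

end

section


/-! ## The second difference formula -/

open Classical in
/-- the support function of `Y` -/
def fY (Y : Finset (Fin 4 → ℤ)) (x : Fin 4 → ℤ) : ℤ :=
  if h : Y.Nonempty then Y.sup' h (fun y => y ⬝ᵥ x) else 0

lemma CoreHyp.nonempty {Y : Finset (Fin 4 → ℤ)} {C : ℤ} (hY : CoreHyp Y C) : Y.Nonempty := by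
  obtain ⟨y, hy, _⟩ := hY.bd 0 0
  exact ⟨y, hy⟩

lemma fY_le {Y : Finset (Fin 4 → ℤ)} {x y : Fin 4 → ℤ} (hy : y ∈ Y) : y ⬝ᵥ x ≤ fY Y x := by
  rw [fY, dif_pos ⟨y, hy⟩]
  exact Finset.le_sup' (fun y => y ⬝ᵥ x) hy

lemma fY_mem {Y : Finset (Fin 4 → ℤ)} (hY : Y.Nonempty) (x : Fin 4 → ℤ) :
    ∃ y ∈ Y, fY Y x = y ⬝ᵥ x := by
  rw [fY, dif_pos hY]
  exact Finset.exists_mem_eq_sup' hY _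

lemma fY_eq {Y : Finset (Fin 4 → ℤ)} {x y : Fin 4 → ℤ} (hy : y ∈ Y)
    (h : ∀ y' ∈ Y, y' ⬝ᵥ x ≤ y ⬝ᵥ x) : fY Y x = y ⬝ᵥ x := by
  obtain ⟨z, hz, hz'⟩ := fY_mem ⟨y, hy⟩ x
  exact le_antisymm (hz' ▸ h z hz) (fY_le hy)

/-- truncated height function -/
def phi (Y : Finset (Fin 4 → ℤ)) (n : ℤ) (x : Fin 4 → ℤ) : ℤ := max 0 (n - fY Y x)

/-- sign of a wall -/
def eps (p q : Option (Fin 4 → ℤ)) : ℤ := if p = none ∨ q = none then 1 else -1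

lemma eps_comm (p q : Option (Fin 4 → ℤ)) : eps p q = eps q p := by
  simp [eps, or_comm]

/-- second difference of `|·|` -/
def tt (n : ℤ) (c : Fin 4 → ℤ) (p q : Option (Fin 4 → ℤ)) (x : Fin 4 → ℤ) : ℤ :=
  |pv n p x - pv n q x + (lin p - lin q) ⬝ᵥ c| + |pv n p x - pv n q x - (lin p - lin q) ⬝ᵥ c|
    - 2 * |pv n p x - pv n q x|

lemma tt_comm (n : ℤ) (c : Fin 4 → ℤ) (p q : Option (Fin 4 → ℤ)) (x : Fin 4 → ℤ) :
    tt n c p q x = tt n c q p x := by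
  simp only [tt, sub_dotProduct]
  rw [abs_sub_comm (pv n p x) (pv n q x), ← abs_neg (pv n p x - pv n q x + _),
    ← abs_neg (pv n p x - pv n q x - _)]
  congr 1
  congr 1 <;> congr 1 <;> ring

lemma tt_zero {n D : ℤ} {c : Fin 4 → ℤ} {p q : Option (Fin 4 → ℤ)} {x : Fin 4 → ℤ}
    (hp : |lin p ⬝ᵥ c| ≤ D) (hq : |lin q ⬝ᵥ c| ≤ D) (h : 2 * D ≤ |pv n p x - pv n q x|) :
    tt n c p q x = 0 := by
  simp only [tt, sub_dotProduct]
  rw [abs_le] at hp hq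
  simp only [abs_eq_max_neg] at *
  omega

lemma tt_le {n D : ℤ} {c : Fin 4 → ℤ} {p q : Option (Fin 4 → ℤ)} {x : Fin 4 → ℤ}
    (hp : |lin p ⬝ᵥ c| ≤ D) (hq : |lin q ⬝ᵥ c| ≤ D) : |tt n c p q x| ≤ 4 * D := by
  simp only [tt, sub_dotProduct]
  rw [abs_le] at hp hq
  simp only [abs_eq_max_neg] at *
  omega

open Classical in
/-- contribution of a wall at a point -/
def wt (Y : Finset (Fin 4 → ℤ)) (n : ℤ) (c : Fin 4 → ℤ) (p q : Option (Fin 4 → ℤ))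
    (x : Fin 4 → ℤ) : ℤ :=
  if p ≠ q ∧ TC Y n p q (pv n p x - pv n q x) x then eps p q * tt n c p q x else 0

lemma wt_comm (Y : Finset (Fin 4 → ℤ)) (n : ℤ) (c : Fin 4 → ℤ) (p q : Option (Fin 4 → ℤ))
    (x : Fin 4 → ℤ) : wt Y n c p q x = wt Y n c q p x := by
  simp only [wt, eps_comm p q, tt_comm n c p q]
  congr 1
  simp only [TC, true_and, eq_iff_iff]
  constructor
  · rintro ⟨h, h'⟩; exact ⟨h.symm, fun r a b c => (h' r a c b).symm⟩
  · rintro ⟨h, h'⟩; exact ⟨h.symm, fun r a b c => (h' r a c b).symm⟩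

lemma sum_pair {P : Finset (Option (Fin 4 → ℤ))} {w : Option (Fin 4 → ℤ) → Option (Fin 4 → ℤ) → ℤ}
    {a b : Option (Fin 4 → ℤ)} (ha : a ∈ P) (hb : b ∈ P) (hab : a ≠ b)
    (hw : ∀ p ∈ P, ∀ q ∈ P, w p q ≠ 0 → (p = a ∧ q = b) ∨ (p = b ∧ q = a)) :
    ∑ p ∈ P, ∑ q ∈ P, w p q = w a b + w b a := by
  have h : ∀ p ∈ P, ∀ q ∈ P, w p q = (if p = a then (if q = b then w a b else 0) else 0) +
      (if p = b then (if q = a then w b a else 0) else 0) := by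
    intro p hp q hq
    by_cases h0 : w p q = 0
    · rw [h0]
      split_ifs <;> simp_all
    · rcases hw p hp q hq h0 with ⟨rfl, rfl⟩ | ⟨rfl, rfl⟩
      · simp [hab]
      · simp [hab.symm]
  rw [Finset.sum_congr rfl fun p hp => Finset.sum_congr rfl (h p hp)]
  simp only [Finset.sum_add_distrib]
  congr 1
  · rw [Finset.sum_eq_single a] <;> simp +contextual [ha, hb]
  · rw [Finset.sum_eq_single b] <;> simp +contextual [ha, hb]

/-- second difference -/
def dd (F : (Fin 4 → ℤ) → ℤ) (c x : Fin 4 → ℤ) : ℤ := F (x + c) + F (x - c) - 2 * F x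

lemma second_diff {Y : Finset (Fin 4 → ℤ)} (hYne : Y.Nonempty) {n D : ℤ} {c x : Fin 4 → ℤ}
    (hD : ∀ y ∈ Y, |y ⬝ᵥ c| ≤ D)
    (hx : ¬ ∃ p ∈ Finset.insertNone Y, ∃ q ∈ Finset.insertNone Y,
      ∃ r ∈ Finset.insertNone Y, p ≠ q ∧ p ≠ r ∧ q ≠ r ∧ |pv n p x - pv n q x| ≤ 4 * D ∧
      |pv n p x - pv n r x| ≤ 4 * D) :
    4 * dd (phi Y n) c x = ∑ p ∈ Finset.insertNone Y, ∑ q ∈ Finset.insertNone Y, wt Y n c p q x := by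
  classical
  obtain ⟨y₁, hy1, hf⟩ := fY_mem hYne x
  have hD0 : 0 ≤ D := (abs_nonneg _).trans (hD y₁ hy1)
  have hmin : ∀ y ∈ Y, y ⬝ᵥ x ≤ y₁ ⬝ᵥ x := fun y hy => hf ▸ fY_le hy
  have hsome : ∀ y ∈ Y, some y ∈ Finset.insertNone Y := fun y hy => by simpa using hy
  have hnone : none ∈ Finset.insertNone Y := by simp
  have tri1 : ∀ y ∈ Y, ∀ y' ∈ Y, y ≠ y' → |n - y ⬝ᵥ x| ≤ 4 * D → |n - y' ⬝ᵥ x| ≤ 4 * D → False := by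
    intro y hy y' hy' h h1 h2
    apply hx
    refine ⟨none, hnone, some y, hsome y hy, some y', hsome y' hy', by simp, by simp, by simpa using h,
      ?_, ?_⟩ <;> rw [pv_none, pv_some, abs_sub_comm, sub_zero] <;> assumption
  have tri2 : ∀ y ∈ Y, ∀ y' ∈ Y, y ≠ y₁ → y' ≠ y₁ → y ≠ y' → y₁ ⬝ᵥ x - y ⬝ᵥ x ≤ 4 * D →
      y₁ ⬝ᵥ x - y' ⬝ᵥ x ≤ 4 * D → False := by
    intro y hy y' hy' ha hb h h1 h2
    apply hx
    have := hmin y hy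
    have := hmin y' hy'
    refine ⟨some y₁, hsome _ hy1, some y, hsome y hy, some y', hsome y' hy', by simpa using ha.symm,
      by simpa using hb.symm, by simpa using h, ?_, ?_⟩ <;> rw [pv_some, pv_some, abs_le] <;>
      constructor <;> linarith
  have hlin : ∀ r ∈ Finset.insertNone Y, |lin r ⬝ᵥ c| ≤ D := by
    rintro (_ | y) hr
    · simpa [lin] using hD0
    · simpa [lin] using hD y (by simpa using hr)
  -- what a nonzero contribution means
  have act : ∀ p ∈ Finset.insertNone Y, ∀ q ∈ Finset.insertNone Y, wt Y n c p q x ≠ 0 →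
      p ≠ q ∧ |pv n p x - pv n q x| < 2 * D ∧ ∀ r ∈ Finset.insertNone Y, r ≠ p → r ≠ q →
        rel n r x (pv n p x) ∧ rel n r x (pv n q x) := by
    intro p hp q hq hw
    rw [wt] at hw
    split_ifs at hw with h
    · refine ⟨h.1, ?_, h.2.2⟩
      by_contra hc
      exact hw (by rw [tt_zero (hlin p hp) (hlin q hq) (not_lt.mp hc), mul_zero])
    · exact absurd rfl hw
  have act_some : ∀ y ∈ Y, ∀ y' ∈ Y, wt Y n c (some y) (some y') x ≠ 0 → y ≠ y' ∧
      0 ≤ n - y₁ ⬝ᵥ x ∧ y₁ ⬝ᵥ x - y ⬝ᵥ x < 2 * D ∧ y₁ ⬝ᵥ x - y' ⬝ᵥ x < 2 * D ∧ (y = y₁ ∨ y' = y₁) := by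
    intro y hy y' hy' hw
    obtain ⟨h1, h2, h3⟩ := act _ (hsome y hy) _ (hsome y' hy') hw
    have h4 := h3 none hnone (by simp) (by simp)
    have hm := hmin y hy
    have hm' := hmin y' hy'
    simp only [rel, pv_some] at h4 h2
    have hne : y ≠ y' := by simpa using h1
    by_cases ha : y = y₁
    · subst ha
      refine ⟨hne, h4.1, by rw [abs_lt] at h2; omega, by rw [abs_lt] at h2; omega, Or.inl rfl⟩
    · by_cases hb : y' = y₁
      · subst hb
        refine ⟨hne, h4.2, by rw [abs_lt] at h2; omega, by rw [abs_lt] at h2; omega, Or.inr rfl⟩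
      · exfalso
        have h5 := h3 (some y₁) (hsome _ hy1) (by simpa using Ne.symm ha) (by simpa using Ne.symm hb)
        simp only [rel, pv_some] at h5
        exact tri2 y hy y' hy' ha hb hne (by omega) (by omega)
  have act_none : ∀ y ∈ Y, wt Y n c none (some y) x ≠ 0 →
      |n - y ⬝ᵥ x| < 2 * D ∧ (y ≠ y₁ → 0 ≤ n - y₁ ⬝ᵥ x ∧ y ⬝ᵥ x = y₁ ⬝ᵥ x) := by
    intro y hy hw
    obtain ⟨h1, h2, h3⟩ := act _ hnone _ (hsome y hy) hw
    rw [pv_none, pv_some, abs_sub_comm, sub_zero] at h2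
    refine ⟨h2, fun hne => ?_⟩
    have h4 := h3 (some y₁) (hsome _ hy1) (by simp) (by simpa using hne.symm)
    have hm := hmin y hy
    simp only [rel, pv_some, pv_none] at h4
    constructor <;> omega
  have zero_none : wt Y n c none none x = 0 := by simp [wt]
  -- value of `fY` at a neighbouring point
  have near : ∀ s : ℤ, |s| ≤ 1 → ∀ y ∈ Y, |y ⬝ᵥ (x + s • c) - y ⬝ᵥ x| ≤ D := by
    intro s hs y hy
    rw [dotProduct_add, dotProduct_smul, add_sub_cancel_left, smul_eq_mul, abs_mul]
    have := hD y hy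
    nlinarith [abs_nonneg (y ⬝ᵥ c), abs_nonneg s]
  have ddeq : dd (phi Y n) c x = phi Y n (x + (1:ℤ) • c) + phi Y n (x + (-1:ℤ) • c) -
      2 * phi Y n (x + (0:ℤ) • c) := by
    simp [dd, sub_eq_add_neg]
  have dotv : ∀ (y : Fin 4 → ℤ) (s : ℤ), y ⬝ᵥ (x + s • c) = y ⬝ᵥ x + s * (y ⬝ᵥ c) := by
    intro y s
    rw [dotProduct_add, dotProduct_smul, smul_eq_mul]
  rcases lt_or_ge (n - y₁ ⬝ᵥ x) (-2 * D) with hm | hm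
  · -- far outside
    have hl : ∀ s : ℤ, |s| ≤ 1 → phi Y n (x + s • c) = 0 := by
      intro s hs
      have h1 := near s hs y₁ hy1
      have h2 := fY_le (x := x + s • c) hy1
      rw [abs_le] at h1
      rw [phi, max_eq_left]
      omega
    rw [ddeq, hl 1 (by simp), hl (-1) (by simp), hl 0 (by simp)]
    symm
    rw [show (4:ℤ) * (0 + 0 - 2 * 0) = 0 by norm_num]
    have key : ∀ y ∈ Y, wt Y n c none (some y) x = 0 := by
      intro y hy
      by_contra hw
      obtain ⟨h1, h2⟩ := act_none y hy hw
      by_cases he : y = y₁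
      · subst he; rw [abs_lt] at h1; omega
      · have := h2 he; omega
    refine Finset.sum_eq_zero fun p hp => Finset.sum_eq_zero fun q hq => ?_
    rcases p with _ | p <;> rcases q with _ | q
    · exact zero_none
    · exact key q (by simpa using hq)
    · rw [wt_comm]; exact key p (by simpa using hp)
    · by_contra hw
      have := act_some p (by simpa using hp) q (by simpa using hq) hw
      omega
  rcases le_or_gt (n - y₁ ⬝ᵥ x) (2 * D) with hm2 | hm2
  · -- near the boundary
    have sep : ∀ y ∈ Y, y ≠ y₁ → n - y₁ ⬝ᵥ x + 2 * D < n - y ⬝ᵥ x := by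
      intro y hy hne
      by_contra hc
      have := hmin y hy
      exact tri1 y hy y₁ hy1 hne (by rw [abs_le]; constructor <;> omega)
        (by rw [abs_le]; constructor <;> omega)
    have hl : ∀ s : ℤ, |s| ≤ 1 → phi Y n (x + s • c) = max 0 (n - y₁ ⬝ᵥ x - s * (y₁ ⬝ᵥ c)) := by
      intro s hs
      have h1 : fY Y (x + s • c) = y₁ ⬝ᵥ (x + s • c) := by
        refine fY_eq hy1 fun y hy => ?_
        by_cases he : y = y₁
        · rw [he]
        · have h2 := near s hs y₁ hy1
          have h3 := near s hs y hy
          have := sep y hy he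
          rw [abs_le] at h2 h3
          omega
      rw [phi, h1, dotv]; congr 1; ring
    rw [sum_pair hnone (hsome _ hy1) (by simp), wt_comm Y n c (some y₁) none]
    · have hTC : TC Y n none (some y₁) (pv n none x - pv n (some y₁) x) x := by
        refine ⟨rfl, ?_⟩
        rintro (_ | r) hr h1 h2
        · exact absurd rfl h1
        · have := sep r (by simpa using hr) (by simpa using h2)
          simp only [rel, pv_none, pv_some]
          omega
      rw [wt, if_pos ⟨by simp, hTC⟩, ddeq, hl 1 (by simp), hl (-1) (by simp), hl 0 (by simp)]
      simp only [eps, tt, pv_none, pv_some, lin, sub_dotProduct, Option.elim, zero_dotProduct,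
        neg_dotProduct, true_or, if_true]
      simp only [abs_eq_max_neg]
      omega
    · intro p hp q hq hw
      rcases p with _ | p <;> rcases q with _ | q
      · exact absurd zero_none hw
      · left
        refine ⟨rfl, ?_⟩
        obtain ⟨h1, h2⟩ := act_none q (by simpa using hq) hw
        by_contra hc
        have hc' : q ≠ y₁ := by simpa using hc
        have h3 := sep q (by simpa using hq) hc'
        have := h2 hc'
        omega
      · right
        refine ⟨?_, rfl⟩
        rw [wt_comm] at hw
        obtain ⟨h1, h2⟩ := act_none p (by simpa using hp) hw
        by_contra hc
        have hc' : p ≠ y₁ := by simpa using hc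
        have h3 := sep p (by simpa using hp) hc'
        have := h2 hc'
        omega
      · exfalso
        have hp' : p ∈ Y := by simpa using hp
        have hq' : q ∈ Y := by simpa using hq
        obtain ⟨h1, h2, h3, h4, h5⟩ := act_some p hp' q hq' hw
        rcases h5 with rfl | rfl
        · have := sep q hq' h1.symm; omega
        · have := sep p hp' h1; omega
  -- deep inside
  have noneZ : ∀ y ∈ Y, wt Y n c none (some y) x = 0 := by
    intro y hy
    by_contra hw
    obtain ⟨h1, h2⟩ := act_none y hy hw
    have := hmin y hy
    rw [abs_lt] at h1
    omega
  by_cases h2 : ∃ y₂ ∈ Y, y₂ ≠ y₁ ∧ y₁ ⬝ᵥ x - y₂ ⬝ᵥ x ≤ 2 * D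
  · obtain ⟨y₂, hy2, hne, hcl⟩ := h2
    have hm12 := hmin y₂ hy2
    have sep : ∀ y ∈ Y, y ≠ y₁ → y ≠ y₂ → 2 * D < y₁ ⬝ᵥ x - y ⬝ᵥ x := by
      intro y hy h1 h2
      by_contra hc
      exact tri2 y hy y₂ hy2 h1 hne h2 (by omega) (by omega)
    have hl : ∀ s : ℤ, |s| ≤ 1 → phi Y n (x + s • c) =
        min (n - y₁ ⬝ᵥ x - s * (y₁ ⬝ᵥ c)) (n - y₂ ⬝ᵥ x - s * (y₂ ⬝ᵥ c)) := by
      intro s hs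
      have a1 := near s hs y₁ hy1
      have a2 := near s hs y₂ hy2
      have h1 : fY Y (x + s • c) = max (y₁ ⬝ᵥ (x + s • c)) (y₂ ⬝ᵥ (x + s • c)) := by
        have others : ∀ y ∈ Y, y ⬝ᵥ (x + s • c) ≤ max (y₁ ⬝ᵥ (x + s • c)) (y₂ ⬝ᵥ (x + s • c)) := by
          intro y hy
          by_cases e1 : y = y₁
          · rw [e1]; exact le_max_left _ _
          by_cases e2 : y = y₂
          · rw [e2]; exact le_max_right _ _
          have h3 := near s hs y hy
          have := sep y hy e1 e2
          rw [abs_le] at a1 a2 h3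
          omega
        obtain ⟨y, hy, hy'⟩ := fY_mem hYne (x + s • c)
        apply le_antisymm
        · rw [hy']; exact others y hy
        · exact max_le (fY_le hy1) (fY_le hy2)
      rw [phi, h1]
      rw [abs_le] at a1 a2
      have b1 := dotv y₁ s
      have b2 := dotv y₂ s
      omega
    rw [sum_pair (hsome _ hy1) (hsome _ hy2) (by simpa using hne.symm), wt_comm Y n c (some y₂) (some y₁)]
    · have hTC : TC Y n (some y₁) (some y₂) (pv n (some y₁) x - pv n (some y₂) x) x := by
        refine ⟨rfl, ?_⟩
        rintro (_ | r) hr h1 h2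
        · simp only [rel, pv_some]; omega
        · have := sep r (by simpa using hr) (by simpa using h1) (by simpa using h2)
          simp only [rel, pv_some]
          omega
      rw [wt, if_pos ⟨by simpa using hne.symm, hTC⟩, ddeq, hl 1 (by simp), hl (-1) (by simp),
        hl 0 (by simp)]
      simp only [eps, tt, pv_some, lin, sub_dotProduct, Option.elim, reduceCtorEq,
        neg_dotProduct, or_self, if_false]
      simp only [abs_eq_max_neg]
      omega
    · intro p hp q hq hw
      rcases p with _ | p <;> rcases q with _ | q
      · exact absurd zero_none hw
      · exact absurd (noneZ q (by simpa using hq)) hw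
      · rw [wt_comm] at hw
        exact absurd (noneZ p (by simpa using hp)) hw
      · have hp' : p ∈ Y := by simpa using hp
        have hq' : q ∈ Y := by simpa using hq
        obtain ⟨h1, h2, h3, h4, h5⟩ := act_some p hp' q hq' hw
        rcases h5 with rfl | rfl
        · left
          refine ⟨rfl, ?_⟩
          by_contra hc
          have := sep q hq' h1.symm (by simpa using hc); omega
        · right
          refine ⟨?_, rfl⟩
          by_contra hc
          have := sep p hp' h1 (by simpa using hc); omega
  · push Not at h2
    have hl : ∀ s : ℤ, |s| ≤ 1 → phi Y n (x + s • c) = n - y₁ ⬝ᵥ x - s * (y₁ ⬝ᵥ c) := by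
      intro s hs
      have a1 := near s hs y₁ hy1
      have h1 : fY Y (x + s • c) = y₁ ⬝ᵥ (x + s • c) := by
        refine fY_eq hy1 fun y hy => ?_
        by_cases he : y = y₁
        · rw [he]
        · have h3 := near s hs y hy
          have := h2 y hy he
          rw [abs_le] at a1 h3
          omega
      rw [phi, h1]
      rw [abs_le] at a1
      have b1 := dotv y₁ s
      omega
    rw [ddeq, hl 1 (by simp), hl (-1) (by simp), hl 0 (by simp)]
    rw [Finset.sum_eq_zero fun p hp => Finset.sum_eq_zero fun q hq => ?_]
    · ring
    rcases p with _ | p <;> rcases q with _ | q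
    · exact zero_none
    · exact noneZ q (by simpa using hq)
    · rw [wt_comm]; exact noneZ p (by simpa using hp)
    · by_contra hw
      have hp' : p ∈ Y := by simpa using hp
      have hq' : q ∈ Y := by simpa using hq
      obtain ⟨h1, _, h3, h4, h5⟩ := act_some p hp' q hq' hw
      rcases h5 with rfl | rfl
      · have := h2 q hq' h1.symm; omega
      · have := h2 p hp' h1; omega

end

section


lemma lin_sub_ne {Y : Finset (Fin 4 → ℤ)} {C : ℤ} (hY : CoreHyp Y C)
    {p q : Option (Fin 4 → ℤ)} (hp : p ∈ Finset.insertNone Y) (hq : q ∈ Finset.insertNone Y)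
    (hpq : p ≠ q) : lin p - lin q ≠ 0 := by
  have h0 : ∀ y ∈ Y, y ≠ 0 := by
    rintro y hy rfl
    obtain ⟨x, hx⟩ := hY.prim 0 hy
    simp at hx
  rcases p with _ | p <;> rcases q with _ | q
  · exact absurd rfl hpq
  · simpa [lin] using h0 q (by simpa using hq)
  · simpa [lin] using h0 p (by simpa using hp)
  · simp only [lin, Option.elim]
    intro h
    apply hpq
    congr 1
    have : - p = - q := sub_eq_zero.mp h
    simpa using this

lemma gl_dvd_pv {Y : Finset (Fin 4 → ℤ)} {C : ℤ} (hY : CoreHyp Y C)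
    {p q : Option (Fin 4 → ℤ)} (hp : p ∈ Finset.insertNone Y) (hq : q ∈ Finset.insertNone Y)
    (n : ℤ) (x : Fin 4 → ℤ) : gl (lin p - lin q) ∣ pv n p x - pv n q x := by
  have hc : cn p = cn q ∨ gl (lin p - lin q) = 1 := by
    rcases p with _ | p <;> rcases q with _ | q
    · left; rfl
    · right
      obtain ⟨z, hz⟩ := hY.prim q (by simpa using hq)
      exact gl_eq_one ⟨z, Or.inl (by simpa [lin] using hz)⟩
    · right
      obtain ⟨z, hz⟩ := hY.prim p (by simpa using hp)
      exact gl_eq_one ⟨z, Or.inr (by simpa [lin] using hz)⟩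
    · left; rfl
  rcases hc with hc | hc
  · have : pv n p x - pv n q x = (lin p - lin q) ⬝ᵥ x := by
      simp only [pv, hc, sub_dotProduct]; ring
    rw [this]
    exact Finset.dvd_sum fun i _ => Dvd.dvd.mul_right (gl_dvd _ i) _
  · rw [hc]; exact one_dvd _

lemma pair_sum {Y : Finset (Fin 4 → ℤ)} {C : ℤ} (hY : CoreHyp Y C)
    {p q : Option (Fin 4 → ℤ)} (hp : p ∈ Finset.insertNone Y) (hq : q ∈ Finset.insertNone Y)
    (hpq : p ≠ q) {J M : ℤ} {ξ c : Fin 4 → ℤ} (hJ : |prv (lin p - lin q) ⬝ᵥ c| ≤ J) (n : ℕ) :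
    ∑ x ∈ bx (M * n), sg (ξ ⬝ᵥ x) * wt Y n c p q x = eps p q * WW Y M J ξ c p q n := by
  classical
  have hd := lin_sub_ne hY hp hq hpq
  have hl := gl_pos hd
  rw [WW, Finset.mul_sum]
  simp only [TT, Finset.sum_filter, Finset.mul_sum]
  rw [Finset.sum_comm]
  refine Finset.sum_congr rfl fun x _ => ?_
  obtain ⟨j, hj⟩ := gl_dvd_pv hY hp hq n x
  by_cases hT : TC Y n p q (pv n p x - pv n q x) x
  · rw [wt, if_pos ⟨hpq, hT⟩]
    have hiff : ∀ j' : ℤ, TC Y n p q (gl (lin p - lin q) * j') x ↔ j = j' := by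
      intro j'
      constructor
      · intro h
        have h1 := h.1
        rw [hj] at h1
        exact mul_left_cancel₀ (by omega) h1
      · rintro rfl
        rw [← hj]; exact hT
    simp only [hiff, mul_ite, mul_zero]
    rw [Finset.sum_ite_eq]
    split_ifs with hm
    · rw [tt, hj]; ring
    · have : tt n c p q x = 0 := by
        rw [tt, hj]
        have h1 : (lin p - lin q) ⬝ᵥ c = gl (lin p - lin q) * (prv (lin p - lin q) ⬝ᵥ c) := by
          rw [← smul_eq_mul, ← smul_dotProduct, ← gl_smul]
        rw [h1, ← mul_add, ← mul_sub, abs_mul, abs_mul, abs_mul]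
        have h2 : |j + prv (lin p - lin q) ⬝ᵥ c| + |j - prv (lin p - lin q) ⬝ᵥ c| = 2 * |j| := by
          rw [Finset.mem_Icc, ← abs_le, not_le] at hm
          simp only [abs_eq_max_neg] at *
          omega
        rw [← mul_add, h2]; ring
      rw [this]; ring
  · rw [wt, if_neg (fun h => hT h.2), mul_zero]
    symm
    refine Finset.sum_eq_zero fun j' _ => ?_
    rw [if_neg, mul_zero]
    intro h
    apply hT
    rw [h.1]; exact h

/-- twisted sum of the height function -/
def AA (Y : Finset (Fin 4 → ℤ)) (ξ : Fin 4 → ℤ) (n : ℕ) : ℤ := ∑ᶠ x, sg (ξ ⬝ᵥ x) * phi Y n x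

lemma phi_ne {Y : Finset (Fin 4 → ℤ)} {C : ℤ} (hY : CoreHyp Y C) {n : ℕ} {K M : ℤ} {D' : Fin 4 → ℤ}
    (hK : 0 ≤ K) (hD : ∀ y ∈ Y, |y ⬝ᵥ D'| ≤ K) (hM : C * (1 + K) ≤ M) {x : Fin 4 → ℤ}
    (h : phi Y n (x + D') ≠ 0) : 1 ≤ n → x ∈ bx (M * n) := by
  intro hn
  have h1 : fY Y (x + D') < n := by
    by_contra hc
    apply h
    rw [phi, max_eq_left]; omega
  have h2 := bx_of_bound hY hK hn (x := x) (fun y hy => by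
    have a := fY_le (x := x + D') hy
    rw [dotProduct_add] at a
    have b := hD y hy
    rw [abs_le] at b
    omega)
  rw [mem_bx] at h2 ⊢
  intro i
  exact (h2 i).trans (mul_le_mul_of_nonneg_right hM (by positivity))

lemma AA_shift {Y : Finset (Fin 4 → ℤ)} {C : ℤ} (hY : CoreHyp Y C) {n : ℕ} {K M : ℤ}
    (hK : 0 ≤ K) {c ξ : Fin 4 → ℤ} (hD : ∀ y ∈ Y, |y ⬝ᵥ c| ≤ K) (hM : C * (1 + K) ≤ M) (hn : 1 ≤ n) :
    ∑ x ∈ bx (M * n), sg (ξ ⬝ᵥ x) * phi Y n (x + c) = sg (ξ ⬝ᵥ (-c)) * AA Y ξ n := by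
  rw [AA, ← finsum_comp_equiv (Equiv.addRight c)]
  rw [finsum_eq_sum_of_support_subset (s := bx (M * n)), Finset.mul_sum]
  · refine Finset.sum_congr rfl fun x _ => ?_
    rw [← mul_assoc, ← sg_add, ← dotProduct_add]
    simp
  · intro x hx
    rw [Function.mem_support] at hx
    exact phi_ne hY hK hD hM (right_ne_zero_of_mul hx) hn

lemma AA_dd {Y : Finset (Fin 4 → ℤ)} {C : ℤ} (hY : CoreHyp Y C) {n : ℕ} {K M : ℤ}
    (hK : 0 ≤ K) {c ξ : Fin 4 → ℤ} (hD : ∀ y ∈ Y, |y ⬝ᵥ c| ≤ K) (hM : C * (1 + K) ≤ M) (hn : 1 ≤ n)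
    (hc : Odd (ξ ⬝ᵥ c)) :
    ∑ x ∈ bx (M * n), sg (ξ ⬝ᵥ x) * dd (phi Y n) c x = -4 * AA Y ξ n := by
  have h1 := AA_shift hY hK (ξ := ξ) hD hM hn
  have h2 := AA_shift hY hK (ξ := ξ) (c := -c) (by simpa using hD) hM hn
  have h3 := AA_shift hY hK (ξ := ξ) (c := 0) (by simpa using fun _ _ => hK) hM hn
  rw [sg_odd (by rw [dotProduct_neg]; exact hc.neg)] at h1
  rw [neg_neg, sg_odd hc] at h2
  rw [neg_zero, dotProduct_zero, sg_even (by simp)] at h3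
  simp only [add_zero] at h3
  simp only [← sub_eq_add_neg] at h2
  simp only [dd, mul_sub, mul_add, Finset.sum_sub_distrib, Finset.sum_add_distrib]
  have h4 : ∑ x ∈ bx (M * n), sg (ξ ⬝ᵥ x) * (2 * phi Y n x) =
      2 * ∑ x ∈ bx (M * n), sg (ξ ⬝ᵥ x) * phi Y n x := by
    rw [Finset.mul_sum]; refine Finset.sum_congr rfl fun x _ => by ring
  rw [h1, h2, h4, h3]; ring

lemma phi_lip {Y : Finset (Fin 4 → ℤ)} (hYne : Y.Nonempty) {n D : ℤ} {c : Fin 4 → ℤ}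
    (hD : ∀ y ∈ Y, |y ⬝ᵥ c| ≤ D) (x : Fin 4 → ℤ) : |phi Y n (x + c) - phi Y n x| ≤ D := by
  have h1 : fY Y (x + c) ≤ fY Y x + D := by
    obtain ⟨y, hy, hy'⟩ := fY_mem hYne (x + c)
    have a := fY_le (x := x) hy
    have b := hD y hy
    rw [abs_le] at b
    rw [hy', dotProduct_add]; omega
  have h2 : fY Y x ≤ fY Y (x + c) + D := by
    obtain ⟨y, hy, hy'⟩ := fY_mem hYne x
    have a := fY_le (x := x + c) hy
    have b := hD y hy
    rw [abs_le] at b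
    rw [dotProduct_add] at a
    omega
  rw [abs_le]
  simp only [phi]
  constructor <;> omega

lemma AA_walls {Y : Finset (Fin 4 → ℤ)} {C : ℤ} (hY : CoreHyp Y C) {K M : ℤ}
    {c ξ : Fin 4 → ℤ} (hD : ∀ y ∈ Y, |y ⬝ᵥ c| ≤ K) (hM : C * (1 + K) ≤ M)
    (hc : Odd (ξ ⬝ᵥ c)) :
    O2 (fun n => -16 * AA Y ξ n - ∑ p ∈ Finset.insertNone Y, ∑ q ∈ Finset.insertNone Y,
      ∑ x ∈ bx (M * n), sg (ξ ⬝ᵥ x) * wt Y n c p q x) := by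
  classical
  obtain ⟨y0, hy0⟩ := hY.nonempty
  have hK : 0 ≤ K := (abs_nonneg _).trans (hD y0 hy0)
  set N : ℤ := ((Finset.insertNone Y).card : ℤ)
  have hO := (excp_O2 hY (4 * K) M).const_mul (8 * K + N * (N * (4 * K)))
  refine hO.mono ?_
  filter_upwards [eventually_ge_atTop 1] with n hn
  have e1 : -16 * AA Y ξ n = ∑ x ∈ bx (M * n), sg (ξ ⬝ᵥ x) * (4 * dd (phi Y n) c x) := by
    have := AA_dd hY hK (ξ := ξ) hD hM hn hc
    rw [show -16 * AA Y ξ n = 4 * (-4 * AA Y ξ n) by ring, ← this, Finset.mul_sum]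
    exact Finset.sum_congr rfl fun x _ => by ring
  have e2 : ∑ p ∈ Finset.insertNone Y, ∑ q ∈ Finset.insertNone Y,
      ∑ x ∈ bx (M * n), sg (ξ ⬝ᵥ x) * wt Y n c p q x = ∑ x ∈ bx (M * n), sg (ξ ⬝ᵥ x) *
        ∑ p ∈ Finset.insertNone Y, ∑ q ∈ Finset.insertNone Y, wt Y n c p q x := by
    simp only [Finset.mul_sum]
    rw [Finset.sum_comm]
    rw [Finset.sum_congr rfl fun q _ => Finset.sum_comm]
    rw [Finset.sum_comm]
    refine Finset.sum_congr rfl fun x _ => ?_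
    rw [Finset.sum_comm]
  rw [e1, e2, ← Finset.sum_sub_distrib]
  have e3 : ∑ x ∈ bx (M * n), (sg (ξ ⬝ᵥ x) * (4 * dd (phi Y n) c x) - sg (ξ ⬝ᵥ x) *
        ∑ p ∈ Finset.insertNone Y, ∑ q ∈ Finset.insertNone Y, wt Y n c p q x) =
      ∑ x ∈ excp Y (4 * K) M n, (sg (ξ ⬝ᵥ x) * (4 * dd (phi Y n) c x) - sg (ξ ⬝ᵥ x) *
        ∑ p ∈ Finset.insertNone Y, ∑ q ∈ Finset.insertNone Y, wt Y n c p q x) := by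
    symm
    apply Finset.sum_subset (Finset.filter_subset _ _)
    intro x hx hx2
    rw [second_diff hY.nonempty hD, sub_self]
    intro h
    exact hx2 (Finset.mem_filter.mpr ⟨hx, h⟩)
  rw [e3]
  refine (Finset.abs_sum_le_sum_abs _ _).trans ?_
  have hbd : ∀ x, |sg (ξ ⬝ᵥ x) * (4 * dd (phi Y n) c x) - sg (ξ ⬝ᵥ x) *
        ∑ p ∈ Finset.insertNone Y, ∑ q ∈ Finset.insertNone Y, wt Y n c p q x| ≤
        8 * K + N * (N * (4 * K)) := by
    intro x
    rw [← mul_sub, abs_mul, sg_abs, one_mul]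
    refine (abs_sub _ _).trans (add_le_add ?_ ?_)
    · have a1 := phi_lip hY.nonempty (n := n) hD x
      have a2 := phi_lip hY.nonempty (n := n) (c := -c) (by simpa using hD) x
      rw [← sub_eq_add_neg] at a2
      rw [dd]
      rw [abs_le] at *
      constructor <;> linarith
    · have hw : ∀ p ∈ Finset.insertNone Y, ∀ q ∈ Finset.insertNone Y, |wt Y n c p q x| ≤ 4 * K := by
        have hlin : ∀ r ∈ Finset.insertNone Y, |lin r ⬝ᵥ c| ≤ K := by
          rintro (_ | y) hr
          · simpa [lin] using hK
          · simpa [lin] using hD y (by simpa using hr)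
        intro p hp q hq
        rw [wt]
        split_ifs
        · rw [abs_mul]
          have h1 : |eps p q| = 1 := by rw [eps]; split_ifs <;> simp
          rw [h1, one_mul]
          exact tt_le (hlin p hp) (hlin q hq)
        · rw [abs_zero]; linarith
      refine (Finset.abs_sum_le_sum_abs _ _).trans ?_
      refine (Finset.sum_le_card_nsmul _ _ (N * (4 * K)) fun p hp => ?_).trans (by simp [N])
      refine (Finset.abs_sum_le_sum_abs _ _).trans ?_
      refine (Finset.sum_le_card_nsmul _ _ (4 * K) fun q hq => hw p hp q hq).trans (by simp [N])
  refine (Finset.sum_le_card_nsmul _ _ _ fun x _ => hbd x).trans ?_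
  refine le_trans (le_of_eq ?_) (le_abs_self _)
  rw [nsmul_eq_mul, mul_comm]

end

section


/-- the characters modulo two -/
def XX : Finset (Fin 4 → ℤ) := Fintype.piFinset fun _ => {0, 1}

lemma mem_XX {ξ : Fin 4 → ℤ} : ξ ∈ XX ↔ ∀ i, ξ i = 0 ∨ ξ i = 1 := by
  simp [XX]

lemma sg_zero : sg 0 = 1 := sg_even Even.zero

lemma sum_XX (x : Fin 4 → ℤ) : ∑ ξ ∈ XX, sg (ξ ⬝ᵥ x) = if ∀ i, Even (x i) then 16 else 0 := by
  have h1 : ∀ ξ : Fin 4 → ℤ, sg (ξ ⬝ᵥ x) = ∏ i, sg (ξ i * x i) := by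
    intro ξ
    simp [dotProduct, Fin.sum_univ_four, Fin.prod_univ_four, sg_add]
  simp only [h1, XX]
  rw [← Finset.prod_univ_sum (fun _ : Fin 4 => ({0, 1} : Finset ℤ)) (fun i k => sg (k * x i))]
  simp only [Finset.sum_pair (zero_ne_one (α := ℤ)), zero_mul, one_mul, sg_zero]
  split_ifs with h
  · simp only [sg_even (h _)]; norm_num
  · push Not at h
    obtain ⟨i, hi⟩ := h
    apply Finset.prod_eq_zero (Finset.mem_univ i)
    rw [sg_odd (Int.not_even_iff_odd.mp hi)]; norm_num

lemma AA_sum {Y : Finset (Fin 4 → ℤ)} {C : ℤ} (hY : CoreHyp Y C) (ξ : Fin 4 → ℤ) {n : ℕ}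
    (hn : 1 ≤ n) : AA Y ξ n = ∑ x ∈ bx (C * n), sg (ξ ⬝ᵥ x) * phi Y n x := by
  have h3 := AA_shift hY le_rfl (M := C) (ξ := ξ) (c := 0) (by simp) (by simp) hn
  rw [neg_zero, dotProduct_zero, sg_even (by simp), one_mul] at h3
  simp only [add_zero] at h3
  exact h3.symm

lemma fY_double {Y : Finset (Fin 4 → ℤ)} (hY : Y.Nonempty) (z : Fin 4 → ℤ) :
    fY Y ((2:ℤ) • z) = 2 * fY Y z := by
  obtain ⟨y, hy, hy'⟩ := fY_mem hY z
  rw [hy', fY_eq hy, dotProduct_smul, smul_eq_mul]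
  intro y' h
  have := fY_le (x := z) h
  rw [dotProduct_smul, dotProduct_smul, smul_eq_mul, smul_eq_mul]
  omega

lemma AA_orth {Y : Finset (Fin 4 → ℤ)} {C : ℤ} (hY : CoreHyp Y C) {n : ℕ}
    (hn : 1 ≤ n) : ∑ ξ ∈ XX, AA Y ξ (2 * n) = 32 * AA Y 0 n := by
  classical
  rw [Finset.sum_congr rfl fun ξ _ => AA_sum hY ξ (show 1 ≤ 2 * n by omega), AA_sum hY 0 hn]
  rw [Finset.sum_comm]
  simp only [← Finset.sum_mul, sum_XX, ite_mul, zero_mul]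
  rw [← Finset.sum_filter]
  have : (bx (C * ((2 * n : ℕ) : ℤ))).filter (fun x => ∀ i, Even (x i)) =
      (bx (C * n)).image (fun z => (2:ℤ) • z) := by
    ext x
    simp only [Finset.mem_filter, Finset.mem_image, mem_bx]
    constructor
    · rintro ⟨h1, h2⟩
      refine ⟨fun i => x i / 2, fun i => ?_, ?_⟩
      · obtain ⟨k, hk⟩ := h2 i
        have := h1 i
        rw [hk] at this
        simp only [hk]
        push_cast at this
        rw [show (k + k) / 2 = k by omega]
        rw [← two_mul, abs_mul] at this
        norm_num at this
        nlinarith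
      · funext i
        obtain ⟨k, hk⟩ := h2 i
        simp only [Pi.smul_apply, smul_eq_mul, hk]
        omega
    · rintro ⟨z, hz, rfl⟩
      refine ⟨fun i => ?_, fun i => ?_⟩
      · have := hz i
        simp only [Pi.smul_apply, smul_eq_mul, abs_mul]
        push_cast
        norm_num
        linarith
      · simp
  rw [this, Finset.sum_image, Finset.mul_sum]
  · refine Finset.sum_congr rfl fun z _ => ?_
    rw [zero_dotProduct, sg_zero, phi, phi, fY_double hY.nonempty]
    push_cast
    omega
  · intro a _ b _ h
    funext i
    have := congrFun h i
    simp only [Pi.smul_apply, smul_eq_mul] at this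
    omega

lemma res_unique {d : Fin 4 → ℤ} (hd : d ≠ 0) : ∃ ξ ∈ XX.erase 0, ∀ ξ' ∈ XX.erase 0, res ξ' d ↔ ξ' = ξ := by
  refine ⟨fun i => prv d i % 2, ?_, ?_⟩
  · rw [Finset.mem_erase]
    refine ⟨?_, ?_⟩
    · intro h
      obtain ⟨z, hz⟩ := prv_prim hd
      have h2 : Even (prv d ⬝ᵥ z) := Finset.even_sum _ fun i _ => Even.mul_right
        (Int.even_iff.mpr (congrFun h i)) _
      rw [hz] at h2
      exact absurd h2 (by decide)
    · rw [mem_XX]; intro i; omega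
  · intro ξ' h
    rw [Finset.mem_erase, mem_XX] at h
    constructor
    · intro hr
      funext i
      have := hr i
      rcases h.2 i with h0 | h0 <;> rw [Int.even_iff] at this <;> simp only [h0] at this ⊢ <;> omega
    · rintro rfl i
      rw [Int.even_iff]; simp only; omega

lemma AA_main {Y : Finset (Fin 4 → ℤ)} {C : ℤ} (hY : CoreHyp Y C) :
    ∃ M0 : ℤ, ∀ M, M0 ≤ M → O2 (fun n => -8 * (32 * AA Y 0 n - AA Y 0 (2 * n)) -
      ∑ p ∈ Finset.insertNone Y, ∑ q ∈ Finset.insertNone Y,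
      if p ≠ q then eps p q * gl (lin p - lin q) * (TT Y M p q 0 (2 * n)).card else 0) := by
  classical
  set P := Finset.insertNone Y with hP
  set J : ℤ := ∑ p ∈ P, ∑ q ∈ P, ∑ i, |prv (lin p - lin q) i| with hJ
  set K : ℤ := ∑ y ∈ Y, ∑ i, |y i| + ∑ p ∈ P, ∑ q ∈ P, |gl (lin p - lin q)| * J with hK
  have hJ0 : 0 ≤ J := Finset.sum_nonneg fun p _ => Finset.sum_nonneg fun q _ =>
    Finset.sum_nonneg fun i _ => abs_nonneg _
  have hs1 : 0 ≤ ∑ y ∈ Y, ∑ i, |y i| := Finset.sum_nonneg fun p _ => 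
    Finset.sum_nonneg fun i _ => abs_nonneg _
  have hs2 : 0 ≤ ∑ p ∈ P, ∑ q ∈ P, |gl (lin p - lin q)| * J := Finset.sum_nonneg fun p _ =>
    Finset.sum_nonneg fun q _ => mul_nonneg (abs_nonneg _) hJ0
  have hyK : ∀ y ∈ Y, ∀ i, |y i| ≤ K := by
    intro y hy i
    have h1 := Finset.single_le_sum (f := fun i => |y i|) (fun _ _ => abs_nonneg _) (Finset.mem_univ i)
    have h2 := Finset.single_le_sum (f := fun y : Fin 4 → ℤ => ∑ i, |y i|) 
      (fun y _ => Finset.sum_nonneg fun i _ => abs_nonneg (y i)) hy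
    linarith
  have hpJ : ∀ p ∈ P, ∀ q ∈ P, ∀ i, |prv (lin p - lin q) i| ≤ J := by
    intro p hp q hq i
    have h1 := Finset.single_le_sum (f := fun i => |prv (lin p - lin q) i|)
      (fun _ _ => abs_nonneg _) (Finset.mem_univ i)
    have h2 := Finset.single_le_sum (f := fun q => ∑ i, |prv (lin p - lin q) i|) 
      (fun q _ => Finset.sum_nonneg fun i _ => abs_nonneg _) hq
    have h3 := Finset.single_le_sum (f := fun p => ∑ q ∈ P, ∑ i, |prv (lin p - lin q) i|) 
      (fun p _ => Finset.sum_nonneg fun q _ => Finset.sum_nonneg fun i _ => abs_nonneg _) hp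
    linarith
  have hpK : ∀ p ∈ P, ∀ q ∈ P, gl (lin p - lin q) * J ≤ K := by
    intro p hp q hq
    have h1 := mul_le_mul_of_nonneg_right (le_abs_self (gl (lin p - lin q))) hJ0
    have h2 := Finset.single_le_sum (f := fun q => |gl (lin p - lin q)| * J) 
      (fun q _ => mul_nonneg (abs_nonneg _) hJ0) hq
    have h3 := Finset.single_le_sum (f := fun p => ∑ q ∈ P, |gl (lin p - lin q)| * J) 
      (fun p _ => Finset.sum_nonneg fun q _ => mul_nonneg (abs_nonneg _) hJ0) hp
    linarith
  refine ⟨C * (1 + K), fun M hM => ?_⟩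
  have key : ∀ ξ ∈ XX.erase 0, O2 (fun n => -16 * AA Y ξ (2 * n) - ∑ p ∈ P, ∑ q ∈ P,
      if p ≠ q ∧ res ξ (lin p - lin q) then
        2 * (eps p q * gl (lin p - lin q) * (TT Y M p q 0 (2 * n)).card) else 0) := by
    intro ξ hξ
    rw [Finset.mem_erase, mem_XX] at hξ
    obtain ⟨i, hi⟩ : ∃ i, ξ i = 1 := by
      by_contra hc
      push Not at hc
      exact hξ.1 (funext fun i => (hξ.2 i).resolve_right (hc i))
    have hodd : ∃ i, Odd (ξ i) := ⟨i, by rw [hi]; decide⟩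
    have hc : Odd (ξ ⬝ᵥ Pi.single i 1) := by
      rw [dotProduct_single, hi]; decide
    have h1 := AA_walls hY (c := Pi.single i 1) (ξ := ξ) (K := K) (M := M)
      (fun y hy => by rw [dotProduct_single, mul_one]; exact hyK y hy i) hM hc
    have h2 : O2 (fun n => ∑ p ∈ P, ∑ q ∈ P, (∑ x ∈ bx (M * n), sg (ξ ⬝ᵥ x) * 
        wt Y n (Pi.single i 1) p q x -
        if p ≠ q ∧ res ξ (lin p - lin q) then
        2 * (eps p q * gl (lin p - lin q) * UU Y M ξ p q 0 n) else 0)) := by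
      refine O2.sum fun p hp => O2.sum fun q hq => ?_
      by_cases hpq : p = q
      · refine O2.zero.congr (Eventually.of_forall fun n => ?_)
        simp [hpq, wt]
      · have hd := lin_sub_ne hY hp hq hpq
        have hJ' : |prv (lin p - lin q) ⬝ᵥ Pi.single i 1| ≤ J := by
          rw [dotProduct_single, mul_one]; exact hpJ p hp q hq i
        have h3 := WW_asymp hY hp hq hpq hM hd hJ' (hpK p hp q hq) hodd hc
        simp only [pair_sum hY hp hq hpq hJ']
        by_cases hr : res ξ (lin p - lin q)
        · simp only [hpq, hr, ne_eq, not_false_eq_true, and_self, if_true]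
          refine ((h3.1 hr).const_mul (eps p q)).congr (Eventually.of_forall fun n => ?_)
          ring
        · simp only [hr, and_false, if_false, sub_zero]
          exact (h3.2 hr).const_mul (eps p q)
    refine (h1.add h2).comp_double.congr (Eventually.of_forall fun n => ?_)
    simp only [Finset.sum_sub_distrib]
    have h4 : ∀ p ∈ P, ∀ q ∈ P, (if p ≠ q ∧ res ξ (lin p - lin q) then
        2 * (eps p q * gl (lin p - lin q) * UU Y M ξ p q 0 (2 * n)) else 0) =
        if p ≠ q ∧ res ξ (lin p - lin q) then
        2 * (eps p q * gl (lin p - lin q) * (TT Y M p q 0 (2 * n)).card) else 0 := by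
      intro p hp q hq
      split_ifs with h
      · rw [UU_zero hY (lin_sub_ne hY hp hq h.1) hp hq h.2 (2 * n) (by simp)]
      · rfl
    rw [Finset.sum_congr rfl fun p hp => Finset.sum_congr rfl (h4 p hp)]
    ring
  have hfin := O2.sum key
  have h0X : (0 : Fin 4 → ℤ) ∈ XX := by rw [mem_XX]; simp
  have : O2 (fun n => 2 * (-8 * (32 * AA Y 0 n - AA Y 0 (2 * n)) -
      ∑ p ∈ Finset.insertNone Y, ∑ q ∈ Finset.insertNone Y,
      if p ≠ q then eps p q * gl (lin p - lin q) * (TT Y M p q 0 (2 * n)).card else 0)) := by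
    refine hfin.congr ?_
    filter_upwards [eventually_ge_atTop 1] with n hn
    rw [Finset.sum_sub_distrib, ← Finset.mul_sum]
    have e1 : ∑ ξ ∈ XX.erase 0, AA Y ξ (2 * n) = 32 * AA Y 0 n - AA Y 0 (2 * n) := by
      rw [← AA_orth hY hn, ← Finset.add_sum_erase _ _ h0X]; ring
    rw [e1]
    have e2 : ∑ ξ ∈ XX.erase 0, ∑ p ∈ P, ∑ q ∈ P, (if p ≠ q ∧ res ξ (lin p - lin q) then
        2 * (eps p q * gl (lin p - lin q) * ((TT Y M p q 0 (2 * n)).card : ℤ)) else 0) =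
        ∑ p ∈ P, ∑ q ∈ P, (if p ≠ q then 
        2 * (eps p q * gl (lin p - lin q) * ((TT Y M p q 0 (2 * n)).card : ℤ)) else 0) := by
      rw [Finset.sum_comm]
      refine Finset.sum_congr rfl fun p hp => ?_
      rw [Finset.sum_comm]
      refine Finset.sum_congr rfl fun q hq => ?_
      by_cases hpq : p = q
      · simp [hpq]
      · obtain ⟨ξ, hξ, hu⟩ := res_unique (lin_sub_ne hY hp hq hpq)
        rw [Finset.sum_eq_single ξ]
        · rw [if_pos ⟨hpq, (hu ξ hξ).mpr rfl⟩, if_pos hpq]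
        · intro ξ' h1 h2
          rw [if_neg]
          intro h
          exact h2 ((hu ξ' h1).mp h.2)
        · intro h; exact absurd hξ h
    rw [e2, mul_sub]
    congr 1
    · ring
    · rw [Finset.mul_sum]
      refine Finset.sum_congr rfl fun p _ => ?_
      rw [Finset.mul_sum]
      refine Finset.sum_congr rfl fun q _ => ?_
      split_ifs <;> simp
  refine this.mono (Eventually.of_forall fun n => ?_)
  rw [abs_mul, abs_two]
  exact le_mul_of_one_le_left (abs_nonneg _) (by norm_num)

end

section


/-- number of lattice points on the boundary of the `n`-th dilate -/
def LL (Y : Finset (Fin 4 → ℤ)) (n : ℕ) : ℕ := Set.ncard {x : Fin 4 → ℤ | fY Y x = n}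

/-- number of lattice points on a cone over a codimension two face up to height `n` -/
def EE (Y : Finset (Fin 4 → ℤ)) (y₁ y₂ : Fin 4 → ℤ) (n : ℕ) : ℕ :=
  Set.ncard {x : Fin 4 → ℤ | y₁ ⬝ᵥ x = y₂ ⬝ᵥ x ∧ y₁ ⬝ᵥ x ≤ n ∧ ∀ y ∈ Y, y ⬝ᵥ x ≤ y₁ ⬝ᵥ x}

lemma fY_nonneg {Y : Finset (Fin 4 → ℤ)} {C : ℤ} (hY : CoreHyp Y C) (x : Fin 4 → ℤ) : 0 ≤ fY Y x := by
  by_cases hx : x = 0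
  · obtain ⟨y, hy⟩ := hY.nonempty
    have := fY_le (x := x) hy
    simpa [hx] using this
  · obtain ⟨i, hi⟩ : ∃ i, x i ≠ 0 := by
      by_contra hc; push Not at hc; exact hx (funext hc)
    obtain ⟨y, hy, h⟩ := hY.bd x i
    have h1 := fY_le (x := x) hy
    have h2 : 0 < |x i| := abs_pos.mpr hi
    have h3 := hY.cpos
    by_contra hc
    push Not at hc
    nlinarith

lemma mem_bx_of_fY {Y : Finset (Fin 4 → ℤ)} {C : ℤ} (hY : CoreHyp Y C) {n : ℤ} {M : ℤ} (hM : C ≤ M)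
    {x : Fin 4 → ℤ} (h : fY Y x ≤ n) : x ∈ bx (M * n) := by
  rw [mem_bx]
  intro i
  obtain ⟨y, hy, hb⟩ := hY.bd x i
  have h1 := fY_le (x := x) hy
  have h2 := fY_nonneg hY x
  have h3 := hY.cpos
  nlinarith

lemma LL_card {Y : Finset (Fin 4 → ℤ)} {C : ℤ} (hY : CoreHyp Y C) {n m : ℕ} {M : ℤ} (hM : C ≤ M)
    (hmn : m ≤ n) : LL Y m = ((bx (M * n)).filter fun x => fY Y x = m).card := by
  rw [LL, ← Set.ncard_coe_finset]
  congr 1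
  ext x
  simp only [Set.mem_ofPred_eq, Finset.coe_filter]
  refine ⟨fun h => ⟨mem_bx_of_fY hY hM ?_, h⟩, fun h => h.2⟩
  rw [h]; exact_mod_cast hmn

lemma AA_zero {Y : Finset (Fin 4 → ℤ)} {C : ℤ} (hY : CoreHyp Y C) {n : ℕ} (hn : 1 ≤ n) :
    AA Y 0 n = ∑ m ∈ Finset.range n, ((n : ℤ) - m) * LL Y m := by
  rw [AA_sum hY 0 hn]
  have : ∀ m ∈ Finset.range n, ((n : ℤ) - m) * LL Y m = ∑ x ∈ bx (C * n),
      if fY Y x = m then ((n : ℤ) - m) else 0 := by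
    intro m hm
    rw [LL_card hY le_rfl (Finset.mem_range.mp hm).le, ← Finset.sum_filter, Finset.sum_const,
      nsmul_eq_mul, mul_comm]
  rw [Finset.sum_congr rfl this, Finset.sum_comm]
  refine Finset.sum_congr rfl fun x _ => ?_
  rw [zero_dotProduct, sg_zero, one_mul, phi]
  have h0 := fY_nonneg hY x
  obtain ⟨k, hk⟩ := Int.eq_ofNat_of_zero_le h0
  rw [hk]
  simp only [Nat.cast_inj]
  rw [Finset.sum_ite_eq]
  simp only [Finset.mem_range]
  split_ifs <;> omega

lemma gl_neg (d : Fin 4 → ℤ) : gl (-d) = gl d := by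
  have h : ∀ a b : Fin 4 → ℤ, (∀ i, b i = - a i) → gl a ∣ gl b := by
    intro a b h
    refine Finset.dvd_gcd fun i _ => ?_
    rw [h i, dvd_neg]; exact gl_dvd a i
  have h1 : normalize (gl d) = gl d := Finset.normalize_gcd
  have h2 : normalize (gl (-d)) = gl (-d) := Finset.normalize_gcd
  rw [← h1, ← h2]
  exact normalize_eq_normalize (h _ _ fun i => by simp) (h _ _ fun i => by simp)

lemma core_asymp {Y : Finset (Fin 4 → ℤ)} {C : ℤ} (hY : CoreHyp Y C) :
    O2 (fun n => 8 * (32 * AA Y 0 n - AA Y 0 (2 * n)) + 2 * (LL Y (2 * n) : ℤ) -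
      ∑ y₁ ∈ Y, ∑ y₂ ∈ Y, if y₁ ≠ y₂ then gl (y₁ - y₂) * (EE Y y₁ y₂ (2 * n) : ℤ) else 0) := by
  classical
  obtain ⟨M0, hM0⟩ := AA_main hY
  set M := max M0 C with hM
  have h1 := hM0 M (le_max_left _ _)
  have hC : C ≤ M := le_max_right _ _
  -- the boundary
  have h2 : O2 (fun n : ℕ => ∑ y ∈ Y, ((TT Y M none (some y) 0 n).card : ℤ) - LL Y n) := by
    refine ((excp_O2 hY 0 M).const_mul Y.card).mono ?_
    filter_upwards [eventually_ge_atTop 1] with n hn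
    have e1 : ∑ y ∈ Y, ((TT Y M none (some y) 0 n).card : ℤ) = 
        ∑ x ∈ (bx (M * n)).filter (fun x => fY Y x = n), ((Y.filter fun y => y ⬝ᵥ x = n).card : ℤ) := by
      have : ∀ y ∈ Y, ((TT Y M none (some y) 0 n).card : ℤ) = 
          ∑ x ∈ (bx (M * n)).filter (fun x => fY Y x = n), if y ⬝ᵥ x = n then 1 else 0 := by
        intro y hy
        rw [← Finset.sum_filter, Finset.sum_const, nsmul_eq_mul, mul_one, TT, Finset.filter_filter]
        congr 2
        apply Finset.filter_congr
        intro x _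
        constructor
        · rintro ⟨a, b⟩
          simp only [pv_none, pv_some] at a
          have hyn : y ⬝ᵥ x = n := by omega
          refine ⟨?_, hyn⟩
          rw [← hyn]
          refine fY_eq hy fun y' hy' => ?_
          by_cases he : y' = y
          · rw [he]
          · have := (b (some y') (by simpa using hy') (by simp) (by simpa using he)).1
            simp only [rel, pv_none] at this
            omega
        · rintro ⟨a, b⟩
          refine ⟨by simp [b], ?_⟩
          rintro (_ | y') hy' h1 h2
          · exact absurd rfl h1
          · have := fY_le (x := x) (show y' ∈ Y by simpa using hy')
            simp only [rel, pv_none, pv_some]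
            omega
      rw [Finset.sum_congr rfl this, Finset.sum_comm]
      refine Finset.sum_congr rfl fun x _ => ?_
      rw [← Finset.sum_filter, Finset.sum_const, nsmul_eq_mul, mul_one]
    have e2 : (LL Y n : ℤ) = ∑ x ∈ (bx (M * n)).filter (fun x => fY Y x = n), (1 : ℤ) := by
      rw [LL_card hY hC le_rfl]; simp
    rw [e1, e2, ← Finset.sum_sub_distrib]
    refine (Finset.abs_sum_le_sum_abs _ _).trans ?_
    refine le_trans ?_ (le_abs_self _)
    have e3 : ∀ x ∈ (bx (M * n)).filter (fun x => fY Y x = n), 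
        |((Y.filter fun y => y ⬝ᵥ x = n).card : ℤ) - 1| ≤ 
          if x ∈ excp Y 0 M n then (Y.card : ℤ) else 0 := by
      intro x hx
      rw [Finset.mem_filter] at hx
      obtain ⟨y, hy, hy'⟩ := fY_mem hY.nonempty x
      have hpos : 1 ≤ (Y.filter fun y => y ⬝ᵥ x = n).card := by
        rw [Nat.one_le_iff_ne_zero, ← Nat.pos_iff_ne_zero, Finset.card_pos]
        exact ⟨y, Finset.mem_filter.mpr ⟨hy, by rw [← hy', hx.2]⟩⟩
      have hle : (Y.filter fun y => y ⬝ᵥ x = n).card ≤ Y.card := Finset.card_filter_le _ _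
      split_ifs with h
      · rw [abs_le]; constructor <;> omega
      · have : (Y.filter fun y => y ⬝ᵥ x = n).card ≤ 1 := by
          rw [Finset.card_le_one]
          intro a ha b hb
          by_contra hab
          apply h
          rw [Finset.mem_filter] at ha hb
          refine Finset.mem_filter.mpr ⟨hx.1, none, by simp, some a, by simpa using ha.1, some b,
            by simpa using hb.1, by simp, by simp, by simpa using hab, ?_, ?_⟩
          · simp [ha.2]
          · simp [hb.2]
        have h1 : (Y.filter fun y => y ⬝ᵥ x = n).card = 1 := by omega
        rw [h1]; simp
    refine (Finset.sum_le_sum e3).trans ?_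
    rw [← Finset.sum_filter, Finset.sum_const, nsmul_eq_mul, mul_comm]
    refine mul_le_mul_of_nonneg_left ?_ (by positivity)
    exact_mod_cast Finset.card_le_card (fun x hx => (Finset.mem_filter.mp hx).2)
  have h3 := (h2.comp_double).const_mul 2
  refine (h3.add h1).neg.congr ?_
  filter_upwards [eventually_ge_atTop 1] with n hn
  rw [Finset.sum_insertNone]
  simp only [Finset.sum_insertNone]
  have hE : ∀ y₁ ∈ Y, ∀ y₂ ∈ Y, y₁ ≠ y₂ → (TT Y M (some y₁) (some y₂) 0 (2 * n)).card = EE Y y₁ y₂ (2 * n) := by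
    intro y₁ hy1 y₂ hy2 hne
    rw [EE, ← Set.ncard_coe_finset]
    congr 1
    ext x
    rw [Finset.mem_coe, TT, Finset.mem_filter, TC]
    constructor
    · rintro ⟨-, a, b⟩
      simp only [pv_some] at a
      refine ⟨by omega, ?_, ?_⟩
      · have := (b none (by simp) (by simp) (by simp)).1
        simp only [rel, pv_some] at this; omega
      · intro y hy
        by_cases e1 : y = y₁
        · rw [e1]
        by_cases e2 : y = y₂
        · rw [e2]; omega
        have := (b (some y) (by simpa using hy) (by simpa using e1) (by simpa using e2)).1
        simp only [rel, pv_some] at this; omega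
    · rintro ⟨a, b, c⟩
      refine ⟨mem_bx_of_fY hY hC ((fY_eq hy1 c).trans_le b), by simp [a], ?_⟩
      rintro (_ | y) hy h1 h2
      · simp only [rel, pv_some]; omega
      · have := c y (by simpa using hy)
        simp only [rel, pv_some]; omega
  have hgl : ∀ y ∈ Y, gl y = 1 := fun y hy => by
    obtain ⟨z, hz⟩ := hY.prim y hy
    exact gl_eq_one ⟨z, Or.inl hz⟩
  have hN1 : ∀ y ∈ Y, (if none ≠ some y then eps none (some y) * gl (lin none - lin (some y)) * 
      ((TT Y M none (some y) 0 (2 * n)).card : ℤ) else 0) = (TT Y M none (some y) 0 (2 * n)).card := by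
    intro y hy
    simp [eps, lin, hgl y hy]
  have hTs : ∀ y, TT Y M (some y) none 0 (2 * n) = TT Y M none (some y) 0 (2 * n) := by
    intro y
    rw [TT, TT]
    apply Finset.filter_congr
    intro x _
    constructor
    · rintro ⟨a, b⟩; exact ⟨by linarith, fun r h h1 h2 => (b r h h2 h1).symm⟩
    · rintro ⟨a, b⟩; exact ⟨by linarith, fun r h h1 h2 => (b r h h2 h1).symm⟩
  have hN2 : ∀ y ∈ Y, (if some y ≠ none then eps (some y) none * gl (lin (some y) - lin none) * 
      ((TT Y M (some y) none 0 (2 * n)).card : ℤ) else 0) = (TT Y M none (some y) 0 (2 * n)).card := by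
    intro y hy
    simp [eps, lin, gl_neg, hgl y hy, hTs]
  have hP : ∀ y₁ ∈ Y, ∀ y₂ ∈ Y, (if some y₁ ≠ some y₂ then eps (some y₁) (some y₂) * 
      gl (lin (some y₁) - lin (some y₂)) * 
      ((TT Y M (some y₁) (some y₂) 0 (2 * n)).card : ℤ) else 0) = 
      - (if y₁ ≠ y₂ then gl (y₁ - y₂) * (EE Y y₁ y₂ (2 * n) : ℤ) else 0) := by
    intro y₁ hy1 y₂ hy2
    by_cases he : y₁ = y₂
    · simp [he]
    · rw [if_pos (by simpa using he), if_pos he, hE y₁ hy1 y₂ hy2 he]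
      have : lin (some y₁) - lin (some y₂) = - (y₁ - y₂) := by simp [lin]; abel
      rw [this, gl_neg]
      simp [eps]
  rw [Finset.sum_congr rfl hN1]
  rw [Finset.sum_congr rfl fun y₁ hy1 => congrArg₂ (· + ·) (hN2 y₁ hy1) 
    (Finset.sum_congr rfl (hP y₁ hy1))]
  simp only [Finset.sum_add_distrib, Finset.sum_neg_distrib, ne_eq, not_true_eq_false, if_false]
  ring

end

section


/-- half-open simplicial cone data in integer form -/
structure ConeData (D : ℤ) (v : Fin 4 → Fin 4 → ℤ) (l : Fin 4 → (Fin 4 → ℤ) →+ ℤ) : Prop where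
  Dpos : 0 < D
  dual : ∀ i j, l i (v j) = if i = j then D else 0
  expand : ∀ x, D • x = ∑ i, l i x • v i
  dvd : ∀ x, (∀ i, 0 ≤ l i x) → D ∣ ∑ i, l i x

def coneCount (D : ℤ) (l : Fin 4 → (Fin 4 → ℤ) →+ ℤ) (e : Fin 4 → ℤ) (n : ℤ) : ℕ :=
  Set.ncard {x : Fin 4 → ℤ | (∀ i, e i ≤ l i x) ∧ ∑ i, l i x = D * n}

lemma ConeData.inj {D v l} (h : ConeData D v l) {x y : Fin 4 → ℤ} (hxy : ∀ i, l i x = l i y) : x = y := by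
  have h1 : D • x = D • y := by
    rw [h.expand x, h.expand y]
    exact Finset.sum_congr rfl fun i _ => by rw [hxy i]
  have hD : D ≠ 0 := h.Dpos.ne'
  ext i
  have := congrFun h1 i
  simp only [Pi.smul_apply, smul_eq_mul] at this
  exact mul_left_cancel₀ hD this

lemma ConeData.l_comb {D v l} (h : ConeData D v l) (m : Fin 4 → ℤ) (i : Fin 4) :
    l i (∑ j, m j • v j) = D * m i := by
  rw [map_sum]
  simp only [map_zsmul, h.dual, smul_eq_mul]
  simp [mul_comm]

lemma ConeData.box_finite {D v l} (h : ConeData D v l) (e : Fin 4 → ℤ) :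
    {b : Fin 4 → ℤ | ∀ i, e i ≤ l i b ∧ l i b < D + e i}.Finite := by
  apply Set.Finite.of_finite_image (f := fun b i => l i b)
  · apply (Set.finite_Icc e (fun i => D + e i)).subset
    rintro _ ⟨b, hb, rfl⟩
    exact ⟨fun i => (hb i).1, fun i => (hb i).2.le⟩
  · intro x _ y _ hxy
    exact h.inj fun i => congrFun hxy i

def boxF {D v l} (h : ConeData D v l) (e : Fin 4 → ℤ) : Finset (Fin 4 → ℤ) := (h.box_finite e).toFinset

lemma mem_boxF {D v l} (h : ConeData D v l) (e : Fin 4 → ℤ) (b : Fin 4 → ℤ) :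
    b ∈ boxF h e ↔ ∀ i, e i ≤ l i b ∧ l i b < D + e i := by
  simp [boxF]

/-- number of compositions -/
lemma card_comp (N : ℕ) : Set.ncard {m : Fin 4 → ℤ | (∀ i, 0 ≤ m i) ∧ ∑ i, m i = N} = (N + 3).choose 3 := by
  have h1 := Finset.card_finsuppAntidiag_nat_eq_choose (s := (Finset.univ : Finset (Fin 4))) N
  have : {m : Fin 4 → ℤ | (∀ i, 0 ≤ m i) ∧ ∑ i, m i = N} =
      (fun (m : Fin 4 →₀ ℕ) i => (m i : ℤ)) '' 
        (Finset.finsuppAntidiag (Finset.univ : Finset (Fin 4)) N : Set (Fin 4 →₀ ℕ)) := by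
    ext m
    simp only [Set.mem_ofPred_eq, Set.mem_image, Finset.mem_coe, Finset.mem_finsuppAntidiag]
    constructor
    · rintro ⟨h0, hs⟩
      refine ⟨Finsupp.equivFunOnFinite.symm fun i => (m i).toNat, ⟨?_, by simp⟩, ?_⟩
      · zify
        rw [← hs]
        exact Finset.sum_congr rfl fun i _ => by simp [h0 i]
      · ext i; simp [h0 i]
    · rintro ⟨m, ⟨h1, _⟩, rfl⟩
      exact ⟨fun i => by simp, by rw [← h1]; push_cast; rfl⟩
  rw [this, Set.ncard_image_of_injective, Set.ncard_coe_finset, h1]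
  · simp only [Finset.card_univ, Fintype.card_fin]
    rw [show 4 + N - 1 = N + 3 by omega, ← Nat.choose_symm_add]
  · intro a b hab
    ext i
    have := congrFun hab i
    simpa using this

def qq (z : ℝ) : ℝ := (z + 1) * (z + 2) * (z + 3) / 6

lemma card_comp_qq (z : ℤ) (hz : -3 ≤ z) :
    ((Set.ncard {m : Fin 4 → ℤ | (∀ i, 0 ≤ m i) ∧ ∑ i, m i = z} : ℕ) : ℝ) = qq z := by
  by_cases h0 : 0 ≤ z
  · obtain ⟨N, rfl⟩ := Int.eq_ofNat_of_zero_le h0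
    rw [card_comp]
    have := Nat.cast_choose_eq_ascPochhammer_div ℝ (N+3) 3
    rw [this]
    simp [ascPochhammer_succ_right, qq, Nat.factorial]
    ring
  · have : {m : Fin 4 → ℤ | (∀ i, 0 ≤ m i) ∧ ∑ i, m i = z} = ∅ := by
      ext m
      simp only [Set.mem_ofPred_eq, Set.mem_empty_iff_false, iff_false, not_and]
      intro h h1
      have := Finset.sum_nonneg (s := Finset.univ) fun i _ => h i
      omega
    rw [this]
    push Not at h0
    interval_cases z <;> simp [qq]

lemma box_s {D v l} (h : ConeData D v l) (e : Fin 4 → ℤ) (he : ∀ i, e i = 0 ∨ e i = 1) (b : Fin 4 → ℤ)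
    (hb : b ∈ boxF h e) : D * ((∑ i, l i b) / D) = ∑ i, l i b ∧ 0 ≤ (∑ i, l i b) / D ∧ (∑ i, l i b) / D ≤ 4 := by
  rw [mem_boxF] at hb
  have h0 : ∀ i, 0 ≤ l i b := fun i => by have := hb i; rcases he i with h | h <;> omega
  have h1 : ∀ i, l i b ≤ D := fun i => by have := hb i; rcases he i with h | h <;> omega
  refine ⟨Int.mul_ediv_cancel' (h.dvd b h0), ?_, ?_⟩
  · exact Int.ediv_nonneg (Finset.sum_nonneg fun i _ => h0 i) h.Dpos.le
  · have : ∑ i, l i b ≤ 4 * D := by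
      calc ∑ i, l i b ≤ ∑ i : Fin 4, D := Finset.sum_le_sum fun i _ => h1 i
        _ = 4 * D := by simp
    calc _ ≤ (4 * D) / D := Int.ediv_le_ediv h.Dpos this
      _ = 4 := by rw [Int.mul_ediv_cancel _ h.Dpos.ne']

lemma coneCount_eq {D v l} (h : ConeData D v l) (e : Fin 4 → ℤ) (he : ∀ i, e i = 0 ∨ e i = 1) (n : ℕ) (hn : 1 ≤ n) :
    (coneCount D l e n : ℝ) = ∑ b ∈ boxF h e, qq ((n : ℝ) - ((∑ i, l i b) / D : ℤ)) := by
  have hD := h.Dpos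
  have hset : {x : Fin 4 → ℤ | (∀ i, e i ≤ l i x) ∧ ∑ i, l i x = D * n} =
      ⋃ b ∈ boxF h e, (fun m : Fin 4 → ℤ => b + ∑ j, m j • v j) ''
        {m : Fin 4 → ℤ | (∀ i, 0 ≤ m i) ∧ ∑ i, m i = n - (∑ i, l i b) / D} := by
    ext x
    simp only [Set.mem_ofPred_eq, Set.mem_iUnion, Set.mem_image, exists_prop]
    constructor
    · rintro ⟨hx, hs⟩
      set m : Fin 4 → ℤ := fun i => (l i x - e i) / D with hm
      have hl : ∀ i, l i (x - ∑ j, m j • v j) = l i x - D * m i := fun i => by rw [map_sub, h.l_comb]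
      have hb : x - ∑ j, m j • v j ∈ boxF h e := by
        rw [mem_boxF]
        intro i
        rw [hl]
        have h1 := Int.mul_ediv_add_emod (l i x - e i) D
        have h2 := Int.emod_nonneg (l i x - e i) hD.ne'
        have h3 := Int.emod_lt_of_pos (l i x - e i) hD
        have h4 : m i = (l i x - e i) / D := rfl
        rw [← h4] at h1
        constructor <;> linarith
      refine ⟨_, hb, m, ⟨fun i => Int.ediv_nonneg (by linarith [hx i]) hD.le, ?_⟩, by simp⟩
      have h1 := (box_s h e he _ hb).1
      apply mul_left_cancel₀ hD.ne'
      rw [mul_sub, h1]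
      simp only [hl, Finset.sum_sub_distrib, ← Finset.mul_sum, hs]
      ring
    · rintro ⟨b, hb, m, ⟨hm, hs⟩, rfl⟩
      have h1 := (box_s h e he _ hb).1
      have hl : ∀ i, l i (b + ∑ j, m j • v j) = l i b + D * m i := fun i => by rw [map_add, h.l_comb]
      refine ⟨fun i => ?_, ?_⟩
      · rw [hl]
        have := ((mem_boxF h e b).1 hb i).1
        have := mul_nonneg hD.le (hm i)
        linarith
      · simp only [hl, Finset.sum_add_distrib, ← Finset.mul_sum, hs, mul_sub, h1]
        ring
  have hfin : ∀ z : ℤ, {m : Fin 4 → ℤ | (∀ i, 0 ≤ m i) ∧ ∑ i, m i = z}.Finite := by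
    intro z
    apply (Set.finite_Icc (0 : Fin 4 → ℤ) (fun i => z)).subset
    rintro m ⟨h0, hs⟩
    refine ⟨h0, fun i => ?_⟩
    rw [← hs]
    exact Finset.single_le_sum (f := m) (fun i _ => h0 i) (Finset.mem_univ i)
  have hinj : ∀ b, Function.Injective (fun m : Fin 4 → ℤ => b + ∑ j, m j • v j) := by
    intro b m m' hmm
    ext i
    have := congrArg (l i) hmm
    simp only [map_add, h.l_comb] at this
    have : D * m i = D * m' i := by linarith
    exact mul_left_cancel₀ hD.ne' this
  rw [coneCount, hset]
  have key : Set.ncard (⋃ b ∈ boxF h e, (fun m : Fin 4 → ℤ => b + ∑ j, m j • v j) ''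
        {m : Fin 4 → ℤ | (∀ i, 0 ≤ m i) ∧ ∑ i, m i = n - (∑ i, l i b) / D}) =
      ∑ b ∈ boxF h e, Set.ncard ((fun m : Fin 4 → ℤ => b + ∑ j, m j • v j) ''
        {m : Fin 4 → ℤ | (∀ i, 0 ≤ m i) ∧ ∑ i, m i = n - (∑ i, l i b) / D}) := by
    have hf : ∀ b, ((fun m : Fin 4 → ℤ => b + ∑ j, m j • v j) ''
        {m : Fin 4 → ℤ | (∀ i, 0 ≤ m i) ∧ ∑ i, m i = n - (∑ i, l i b) / D}).Finite := fun b => (hfin _).image _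
    rw [show (⋃ b ∈ boxF h e, (fun m : Fin 4 → ℤ => b + ∑ j, m j • v j) ''
        {m : Fin 4 → ℤ | (∀ i, 0 ≤ m i) ∧ ∑ i, m i = n - (∑ i, l i b) / D}) = 
        (((boxF h e).biUnion fun b => (hf b).toFinset : Finset (Fin 4 → ℤ)) : Set (Fin 4 → ℤ)) by ext; simp]
    rw [Set.ncard_coe_finset, Finset.card_biUnion]
    · exact Finset.sum_congr rfl fun b _ => (Set.ncard_eq_toFinset_card _ (hf b)).symm
    · intro b hb b' hb' hne
      simp only [Function.onFun]
      rw [Finset.disjoint_left]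
      intro x hx hx'
      simp only [Set.Finite.mem_toFinset, Set.mem_image] at hx hx'
      obtain ⟨m, _, rfl⟩ := hx
      obtain ⟨m', _, hmm⟩ := hx'
      apply hne
      apply h.inj
      intro i
      have := congrArg (l i) hmm
      simp only [map_add, h.l_comb] at this
      have h1 := (mem_boxF h e b).1 hb i
      have h2 := (mem_boxF h e b').1 hb' i
      have h3 : l i b - l i b' = D * (m' i - m i) := by linarith
      have h4 : m' i - m i < 1 := by nlinarith
      have h5 : -1 < m' i - m i := by nlinarith
      have : m' i - m i = 0 := by omega
      rw [this] at h3; linarith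
  rw [key]
  push_cast
  apply Finset.sum_congr rfl
  intro b hb
  rw [Set.ncard_image_of_injective _ (hinj b), card_comp_qq]
  · push_cast; rfl
  · have := (box_s h e he b hb).2.2
    omega

lemma coneCount_recip {D v l} (h : ConeData D v l) (e : Fin 4 → ℤ) (he : ∀ i, e i = 0 ∨ e i = 1) :
    ∃ a0 a1 a2 a3 : ℝ, ∀ n : ℕ, 1 ≤ n → 
      (coneCount D l e n : ℝ) = a0 + a1 * n + a2 * n ^ 2 + a3 * n ^ 3 ∧
      (coneCount D l (fun i => 1 - e i) n : ℝ) = -a0 + a1 * n - a2 * n ^ 2 + a3 * n ^ 3 := by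
  have he' : ∀ i, 1 - e i = 0 ∨ 1 - e i = 1 := fun i => by rcases he i with h | h <;> omega
  have hD := h.Dpos
  have hl1 : ∀ i, l i (∑ j, v j) = D := by
    intro i
    have := h.l_comb (fun _ => 1) i
    simpa using this
  set S : (Fin 4 → ℤ) → ℝ := fun b => ((∑ i, l i b) / D : ℤ) with hS
  have hrec : ∀ n : ℝ, ∑ b ∈ boxF h (fun i => 1 - e i), qq (n - S b) = ∑ b ∈ boxF h e, - qq (-n - S b) := by
    intro n
    have hmem : ∀ e : Fin 4 → ℤ, ∀ b ∈ boxF h e, ∑ j, v j - b ∈ boxF h (fun i => 1 - e i) := by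
      intro e b hb
      rw [mem_boxF] at hb ⊢
      intro i
      rw [map_sub, hl1]
      have := hb i
      constructor <;> omega
    refine Finset.sum_bij' (fun b _ => ∑ j, v j - b) (fun b _ => ∑ j, v j - b) ?_ ?_ ?_ ?_ ?_
    · intro b hb
      simpa using hmem _ b hb
    · intro b hb
      exact hmem _ b hb
    · intro b _; simp
    · intro b _; simp
    · intro b hb
      have h1 := (box_s h _ he' b hb).1
      have h3 : (∑ i, l i (∑ j, v j - b)) / D = 4 - (∑ i, l i b) / D := by
        have : ∑ i, l i (∑ j, v j - b) = D * (4 - (∑ i, l i b) / D) := by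
          rw [mul_sub, h1]
          simp only [map_sub, hl1, Finset.sum_sub_distrib]
          simp; ring
        rw [this, Int.mul_ediv_cancel_left _ hD.ne']
      simp only [hS, h3, qq]
      push_cast
      ring
  refine ⟨∑ b ∈ boxF h e, (1 - S b) * (2 - S b) * (3 - S b) / 6,
    ∑ b ∈ boxF h e, ((1 - S b) * (2 - S b) + (1 - S b) * (3 - S b) + (2 - S b) * (3 - S b)) / 6,
    ∑ b ∈ boxF h e, ((1 - S b) + (2 - S b) + (3 - S b)) / 6, ∑ b ∈ boxF h e, 1 / 6, ?_⟩
  intro n hn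
  rw [coneCount_eq h e he n hn, coneCount_eq h _ he' n hn]
  constructor
  · simp only [Finset.sum_mul, ← Finset.sum_add_distrib]
    refine Finset.sum_congr rfl fun b _ => ?_
    simp only [hS, qq]; ring
  · rw [hrec n]
    simp only [Finset.sum_mul, ← Finset.sum_add_distrib, ← Finset.sum_neg_distrib, ← Finset.sum_sub_distrib]
    refine Finset.sum_congr rfl fun b _ => ?_
    simp only [hS, qq]; ring

end

section


lemma exists_lexmin {k : ℕ} (K : Set (Fin k → ℝ)) (hK : IsCompact K) (hne : K.Nonempty) :
    ∃ a ∈ K, ∀ b ∈ K, b ≠ a → ∃ i, a i < b i ∧ ∀ j < i, a j = b j := by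
  have key : ∀ j : ℕ, j ≤ k → ∃ K' ⊆ K, IsCompact K' ∧ K'.Nonempty ∧ ∀ a ∈ K', ∀ b ∈ K,
      (∃ i, a i < b i ∧ ∀ j < i, a j = b j) ∨ ((∀ i : Fin k, i.val < j → a i = b i) ∧ b ∈ K') := by
    intro j
    induction j with
    | zero => 
      intro _
      exact ⟨K, subset_rfl, hK, hne, fun a _ b hb => Or.inr ⟨fun i hi => absurd hi (by omega), hb⟩⟩
    | succ j ih =>
      intro hj
      obtain ⟨K', hsub, hc, hn, h⟩ := ih (by omega)
      let jj : Fin k := ⟨j, by omega⟩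
      obtain ⟨c, hcK, hmin⟩ := hc.exists_isMinOn hn (f := fun a => a jj) (by fun_prop)
      refine ⟨K' ∩ {a | a jj = c jj}, fun a ha => hsub ha.1, 
        hc.inter_right (isClosed_eq (by fun_prop) (by fun_prop)), ⟨c, hcK, rfl⟩, ?_⟩
      rintro a ⟨ha, haj⟩ b hb
      rcases h a ha b hb with h1 | ⟨h1, h2⟩
      · exact Or.inl h1
      · have h3 : c jj ≤ b jj := hmin h2
        rcases h3.lt_or_eq with h4 | h4
        · left
          refine ⟨jj, by rw [Set.mem_ofPred_eq] at haj; rw [haj]; exact h4, fun i hi => h1 i hi⟩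
        · right
          refine ⟨fun i hi => ?_, h2, h4.symm⟩
          rcases Nat.lt_succ_iff_lt_or_eq.1 hi with h5 | h5
          · exact h1 i h5
          · have : i = jj := Fin.ext h5
            rw [this]; rw [Set.mem_ofPred_eq] at haj; rw [haj]; exact h4
  obtain ⟨K', hsub, -, ⟨a, ha⟩, h⟩ := key k le_rfl
  refine ⟨a, hsub ha, fun b hb hne => ?_⟩
  rcases h a ha b hb with h1 | ⟨h1, _⟩
  · exact h1
  · exact absurd (funext fun i => (h1 i i.2).symm) hne

def LexPos {k : ℕ} (μ : Fin k → ℝ) : Prop :=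
  0 < ∑ i, μ i ∨ (∑ i, μ i = 0 ∧ ∃ i, 0 < μ i ∧ ∀ j < i, μ j = 0)

lemma LexPos.asymm {k : ℕ} {μ : Fin k → ℝ} (h : LexPos μ) (h' : LexPos (-μ)) : False := by
  simp only [LexPos, Pi.neg_apply, Finset.sum_neg_distrib] at h h'
  rcases h with h | ⟨h, i, hi, hi'⟩ <;> rcases h' with h2 | ⟨h2, j, hj, hj'⟩
  · linarith
  · linarith
  · linarith
  · rcases lt_trichotomy i j with h3 | h3 | h3
    · have := hj' i h3; linarith
    · rw [h3] at hi; linarith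
    · have := hi' j h3; linarith

lemma LexPos.of_smul {k : ℕ} {μ : Fin k → ℝ} {t : ℝ} (ht : 0 < t) (h : LexPos (t • μ)) : LexPos μ := by
  simp only [LexPos, Pi.smul_apply, smul_eq_mul, ← Finset.mul_sum] at h
  rcases h with h | ⟨h, i, hi, hi'⟩
  · exact Or.inl (pos_of_mul_pos_right h ht.le)
  · refine Or.inr ⟨by simpa [ht.ne'] using h, i, pos_of_mul_pos_right hi ht.le, fun j hj => ?_⟩
    simpa [ht.ne'] using hi' j hj

def comb {k : ℕ} (V : Fin k → Fin 4 → ℤ) : (Fin k → ℝ) →ₗ[ℝ] (Fin 4 → ℝ) :=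
  Fintype.linearCombination ℝ (fun i => coeLat (V i))

lemma comb_apply {k : ℕ} (V : Fin k → Fin 4 → ℤ) (c : Fin k → ℝ) :
    comb V c = ∑ i, c i • coeLat (V i) := rfl

/-- `σ` is (the index set of) a cone of the lexicographic fan. -/
def Opt {k : ℕ} (V : Fin k → Fin 4 → ℤ) (σ : Finset (Fin k)) : Prop :=
  ∀ μ : Fin k → ℝ, comb V μ = 0 → (∀ i ∉ σ, 0 ≤ μ i) → μ ≠ 0 → LexPos μ

structure FanHyp {k : ℕ} (Y : Finset (Fin 4 → ℤ)) (V : Fin k → Fin 4 → ℤ) : Prop where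
  ne : Y.Nonempty
  le : ∀ y ∈ Y, ∀ i, y ⬝ᵥ V i ≤ 1
  rep : ∀ x : Fin 4 → ℝ, ∃ c : Fin k → ℝ, (∀ i, 0 ≤ c i) ∧ comb V c = x ∧ 
    ∃ y ∈ Y, ∑ i, c i = coeLat y ⬝ᵥ x

section
variable {k : ℕ} {Y : Finset (Fin 4 → ℤ)} {V : Fin k → Fin 4 → ℤ}

lemma coeLat_dot (a b : Fin 4 → ℤ) : coeLat a ⬝ᵥ coeLat b = ((a ⬝ᵥ b : ℤ) : ℝ) := by
  simp [coeLat, dotProduct]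

lemma FanHyp.dot_le (h : FanHyp Y V) {y : Fin 4 → ℤ} (hy : y ∈ Y) (c : Fin k → ℝ) (hc : ∀ i, 0 ≤ c i) :
    coeLat y ⬝ᵥ comb V c ≤ ∑ i, c i := by
  rw [comb_apply, dotProduct_sum]
  apply Finset.sum_le_sum
  intro i _
  rw [dotProduct_smul, coeLat_dot, smul_eq_mul]
  have : ((y ⬝ᵥ V i : ℤ) : ℝ) ≤ 1 := by exact_mod_cast h.le y hy i
  nlinarith [hc i]

lemma FanHyp.exists_opt (h : FanHyp Y V) (x : Fin 4 → ℝ) :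
    ∃ σ, Opt V σ ∧ ∃ c : Fin k → ℝ, comb V c = x ∧ (∀ i ∈ σ, 0 < c i) ∧ (∀ i ∉ σ, c i = 0) := by
  obtain ⟨c0, hc0, hx0, y, hy, hs⟩ := h.rep x
  let K : Set (Fin k → ℝ) := {c | (∀ i, 0 ≤ c i) ∧ comb V c = x ∧ ∑ i, c i = coeLat y ⬝ᵥ x}
  have hKc : IsCompact K := by
    apply IsCompact.of_isClosed_subset (isCompact_Icc (a := (0 : Fin k → ℝ)) (b := fun _ => coeLat y ⬝ᵥ x))
    · have hKe : K = (⋂ i, {c : Fin k → ℝ | 0 ≤ c i}) ∩ ({c | comb V c = x} ∩ 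
          {c : Fin k → ℝ | ∑ i, c i = coeLat y ⬝ᵥ x}) := by
        ext c; simp [K]
      rw [hKe]
      apply IsClosed.inter
      · exact isClosed_iInter fun i => isClosed_le (by fun_prop) (by fun_prop)
      · apply IsClosed.inter
        · exact isClosed_eq (LinearMap.continuous_of_finiteDimensional _) continuous_const
        · exact isClosed_eq (by fun_prop) (by fun_prop)
    · rintro c ⟨h1, h2, h3⟩
      refine ⟨h1, fun i => ?_⟩
      rw [← h3]
      exact Finset.single_le_sum (f := c) (fun i _ => h1 i) (Finset.mem_univ i)
  obtain ⟨c, ⟨hc, hcx, hcs⟩, hmin⟩ := exists_lexmin K hKc ⟨c0, hc0, hx0, hs⟩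
  refine ⟨Finset.univ.filter fun i => 0 < c i, ?_, c, hcx, by simp, ?_⟩
  · intro μ hμ hμ0 hne
    -- small t
    obtain ⟨t, ht, htc⟩ : ∃ t : ℝ, 0 < t ∧ ∀ i, 0 ≤ c i + t * μ i := by
      have : ∀ᶠ t : ℝ in nhdsWithin 0 (Set.Ioi 0), ∀ i, 0 ≤ c i + t * μ i := by
        rw [Filter.eventually_all]
        intro i
        by_cases hi : 0 < c i
        · have h1 : Tendsto (fun t : ℝ => c i + t * μ i) (nhdsWithin 0 (Set.Ioi 0)) (nhds (c i + 0 * μ i)) := by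
            apply Tendsto.mono_left _ nhdsWithin_le_nhds
            apply Continuous.tendsto
            fun_prop
          have h2 : c i + 0 * μ i > 0 := by simpa using hi
          filter_upwards [h1.eventually (lt_mem_nhds h2)] with t ht using ht.le
        · filter_upwards [self_mem_nhdsWithin] with t ht
          have := hμ0 i (by simpa using hi)
          exact add_nonneg (hc i) (mul_nonneg (le_of_lt ht) this)
      obtain ⟨t, h1, h2⟩ := (this.and self_mem_nhdsWithin).exists
      exact ⟨t, h2, h1⟩
    apply LexPos.of_smul ht
    have hf : comb V (c + t • μ) = x := by rw [map_add, map_smul, hμ, hcx]; simp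
    have hge : coeLat y ⬝ᵥ x ≤ ∑ i, (c i + t * μ i) := by
      rw [← hf]; exact h.dot_le hy _ htc
    rw [Finset.sum_add_distrib, hcs] at hge
    have hge' : 0 ≤ ∑ i, t * μ i := by linarith
    rcases hge'.lt_or_eq with h5 | h5
    · exact Or.inl h5
    · right
      refine ⟨h5.symm, ?_⟩
      have hne' : c + t • μ ≠ c := by
        intro h6
        apply hne
        have : t • μ = 0 := by simpa using h6
        simpa [ht.ne'] using this
      obtain ⟨i, hi, hi'⟩ := hmin (c + t • μ) ⟨htc, hf, by
        simp only [Pi.add_apply, Pi.smul_apply, smul_eq_mul, Finset.sum_add_distrib, hcs, ← h5, add_zero]⟩ hne'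
      refine ⟨i, by simpa using hi, fun j hj => by simpa using hi' j hj⟩
  · intro i hi
    have : ¬ 0 < c i := by simpa using hi
    exact le_antisymm (not_lt.1 this) (hc i)

lemma Opt.unique {σ τ : Finset (Fin k)} (hσ : Opt V σ) (hτ : Opt V τ) {c d : Fin k → ℝ}
    (hc : ∀ i, 0 ≤ c i) (hd : ∀ i, 0 ≤ d i) (hc0 : ∀ i ∉ σ, c i = 0) (hd0 : ∀ i ∉ τ, d i = 0)
    (he : comb V c = comb V d) : c = d := by
  by_contra hne
  have h1 : LexPos (d - c) := hσ _ (by rw [map_sub, he, sub_self]) 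
    (fun i hi => by simp [hc0 i hi, hd i]) (fun h => hne (by rw [sub_eq_zero] at h; exact h.symm))
  have h2 : LexPos (c - d) := hτ _ (by rw [map_sub, he, sub_self]) 
    (fun i hi => by simp [hd0 i hi, hc i]) (fun h => hne (by rw [sub_eq_zero] at h; exact h))
  apply h1.asymm
  rwa [neg_sub]

lemma Opt.indep {σ : Finset (Fin k)} (hσ : Opt V σ) {μ : Fin k → ℝ} (h0 : ∀ i ∉ σ, μ i = 0) 
    (he : comb V μ = 0) : μ = 0 := by
  by_contra hne
  have h1 := hσ μ he (fun i hi => (h0 i hi).ge) hne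
  have h2 := hσ (-μ) (by simp [he]) (fun i hi => by simp [h0 i hi]) (by simpa using hne)
  exact h1.asymm h2

lemma FanHyp.sum_eq (h : FanHyp Y V) {σ : Finset (Fin k)} (hσ : Opt V σ) {c : Fin k → ℝ}
    (hc : ∀ i, 0 ≤ c i) (hc0 : ∀ i ∉ σ, c i = 0) (x : Fin 4 → ℤ) (hx : comb V c = coeLat x) :
    ∑ i, c i = fY Y x := by
  apply le_antisymm
  · obtain ⟨d, hd, hdx, y, hy, hs⟩ := h.rep (coeLat x)
    have h1 : ∑ i, d i ≤ fY Y x := by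
      rw [hs, coeLat_dot]
      exact_mod_cast fY_le hy
    by_cases hcd : d = c
    · rwa [← hcd]
    · have h2 := hσ (d - c) (by rw [map_sub, hdx, hx, sub_self]) (fun i hi => by simp [hc0 i hi, hd i]) 
        (by rwa [sub_ne_zero])
      have : 0 ≤ ∑ i, (d i - c i) := by
        rcases h2 with h2 | h2
        · exact h2.le
        · exact h2.1.ge
      rw [Finset.sum_sub_distrib] at this
      linarith
  · obtain ⟨y, hy, hfy⟩ := fY_mem h.ne x
    rw [hfy, ← coeLat_dot, ← hx]
    exact h.dot_le hy c hc
end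

end

section


def lR (l : Fin 4 → (Fin 4 → ℤ) →+ ℤ) (i : Fin 4) (z : Fin 4 → ℝ) : ℝ := 
  ∑ j, z j * (l i (Pi.single j 1) : ℝ)

lemma lR_coe (l : Fin 4 → (Fin 4 → ℤ) →+ ℤ) (i : Fin 4) (x : Fin 4 → ℤ) : lR l i (coeLat x) = l i x := by
  have : x = ∑ j, x j • (Pi.single j 1 : Fin 4 → ℤ) := by
    rw [← Finset.univ_sum_single x]
    congr 1
    ext j
    simp [Pi.single_apply]
  conv_rhs => rw [this, map_sum]
  simp only [map_zsmul, smul_eq_mul, lR, coeLat]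
  push_cast
  rfl

lemma lR_add (l : Fin 4 → (Fin 4 → ℤ) →+ ℤ) (i : Fin 4) (z z' : Fin 4 → ℝ) : 
    lR l i (z + z') = lR l i z + lR l i z' := by
  simp [lR, add_mul, Finset.sum_add_distrib]

lemma lR_neg (l : Fin 4 → (Fin 4 → ℤ) →+ ℤ) (i : Fin 4) (z : Fin 4 → ℝ) : 
    lR l i (-z) = - lR l i z := by
  simp [lR, Finset.sum_neg_distrib]

lemma lR_expand {D : ℤ} {v : Fin 4 → Fin 4 → ℤ} {l : Fin 4 → (Fin 4 → ℤ) →+ ℤ} 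
    (he : ∀ x, D • x = ∑ i, l i x • v i) (z : Fin 4 → ℝ) :
    ∑ i, lR l i z • coeLat (v i) = (D : ℝ) • z := by
  ext m
  have h1 : ∀ j, ∑ i, (l i (Pi.single j 1) : ℝ) * (v i m : ℝ) = D * (Pi.single j 1 : Fin 4 → ℝ) m := by
    intro j
    have := congrFun (he (Pi.single j 1)) m
    simp only [Pi.smul_apply, smul_eq_mul, Finset.sum_apply] at this
    have h2 : (((Pi.single j 1 : Fin 4 → ℤ) m : ℤ) : ℝ) = (Pi.single j 1 : Fin 4 → ℝ) m := by
      by_cases h : m = j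
      · subst h; simp
      · simp [h]
    rw [← h2]
    exact_mod_cast this.symm
  simp only [Finset.sum_apply, Pi.smul_apply, smul_eq_mul, lR, coeLat, Finset.sum_mul]
  rw [Finset.sum_comm]
  have : ∀ j, ∑ i, z j * (l i (Pi.single j 1) : ℝ) * (v i m : ℝ) = z j * (D * (Pi.single j 1 : Fin 4 → ℝ) m) := by
    intro j
    rw [← h1, Finset.mul_sum]
    exact Finset.sum_congr rfl fun i _ => by ring
  simp only [this]
  rw [Finset.sum_eq_single m]
  · simp; ring
  · intro j _ hj; simp [hj.symm]
  · simp

lemma exists_dual (v : Fin 4 → Fin 4 → ℤ) (hind : ∀ c : Fin 4 → ℝ, ∑ i, c i • coeLat (v i) = 0 → c = 0) :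
    ∃ (D : ℤ) (l : Fin 4 → (Fin 4 → ℤ) →+ ℤ), 0 < D ∧ (∀ i j, l i (v j) = if i = j then D else 0) ∧
      ∀ x, D • x = ∑ i, l i x • v i := by
  let M : Matrix (Fin 4) (Fin 4) ℤ := Matrix.of v
  have hdet : M.det ≠ 0 := by
    intro h
    obtain ⟨u, hu, hu0⟩ := Matrix.exists_vecMul_eq_zero_iff.2 h
    apply hu
    have : coeLat u = 0 := by
      apply hind
      ext m
      have := congrFun hu0 m
      simp only [Matrix.vecMul, dotProduct, Matrix.of_apply, M, Pi.zero_apply] at this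
      simp only [Finset.sum_apply, Pi.smul_apply, smul_eq_mul, coeLat, Pi.zero_apply]
      exact_mod_cast this
    ext m
    have := congrFun this m
    simpa [coeLat] using this
  refine ⟨M.det.sign * M.det, fun i => AddMonoidHom.mk' (fun x => M.det.sign * (Matrix.vecMul x M.adjugate i)) 
    (fun x y => by simp [Matrix.add_vecMul, mul_add]), ?_, ?_, ?_⟩
  · rw [Int.sign_mul_self_eq_abs]; exact abs_pos.2 hdet
  · intro i j
    have h1 : Matrix.vecMul (v j) M.adjugate i = (M * M.adjugate) j i := rfl
    simp only [AddMonoidHom.mk'_apply, h1, Matrix.mul_adjugate]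
    by_cases h : i = j
    · simp [h]
    · simp [h, Ne.symm h]
  · intro x
    have h1 : Matrix.vecMul (Matrix.vecMul x M.adjugate) M = M.det • x := by
      rw [Matrix.vecMul_vecMul, Matrix.adjugate_mul, Matrix.vecMul_smul, Matrix.vecMul_one]
    ext m
    have := congrFun h1 m
    simp only [Matrix.vecMul, dotProduct, Matrix.of_apply, M, Pi.smul_apply, smul_eq_mul] at this
    simp only [AddMonoidHom.mk'_apply, Pi.smul_apply, smul_eq_mul, Finset.sum_apply, Matrix.vecMul, dotProduct, M]
    rw [mul_assoc, ← this, Finset.mul_sum]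
    exact Finset.sum_congr rfl fun i _ => by ring

section
variable {k : ℕ} {Y : Finset (Fin 4 → ℤ)} {V : Fin k → Fin 4 → ℤ}

lemma sum_extend {g : Fin 4 → Fin k} (hg : Function.Injective g) (c : Fin 4 → ℝ) :
    ∑ j, Function.extend g c 0 j = ∑ i, c i := by
  symm
  apply Fintype.sum_of_injective g hg
  · intro i hi; rw [Function.extend_apply' _ _ _ (by simpa using hi)]; rfl
  · intro i; rw [hg.extend_apply]

lemma comb_extend {g : Fin 4 → Fin k} (hg : Function.Injective g) (c : Fin 4 → ℝ) :
    comb V (Function.extend g c 0) = ∑ i, c i • coeLat (V (g i)) := by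
  rw [comb_apply]
  symm
  apply Fintype.sum_of_injective g hg
  · intro i hi; rw [Function.extend_apply' _ _ _ (by simpa using hi)]; simp
  · intro i; rw [hg.extend_apply]

structure Cell (Y : Finset (Fin 4 → ℤ)) (V : Fin k → Fin 4 → ℤ) (σ : Finset (Fin k)) (D : ℤ) 
    (l : Fin 4 → (Fin 4 → ℤ) →+ ℤ) (g : Fin 4 → Fin k) : Prop where
  opt : Opt V σ
  inj : Function.Injective g
  mem : ∀ j, j ∈ σ ↔ ∃ i, g i = j
  Dpos : 0 < D
  dual : ∀ i j, l i (V (g j)) = if i = j then D else 0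
  expand : ∀ x, D • x = ∑ i, l i x • V (g i)

lemma exists_cell (Y : Finset (Fin 4 → ℤ)) {σ : Finset (Fin k)} (hσ : Opt V σ) (hc : σ.card = 4) : ∃ D l g, Cell Y V σ D l g := by
  let g : Fin 4 → Fin k := σ.orderEmbOfFin hc
  have hg : Function.Injective g := (σ.orderEmbOfFin hc).injective
  have hmem : ∀ j, j ∈ σ ↔ ∃ i, g i = j := by
    intro j
    have := Finset.range_orderEmbOfFin σ hc
    rw [← Finset.mem_coe, ← this]; rfl
  obtain ⟨D, l, h1, h2, h3⟩ := exists_dual (fun i => V (g i)) (by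
    intro c hc
    rw [← comb_extend hg] at hc
    have := hσ.indep (fun i hi => by
      rw [Function.extend_apply' _ _ _ (by rwa [hmem] at hi)]; rfl) hc
    ext i
    have := congrFun this (g i)
    rwa [hg.extend_apply] at this)
  exact ⟨D, l, g, hσ, hg, hmem, h1, h2, h3⟩

namespace Cell
variable {σ : Finset (Fin k)} {D : ℤ} {l : Fin 4 → (Fin 4 → ℤ) →+ ℤ} {g : Fin 4 → Fin k}

def cf (D : ℤ) (l : Fin 4 → (Fin 4 → ℤ) →+ ℤ) (g : Fin 4 → Fin k) (z : Fin 4 → ℝ) : Fin k → ℝ := 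
  Function.extend g (fun i => lR l i z / D) 0

lemma cf_g (h : Cell Y V σ D l g) (z : Fin 4 → ℝ) (i : Fin 4) : cf D l g z (g i) = lR l i z / D := by
  rw [cf, h.inj.extend_apply]

lemma cf_off (h : Cell Y V σ D l g) (z : Fin 4 → ℝ) (j : Fin k) (hj : j ∉ σ) : cf D l g z j = 0 := by
  rw [cf, Function.extend_apply' _ _ _ (by rwa [h.mem] at hj)]; rfl

lemma cf_comb (h : Cell Y V σ D l g) (z : Fin 4 → ℝ) : comb V (cf D l g z) = z := by
  rw [cf, comb_extend h.inj]
  have h1 := lR_expand h.expand z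
  have hD : (D : ℝ) ≠ 0 := by exact_mod_cast h.Dpos.ne'
  have : ∑ i, (lR l i z / D) • coeLat (V (g i)) = (D : ℝ)⁻¹ • ∑ i, lR l i z • coeLat (V (g i)) := by
    rw [Finset.smul_sum]
    exact Finset.sum_congr rfl fun i _ => by rw [smul_smul]; congr 1; field_simp
  rw [this, h1, smul_smul, inv_mul_cancel₀ hD, one_smul]

lemma cf_nonneg (h : Cell Y V σ D l g) (z : Fin 4 → ℝ) (hz : ∀ i, 0 ≤ lR l i z) (j : Fin k) : 0 ≤ cf D l g z j := by
  by_cases hj : j ∈ σ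
  · obtain ⟨i, rfl⟩ := (h.mem j).1 hj
    rw [h.cf_g]
    have hD : (0 : ℝ) < D := by exact_mod_cast h.Dpos
    have := hz i
    positivity
  · rw [h.cf_off z j hj]

lemma sum_l (hF : FanHyp Y V) (h : Cell Y V σ D l g) (x : Fin 4 → ℤ) (hx : ∀ i, 0 ≤ l i x) :
    ∑ i, l i x = D * fY Y x := by
  have h1 := hF.sum_eq h.opt (h.cf_nonneg (coeLat x) (fun i => by rw [lR_coe]; exact_mod_cast hx i)) 
    (h.cf_off _) x (h.cf_comb _)
  rw [cf, sum_extend h.inj] at h1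
  simp only [lR_coe] at h1
  have hD : (D : ℝ) ≠ 0 := by exact_mod_cast h.Dpos.ne'
  rw [← Finset.sum_div, div_eq_iff hD] at h1
  rw [mul_comm]
  exact_mod_cast h1

lemma coneData (hF : FanHyp Y V) (h : Cell Y V σ D l g) : ConeData D (fun i => V (g i)) l :=
  ⟨h.Dpos, h.dual, h.expand, fun x hx => ⟨_, h.sum_l hF x hx⟩⟩

end Cell

def Generic (V : Fin k → Fin 4 → ℤ) (w : Fin 4 → ℝ) : Prop :=
  ∀ x : Fin 4 → ℤ, ∀ τ : Finset (Fin k), τ.card ≤ 3 → ∀ c : Fin k → ℝ, (∀ i ∉ τ, c i = 0) → 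
    comb V c ≠ coeLat x + w

lemma Generic.neg {w : Fin 4 → ℝ} (h : Generic V w) : Generic V (-w) := by
  intro x τ hτ c hc he
  apply h (-x) τ hτ (-c) (fun i hi => by simp [hc i hi])
  rw [map_neg, he]
  have : coeLat (-x) = - coeLat x := by ext; simp [coeLat]
  rw [this]; abel

lemma exists_generic (V : Fin k → Fin 4 → ℤ) (U : Set (Fin 4 → ℝ)) (hU : U ∈ nhds 0) : 
    ∃ w ∈ U, Generic V w := by
  let S : Finset (Fin k) → Submodule ℝ (Fin 4 → ℝ) := fun τ => 
    Submodule.span ℝ ((τ.image fun i => coeLat (V i) : Finset (Fin 4 → ℝ)) : Set (Fin 4 → ℝ))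
  have hS : ∀ τ : Finset (Fin k), τ.card ≤ 3 → volume (S τ : Set (Fin 4 → ℝ)) = 0 := by
    intro τ hτ
    apply Measure.addHaar_submodule
    intro htop
    have h1 : Module.finrank ℝ (S τ) ≤ 3 := 
      (finrank_span_finset_le_card _).trans (Finset.card_image_le.trans hτ)
    rw [htop, finrank_top] at h1
    simp at h1
  let N : Set (Fin 4 → ℝ) := ⋃ x : Fin 4 → ℤ, ⋃ τ : {τ : Finset (Fin k) // τ.card ≤ 3}, 
    (fun w => coeLat x + w) ⁻¹' (S τ.1 : Set (Fin 4 → ℝ))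
  have hN : volume N = 0 := by
    apply measure_iUnion_null
    intro x
    apply measure_iUnion_null
    intro τ
    rw [measure_preimage_add]
    exact hS τ.1 τ.2
  have hpos : 0 < volume U := Measure.measure_pos_of_mem_nhds _ hU
  obtain ⟨w, hw, hwN⟩ : ∃ w ∈ U, w ∉ N := by
    by_contra! h
    have : volume U ≤ volume N := measure_mono h
    rw [hN] at this
    exact absurd this (not_le.2 hpos)
  refine ⟨w, hw, ?_⟩
  intro x τ hτ c hc he
  apply hwN
  rw [Set.mem_iUnion]
  refine ⟨x, ?_⟩
  rw [Set.mem_iUnion]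
  refine ⟨⟨τ, hτ⟩, ?_⟩
  rw [Set.mem_preimage, ← he, comb_apply]
  apply Submodule.sum_mem
  intro i _
  by_cases hi : i ∈ τ
  · apply Submodule.smul_mem
    apply Submodule.subset_span
    simp only [Finset.coe_image]
    exact ⟨i, hi, rfl⟩
  · rw [hc i hi, zero_smul]; exact Submodule.zero_mem _

lemma Opt.card_le {σ : Finset (Fin k)} (hσ : Opt V σ) : σ.card ≤ 4 := by
  have : LinearIndependent ℝ (fun i : σ => coeLat (V i)) := by
    rw [Fintype.linearIndependent_iff]
    intro c hc i
    have hex : ∀ i : σ, Function.extend Subtype.val c (0 : Fin k → ℝ) i = c i := fun i => 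
      Subtype.val_injective.extend_apply _ _ _
    have h0 : Function.extend Subtype.val c (0 : Fin k → ℝ) = 0 := by
      apply hσ.indep
      · intro i hi
        rw [Function.extend_apply' _ _ _ (by simpa using hi)]; rfl
      · rw [comb_apply, ← hc]
        symm
        apply Fintype.sum_of_injective _ Subtype.val_injective
        · intro i hi; rw [Function.extend_apply' _ _ _ (by simpa using hi)]; simp
        · intro i; rw [hex]
    rw [← hex, h0]; rfl
  have := this.fintype_card_le_finrank
  simpa using this
end

end

section

section
variable {k : ℕ} {Y : Finset (Fin 4 → ℤ)} {V : Fin k → Fin 4 → ℤ}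

def ee (l : Fin 4 → (Fin 4 → ℤ) →+ ℤ) (w : Fin 4 → ℝ) (i : Fin 4) : ℤ := if 0 < lR l i w then 0 else 1

lemma Cell.ne_zero {σ D l g} (h : Cell Y V σ D l g) {w : Fin 4 → ℝ} (hw : Generic V w) (i : Fin 4) : lR l i w ≠ 0 := by
  intro h0
  have hi : g i ∈ σ := (h.mem _).2 ⟨i, rfl⟩
  have hcard : σ.card ≤ 4 := h.opt.card_le
  apply hw 0 (σ.erase (g i)) (by rw [Finset.card_erase_of_mem hi]; omega) (Cell.cf D l g w)
  · intro j hj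
    by_cases hj' : j ∈ σ
    · have : j = g i := by
        by_contra hne
        exact hj (Finset.mem_erase.2 ⟨hne, hj'⟩)
      rw [this, h.cf_g, h0]; simp
    · exact h.cf_off _ _ hj'
  · rw [h.cf_comb]
    ext; simp [coeLat]

/-- membership in the half-open cone -/
lemma Cell.mem_iff {σ D l g} (h : Cell Y V σ D l g) {w : Fin 4 → ℝ} (hw : Generic V w)
    (hs : ∀ i, |lR l i w| < 1) (x : Fin 4 → ℤ) :
    (∀ i, ee l w i ≤ l i x) ↔ ∀ i, 0 < lR l i (coeLat x + w) := by
  apply forall_congr'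
  intro i
  have h1 := h.ne_zero hw i
  have h2 := abs_lt.1 (hs i)
  rw [lR_add, lR_coe, ee]
  split_ifs with h3
  · constructor
    · intro h4
      have : (0 : ℝ) ≤ l i x := by exact_mod_cast h4
      linarith
    · intro h4
      have : (-1 : ℝ) < l i x := by linarith
      have : -1 < l i x := by exact_mod_cast this
      omega
  · constructor
    · intro h4
      have : (1 : ℝ) ≤ l i x := by exact_mod_cast h4
      linarith
    · intro h4
      have h5 : lR l i w < 0 := lt_of_le_of_ne (not_lt.1 h3) h1
      have : (0 : ℝ) < l i x := by linarith
      have : 0 < l i x := by exact_mod_cast this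
      omega

lemma partition (hF : FanHyp Y V) (T : Finset (Finset (Fin k))) (hT : ∀ σ, σ ∈ T ↔ Opt V σ ∧ σ.card = 4)
    (D : Finset (Fin k) → ℤ) (l : Finset (Fin k) → Fin 4 → (Fin 4 → ℤ) →+ ℤ) (g : Finset (Fin k) → Fin 4 → Fin k)
    (hC : ∀ σ ∈ T, Cell Y V σ (D σ) (l σ) (g σ)) {w : Fin 4 → ℝ} (hw : Generic V w) 
    (hs : ∀ σ ∈ T, ∀ i, |lR (l σ) i w| < 1) (hfin : ∀ n : ℕ, {x : Fin 4 → ℤ | fY Y x = n}.Finite) (n : ℕ) :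
    LL Y n = ∑ σ ∈ T, coneCount (D σ) (l σ) (ee (l σ) w) n := by
  have he0 : ∀ σ i, 0 ≤ ee (l σ) w i := fun σ i => by rw [ee]; split_ifs <;> simp
  have hmem : ∀ σ ∈ T, ∀ x, ((∀ i, ee (l σ) w i ≤ l σ i x) ∧ ∑ i, l σ i x = D σ * n) ↔
      (∀ i, ee (l σ) w i ≤ l σ i x) ∧ fY Y x = n := by
    intro σ hσ x
    apply and_congr_right
    intro h1
    rw [(hC σ hσ).sum_l hF x (fun i => (he0 σ i).trans (h1 i))]
    exact mul_right_inj' (hC σ hσ).Dpos.ne'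
  have hf : ∀ σ, ({x | (∀ i, ee (l σ) w i ≤ l σ i x) ∧ fY Y x = n} : Set (Fin 4 → ℤ)).Finite := fun σ => 
    (hfin n).subset fun x hx => hx.2
  have hset : {x : Fin 4 → ℤ | fY Y x = n} = ((T.biUnion fun σ => (hf σ).toFinset : Finset (Fin 4 → ℤ)) : Set (Fin 4 → ℤ)) := by
    ext x
    simp only [Finset.coe_biUnion, Set.mem_iUnion, Finset.mem_coe, Set.mem_ofPred_eq,
      exists_prop, Set.Finite.coe_toFinset]
    constructor
    · intro hx
      obtain ⟨σ, hσ, c, hc, hc1, hc0⟩ := hF.exists_opt (coeLat x + w)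
      have hcard : σ.card = 4 := by
        apply le_antisymm hσ.card_le
        by_contra hlt
        exact hw x σ (by omega) c hc0 hc
      have hσT : σ ∈ T := (hT σ).2 ⟨hσ, hcard⟩
      refine ⟨σ, hσT, ?_, hx⟩
      rw [(hC σ hσT).mem_iff hw (hs σ hσT)]
      intro i
      have hcell := hC σ hσT
      have heq : c - Cell.cf (D σ) (l σ) (g σ) (coeLat x + w) = 0 := by
        apply hσ.indep
        · intro j hj; simp [hc0 j hj, hcell.cf_off _ j hj]
        · rw [map_sub, hcell.cf_comb, hc, sub_self]
      have h1 : c (g σ i) = lR (l σ) i (coeLat x + w) / D σ := by rw [sub_eq_zero.1 heq, hcell.cf_g]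
      have h2 := hc1 (g σ i) ((hcell.mem _).2 ⟨i, rfl⟩)
      rw [h1] at h2
      have hD : (0 : ℝ) < D σ := by exact_mod_cast hcell.Dpos
      exact (div_pos_iff_of_pos_right hD).1 h2
    · rintro ⟨σ, _, _, h⟩; exact h
  rw [LL, hset, Set.ncard_coe_finset, Finset.card_biUnion]
  · apply Finset.sum_congr rfl
    intro σ hσ
    rw [coneCount, ← Set.ncard_eq_toFinset_card _ (hf σ)]
    congr 1
    ext x
    exact (hmem σ hσ x).symm
  · intro σ hσ τ hτ hne
    simp only [Function.onFun]
    rw [Finset.disjoint_left]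
    intro x hx hx'
    simp only [Set.Finite.mem_toFinset, Set.mem_ofPred_eq] at hx hx'
    apply hne
    have h1 := hC σ hσ
    have h2 := hC τ hτ
    have hx1 := (h1.mem_iff hw (hs σ hσ) x).1 hx.1
    have hx2 := (h2.mem_iff hw (hs τ hτ) x).1 hx'.1
    have heq := h1.opt.unique h2.opt (h1.cf_nonneg (coeLat x + w) fun i => (hx1 i).le)
      (h2.cf_nonneg (coeLat x + w) fun i => (hx2 i).le) (h1.cf_off _) (h2.cf_off _) 
      (by rw [h1.cf_comb, h2.cf_comb])
    have hsup : ∀ {σ D l g}, Cell Y V σ D l g → (∀ i, 0 < lR l i (coeLat x + w)) → 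
        ∀ j, j ∈ σ ↔ Cell.cf D l g (coeLat x + w) j ≠ 0 := by
      intro σ D l g h hx j
      constructor
      · intro hj
        obtain ⟨i, rfl⟩ := (h.mem j).1 hj
        rw [h.cf_g]
        have hD : (0 : ℝ) < D := by exact_mod_cast h.Dpos
        exact (div_pos (hx i) hD).ne'
      · intro hj
        by_contra hj'
        exact hj (h.cf_off _ j hj')
    ext j
    rw [hsup h1 hx1, hsup h2 hx2, heq]

theorem ehrhart (hF : FanHyp Y V) (hfin : ∀ n : ℕ, {x : Fin 4 → ℤ | fY Y x = n}.Finite) :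
    ∃ a1 a3 : ℝ, ∀ n : ℕ, 1 ≤ n → (LL Y n : ℝ) = a1 * n + a3 * n ^ 3 := by
  classical
  let T : Finset (Finset (Fin k)) := Finset.univ.filter fun σ => Opt V σ ∧ σ.card = 4
  have hT : ∀ σ, σ ∈ T ↔ Opt V σ ∧ σ.card = 4 := by simp [T]
  have hex : ∀ σ, ∃ D l g, σ ∈ T → Cell Y V σ D l g := by
    intro σ
    by_cases h : σ ∈ T
    · obtain ⟨D, l, g, h1⟩ := exists_cell Y ((hT σ).1 h).1 ((hT σ).1 h).2
      exact ⟨D, l, g, fun _ => h1⟩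
    · by_cases hk : Nonempty (Fin k)
      · exact ⟨0, 0, fun _ => hk.some, fun h' => absurd h' h⟩
      · exfalso
        obtain ⟨c, hc, hcx, y, hy, hs⟩ := hF.rep (fun _ => 1)
        rw [not_nonempty_iff] at hk
        have := congrFun hcx 0
        simp [comb_apply] at this
  choose D l g hC using hex
  have hsmall : ∀ᶠ w : Fin 4 → ℝ in nhds 0, ∀ σ i, |lR (l σ) i w| < 1 := by
    rw [eventually_all]; intro σ
    rw [eventually_all]; intro i
    have hcont : Continuous fun w => |lR (l σ) i w| := by unfold lR; fun_prop
    have : |lR (l σ) i 0| < 1 := by simp [lR]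
    exact hcont.continuousAt.eventually (gt_mem_nhds this)
  obtain ⟨w, hwU, hw⟩ := exists_generic V _ hsmall
  have hwU' : ∀ σ i, |lR (l σ) i w| < 1 := hwU
  have h1 := partition hF T hT D l g (fun σ h => hC σ h) hw (fun σ _ => hwU' σ) hfin
  have h2 := partition hF T hT D l g (fun σ h => hC σ h) hw.neg 
    (fun σ _ i => by rw [lR_neg, abs_neg]; exact hwU' σ i) hfin
  have hee : ∀ σ ∈ T, ee (l σ) (-w) = fun i => 1 - ee (l σ) w i := by
    intro σ hσ
    ext i
    have := (hC σ hσ).ne_zero hw i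
    simp only [ee, lR_neg]
    split_ifs with h3 h4 h4
    · linarith
    · rfl
    · rfl
    · exfalso; apply this; linarith
  have hrec : ∀ σ, ∃ a0 a1 a2 a3 : ℝ, σ ∈ T → ∀ n : ℕ, 1 ≤ n → 
      (coneCount (D σ) (l σ) (ee (l σ) w) n : ℝ) = a0 + a1 * n + a2 * n ^ 2 + a3 * n ^ 3 ∧
      (coneCount (D σ) (l σ) (fun i => 1 - ee (l σ) w i) n : ℝ) = -a0 + a1 * n - a2 * n ^ 2 + a3 * n ^ 3 := by
    intro σ
    by_cases h : σ ∈ T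
    · obtain ⟨a0, a1, a2, a3, h⟩ := coneCount_recip ((hC σ h).coneData hF) (ee (l σ) w) 
        (fun i => by rw [ee]; split_ifs <;> simp)
      exact ⟨a0, a1, a2, a3, fun _ => h⟩
    · exact ⟨0, 0, 0, 0, fun h' => absurd h' h⟩
  choose a0 a1 a2 a3 ha using hrec
  have e1 : ∀ n : ℕ, 1 ≤ n → (LL Y n : ℝ) = ∑ σ ∈ T, a0 σ + (∑ σ ∈ T, a1 σ) * n + (∑ σ ∈ T, a2 σ) * n ^ 2 + (∑ σ ∈ T, a3 σ) * n ^ 3 := by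
    intro n hn
    rw [h1 n]
    push_cast
    rw [Finset.sum_congr rfl fun σ hσ => (ha σ hσ n hn).1]
    simp only [Finset.sum_add_distrib, Finset.sum_mul]
  have e2 : ∀ n : ℕ, 1 ≤ n → (LL Y n : ℝ) = -∑ σ ∈ T, a0 σ + (∑ σ ∈ T, a1 σ) * n - (∑ σ ∈ T, a2 σ) * n ^ 2 + (∑ σ ∈ T, a3 σ) * n ^ 3 := by
    intro n hn
    rw [h2 n]
    push_cast
    rw [Finset.sum_congr rfl fun σ hσ => by rw [hee σ hσ, (ha σ hσ n hn).2]]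
    simp only [Finset.sum_add_distrib, Finset.sum_sub_distrib, Finset.sum_neg_distrib, Finset.sum_mul]
  refine ⟨∑ σ ∈ T, a1 σ, ∑ σ ∈ T, a3 σ, fun n hn => ?_⟩
  have f1 := e1 1 le_rfl
  have f2 := e1 2 (by norm_num)
  have g1 := e2 1 le_rfl
  have g2 := e2 2 (by norm_num)
  push_cast at f1 f2 g1 g2
  have h0 : ∑ σ ∈ T, a0 σ = 0 := by linarith
  have h2 : ∑ σ ∈ T, a2 σ = 0 := by linarith
  rw [e1 n hn, h0, h2]
  ring
end

end

section


def FF (Y : Finset (Fin 4 → ℤ)) (y₁ y₂ : Fin 4 → ℤ) (m : ℕ) : ℕ :=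
  Set.ncard {x : Fin 4 → ℤ | y₁ ⬝ᵥ x = m ∧ y₂ ⬝ᵥ x = m ∧ ∀ y ∈ Y, y ⬝ᵥ x ≤ m}

lemma fY_le_finite {Y : Finset (Fin 4 → ℤ)} {C : ℤ} (hY : CoreHyp Y C) (n : ℤ) :
    {x : Fin 4 → ℤ | fY Y x ≤ n}.Finite :=
  (bx (C * n)).finite_toSet.subset fun _ hx => mem_bx_of_fY hY le_rfl hx

lemma ncard_layers (S : Set (Fin 4 → ℤ)) (hS : S.Finite) (h : (Fin 4 → ℤ) → ℤ) (N : ℕ) 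
    (hh : ∀ x ∈ S, 0 ≤ h x ∧ h x ≤ N) :
    S.ncard = ∑ m ∈ Finset.range (N + 1), Set.ncard {x | x ∈ S ∧ h x = m} := by
  classical
  have hf : ∀ m : ℕ, {x | x ∈ S ∧ h x = m}.Finite := fun m => hS.subset fun x hx => hx.1
  have hset : S = (((Finset.range (N + 1)).biUnion fun m => (hf m).toFinset : Finset (Fin 4 → ℤ)) : Set (Fin 4 → ℤ)) := by
    ext x
    simp only [Finset.coe_biUnion, Set.mem_iUnion, Finset.mem_coe, Set.mem_ofPred_eq, exists_prop, 
      Set.Finite.coe_toFinset, Finset.mem_range]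
    constructor
    · intro hx
      obtain ⟨h1, h2⟩ := hh x hx
      exact ⟨(h x).toNat, by omega, hx, by omega⟩
    · rintro ⟨m, _, hx, _⟩; exact hx
  conv_lhs => rw [hset]
  rw [Set.ncard_coe_finset, Finset.card_biUnion]
  · exact Finset.sum_congr rfl fun m _ => (Set.ncard_eq_toFinset_card _ (hf m)).symm
  · intro m _ m' _ hne
    simp only [Function.onFun]
    rw [Finset.disjoint_left]
    intro x hx hx'
    simp only [Set.Finite.mem_toFinset, Set.mem_ofPred_eq] at hx hx'
    apply hne
    have := hx.2.symm.trans hx'.2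
    exact_mod_cast this

lemma EE_eq {Y : Finset (Fin 4 → ℤ)} {C : ℤ} (hY : CoreHyp Y C) {y₁ y₂ : Fin 4 → ℤ} (hy : y₁ ∈ Y) (N : ℕ) :
    EE Y y₁ y₂ N = ∑ m ∈ Finset.range (N + 1), FF Y y₁ y₂ m := by
  have hf : ∀ x : Fin 4 → ℤ, (∀ y ∈ Y, y ⬝ᵥ x ≤ y₁ ⬝ᵥ x) → fY Y x = y₁ ⬝ᵥ x := fun x hx => fY_eq hy hx
  rw [EE, ncard_layers _ _ (fun x => y₁ ⬝ᵥ x) N]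
  · apply Finset.sum_congr rfl
    intro m hm
    rw [FF]
    congr 1
    ext x
    simp only [Set.mem_ofPred_eq]
    have hm' : (m : ℤ) ≤ N := by have := Finset.mem_range.1 hm; omega
    constructor
    · rintro ⟨⟨h1, h2, h3⟩, h4⟩
      exact ⟨h4, by rw [← h1, h4], by rwa [h4] at h3⟩
    · rintro ⟨h1, h2, h3⟩
      exact ⟨⟨by rw [h1, h2], by omega, by rwa [h1]⟩, h1⟩
  · rintro x ⟨h1, h2, h3⟩
    exact ⟨by rw [← hf x h3]; exact fY_nonneg hY x, h2⟩
  · apply (fY_le_finite hY N).subset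
    rintro x ⟨h1, h2, h3⟩
    rw [Set.mem_ofPred_eq, hf x h3]; exact h2

lemma fball_eq {Y : Finset (Fin 4 → ℤ)} {C : ℤ} (hY : CoreHyp Y C) (N : ℕ) :
    Set.ncard {x : Fin 4 → ℤ | fY Y x ≤ N} = ∑ m ∈ Finset.range (N + 1), LL Y m := by
  rw [ncard_layers _ (fY_le_finite hY N) (fY Y) N]
  · apply Finset.sum_congr rfl
    intro m hm
    rw [LL]
    congr 1
    ext x
    simp only [Set.mem_ofPred_eq]
    have hm' : (m : ℤ) ≤ N := by have := Finset.mem_range.1 hm; omega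
    constructor
    · rintro ⟨_, h⟩; exact h
    · intro h; exact ⟨by omega, h⟩
  · intro x hx
    exact ⟨fY_nonneg hY x, hx⟩

lemma sum_sq (N : ℕ) : ∑ m ∈ Finset.range N, (m : ℝ) ^ 2 = N ^ 3 / 3 - N ^ 2 / 2 + N / 6 := by
  induction N with
  | zero => simp
  | succ N ih => rw [Finset.sum_range_succ, ih]; push_cast; ring

/-- weighted Cesàro -/
lemma cesaro_sq (f : ℕ → ℝ) (A : ℝ) (h : Tendsto (fun m : ℕ => f m / (m : ℝ) ^ 2) atTop (nhds A)) :
    Tendsto (fun N : ℕ => (∑ m ∈ Finset.range N, f m) / (N : ℝ) ^ 3) atTop (nhds (A / 3)) := by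
  have h1 : (fun m : ℕ => f m - A * (m : ℝ) ^ 2) =o[atTop] fun m : ℕ => (m : ℝ) ^ 2 := by
    rw [Asymptotics.isLittleO_iff_tendsto']
    · have : Tendsto (fun m : ℕ => f m / (m : ℝ) ^ 2 - A) atTop (nhds (A - A)) := h.sub_const A
      rw [sub_self] at this
      apply this.congr'
      filter_upwards [eventually_gt_atTop 0] with m hm
      have : (m : ℝ) ≠ 0 := by exact_mod_cast hm.ne'
      field_simp
    · filter_upwards [eventually_gt_atTop 0] with m hm h0
      have : (m : ℝ) ≠ 0 := by exact_mod_cast hm.ne'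
      exact absurd h0 (by positivity)
  have hlim : Tendsto (fun N : ℕ => (1 / 3 - (1 / 2) * ((N : ℝ))⁻¹ + (1 / 6) * (((N : ℝ))⁻¹) ^ 2)) atTop 
      (nhds (1 / 3 - (1 / 2) * 0 + (1 / 6) * 0 ^ 2)) := by
    have h0 : Tendsto (fun N : ℕ => ((N : ℝ))⁻¹) atTop (nhds 0) := tendsto_inv_atTop_nhds_zero_nat
    exact (tendsto_const_nhds.sub (h0.const_mul _)).add ((h0.pow 2).const_mul _)
  have hsq : Tendsto (fun N : ℕ => (∑ m ∈ Finset.range N, (m : ℝ) ^ 2) / (N : ℝ) ^ 3) atTop (nhds (1 / 3)) := by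
    have e : (1 / 3 - (1 / 2) * 0 + (1 / 6) * 0 ^ 2 : ℝ) = 1 / 3 := by norm_num
    rw [e] at hlim
    apply hlim.congr'
    filter_upwards [eventually_gt_atTop 0] with N hN
    have : (N : ℝ) ≠ 0 := by exact_mod_cast hN.ne'
    rw [sum_sq]
    field_simp
  have h2 := h1.sum_range (fun m => by positivity) (by
    have h3 : Tendsto (fun N : ℕ => (∑ m ∈ Finset.range N, (m : ℝ) ^ 2) / (N : ℝ) ^ 3 * (N : ℝ) ^ 3) atTop atTop := by
      apply hsq.pos_mul_atTop (by norm_num)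
      exact (tendsto_pow_atTop (by norm_num)).comp tendsto_natCast_atTop_atTop
    apply h3.congr'
    filter_upwards [eventually_gt_atTop 0] with N hN
    have : (N : ℝ) ≠ 0 := by exact_mod_cast hN.ne'
    field_simp)
  have h4 := h2.tendsto_div_nhds_zero
  have h5 := (h4.mul hsq).add (hsq.const_mul A)
  have e : (0 * (1 / 3) + A * (1 / 3) : ℝ) = A / 3 := by ring
  rw [e] at h5
  apply h5.congr'
  filter_upwards [eventually_gt_atTop 1] with N hN
  have hN1 : (1 : ℝ) < N := by exact_mod_cast hN
  have hpos : ∑ m ∈ Finset.range N, (m : ℝ) ^ 2 ≠ 0 := by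
    apply ne_of_gt
    apply Finset.sum_pos' (fun m _ => by positivity)
    exact ⟨1, by simpa using hN, by simp⟩
  simp only [Finset.sum_sub_distrib, ← Finset.mul_sum]
  field_simp
  ring

lemma EE_lim {Y : Finset (Fin 4 → ℤ)} {C : ℤ} (hY : CoreHyp Y C) {y₁ y₂ : Fin 4 → ℤ} (hy : y₁ ∈ Y) {A : ℝ}
    (h : Tendsto (fun m : ℕ => 2 * (FF Y y₁ y₂ m : ℝ) / (m : ℝ) ^ 2) atTop (nhds A)) :
    Tendsto (fun n : ℕ => (EE Y y₁ y₂ (2 * n) : ℝ) / (n : ℝ) ^ 3) atTop (nhds (4 / 3 * A)) := by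
  have h1 : Tendsto (fun m : ℕ => (FF Y y₁ y₂ m : ℝ) / (m : ℝ) ^ 2) atTop (nhds (A / 2)) := by
    apply (h.div_const 2).congr
    intro m; ring
  have h2 := cesaro_sq _ _ h1
  have h3 : Tendsto (fun n : ℕ => 2 * n + 1) atTop atTop := by
    apply tendsto_atTop_mono (f := fun n => n) (fun n => by omega) tendsto_id
  have h4 := h2.comp h3
  have h0 : Tendsto (fun N : ℕ => ((N : ℝ))⁻¹) atTop (nhds 0) := tendsto_inv_atTop_nhds_zero_nat
  have h5 : Tendsto (fun n : ℕ => (2 + ((n : ℝ))⁻¹) ^ 3) atTop (nhds ((2 + 0) ^ 3)) := (tendsto_const_nhds.add h0).pow 3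
  have h6 := h4.mul h5
  have e : (A / 2 / 3 * (2 + 0) ^ 3 : ℝ) = 4 / 3 * A := by ring
  rw [e] at h6
  apply h6.congr'
  filter_upwards [eventually_gt_atTop 0] with n hn
  have : (n : ℝ) ≠ 0 := by exact_mod_cast hn.ne'
  rw [EE_eq hY hy]
  simp only [Function.comp]
  push_cast
  have h7 : (2 * (n : ℝ) + 1) ≠ 0 := by positivity
  have h8 : (2 + (n : ℝ)⁻¹) = (2 * n + 1) / n := by field_simp
  rw [h8]
  field_simp

lemma AA_closed {Y : Finset (Fin 4 → ℤ)} {C : ℤ} (hY : CoreHyp Y C) {a1 a3 : ℝ} 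
    (hL : ∀ n : ℕ, 1 ≤ n → (LL Y n : ℝ) = a1 * n + a3 * n ^ 3) (n : ℕ) (hn : 1 ≤ n) :
    (AA Y 0 n : ℝ) = n * LL Y 0 + a1 * (n ^ 3 / 6 - n / 6) + a3 * (n ^ 5 / 20 - n ^ 3 / 12 + n / 30) := by
  rw [AA_zero hY hn]
  push_cast
  have h1 : ∀ m ∈ Finset.range n, ((n : ℝ) - m) * (LL Y m : ℝ) = (if m = 0 then (n : ℝ) * LL Y 0 else 0) + 
      a1 * (n * (m : ℝ) - (m : ℝ) ^ 2) + a3 * (n * (m : ℝ) ^ 3 - (m : ℝ) ^ 4) := by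
    intro m _
    by_cases hm : m = 0
    · subst hm; simp
    · rw [if_neg hm, hL m (by omega)]; ring
  rw [Finset.sum_congr rfl h1]
  have e1 : ∀ N : ℕ, ∑ m ∈ Finset.range N, (m : ℝ) = N ^ 2 / 2 - N / 2 := by
    intro N
    induction N with
    | zero => simp
    | succ N ih => rw [Finset.sum_range_succ, ih]; push_cast; ring
  have e3 : ∀ N : ℕ, ∑ m ∈ Finset.range N, (m : ℝ) ^ 3 = N ^ 4 / 4 - N ^ 3 / 2 + N ^ 2 / 4 := by
    intro N
    induction N with
    | zero => simp
    | succ N ih => rw [Finset.sum_range_succ, ih]; push_cast; ring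
  have e4 : ∀ N : ℕ, ∑ m ∈ Finset.range N, (m : ℝ) ^ 4 = N ^ 5 / 5 - N ^ 4 / 2 + N ^ 3 / 3 - N / 30 := by
    intro N
    induction N with
    | zero => simp
    | succ N ih => rw [Finset.sum_range_succ, ih]; push_cast; ring
  simp only [Finset.sum_add_distrib, Finset.sum_sub_distrib, ← Finset.mul_sum, e1, e3, e4, sum_sq]
  rw [Finset.sum_ite_eq' , if_pos (by simp; omega)]
  ring

lemma O2_tendsto {g : ℕ → ℤ} (h : O2 g) : Tendsto (fun n : ℕ => (g n : ℝ) / (n : ℝ) ^ 3) atTop (nhds 0) := by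
  obtain ⟨C, hC⟩ := h
  have h0 : Tendsto (fun N : ℕ => (C : ℝ) * ((N : ℝ))⁻¹) atTop (nhds (C * 0)) := 
    tendsto_inv_atTop_nhds_zero_nat.const_mul _
  rw [mul_zero] at h0
  apply squeeze_zero_norm' _ h0
  filter_upwards [hC, eventually_gt_atTop 0] with n hn hn0
  have : (0 : ℝ) < n := by exact_mod_cast hn0
  have h1 : |(g n : ℝ)| ≤ C * n ^ 2 := by exact_mod_cast hn
  rw [Real.norm_eq_abs, abs_div, abs_of_pos (by positivity : (0 : ℝ) < n ^ 3), div_le_iff₀ (by positivity)]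
  calc _ ≤ _ := h1
    _ = _ := by field_simp

theorem a1_eq {Y : Finset (Fin 4 → ℤ)} {C : ℤ} (hY : CoreHyp Y C) {a1 a3 : ℝ} 
    (hL : ∀ n : ℕ, 1 ≤ n → (LL Y n : ℝ) = a1 * n + a3 * n ^ 3) (A : (Fin 4 → ℤ) → (Fin 4 → ℤ) → ℝ)
    (hA : ∀ y₁ ∈ Y, ∀ y₂ ∈ Y, y₁ ≠ y₂ → 
      Tendsto (fun m : ℕ => 2 * (FF Y y₁ y₂ m : ℝ) / (m : ℝ) ^ 2) atTop (nhds (A y₁ y₂))) :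
    24 * a1 = ∑ y₁ ∈ Y, ∑ y₂ ∈ Y, if y₁ ≠ y₂ then (gl (y₁ - y₂) : ℝ) * A y₁ y₂ else 0 := by
  have h1 := O2_tendsto (core_asymp hY)
  have h2 : Tendsto (fun n : ℕ => (∑ y₁ ∈ Y, ∑ y₂ ∈ Y, if y₁ ≠ y₂ then (gl (y₁ - y₂) : ℝ) * 
      ((EE Y y₁ y₂ (2 * n) : ℝ) / (n : ℝ) ^ 3) else 0)) atTop (nhds (∑ y₁ ∈ Y, ∑ y₂ ∈ Y, 
        if y₁ ≠ y₂ then (gl (y₁ - y₂) : ℝ) * (4 / 3 * A y₁ y₂) else 0)) := by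
    apply tendsto_finsetSum
    intro y₁ hy1
    apply tendsto_finsetSum
    intro y₂ hy2
    by_cases hne : y₁ = y₂
    · simp [hne]
    · simp only [if_pos hne, ne_eq]
      exact (EE_lim hY hy1 (hA y₁ hy1 y₂ hy2 hne)).const_mul _
  have h3 := h1.add h2
  have h0 : Tendsto (fun N : ℕ => ((N : ℝ))⁻¹) atTop (nhds 0) := tendsto_inv_atTop_nhds_zero_nat
  have h4 : Tendsto (fun n : ℕ => 32 * a1 + (8 * (30 * LL Y 0 - 5 * a1 + a3) + 4 * a1) * (((n : ℝ))⁻¹) ^ 2) atTop 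
      (nhds (32 * a1 + (8 * (30 * LL Y 0 - 5 * a1 + a3) + 4 * a1) * 0 ^ 2)) := 
    tendsto_const_nhds.add ((h0.pow 2).const_mul _)
  have h5 := tendsto_nhds_unique (h3.congr' (f₂ := fun n : ℕ => 32 * a1 + (8 * (30 * LL Y 0 - 5 * a1 + a3) + 4 * a1) * (((n : ℝ))⁻¹) ^ 2) ?_) h4
  · have e : ∀ y₁ y₂ : Fin 4 → ℤ, (if y₁ ≠ y₂ then (gl (y₁ - y₂) : ℝ) * (4 / 3 * A y₁ y₂) else 0) =
        4 / 3 * (if y₁ ≠ y₂ then (gl (y₁ - y₂) : ℝ) * A y₁ y₂ else 0) := by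
      intro y₁ y₂; split_ifs <;> ring
    simp only [e, ← Finset.mul_sum] at h5
    linarith
  · filter_upwards [eventually_gt_atTop 0] with n hn
    have hn0 : (n : ℝ) ≠ 0 := by exact_mod_cast hn.ne'
    have e : ∀ y₁ y₂ : Fin 4 → ℤ, (if y₁ ≠ y₂ then (gl (y₁ - y₂) : ℝ) * ((EE Y y₁ y₂ (2 * n) : ℝ) / (n : ℝ) ^ 3) else 0) =
        (if y₁ ≠ y₂ then (gl (y₁ - y₂) : ℝ) * (EE Y y₁ y₂ (2 * n) : ℝ) else 0) / (n : ℝ) ^ 3 := by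
      intro y₁ y₂; split_ifs <;> ring
    simp only [e, ← Finset.sum_div, ← add_div]
    rw [div_eq_iff (by positivity)]
    push_cast
    rw [AA_closed hY hL n hn, AA_closed hY hL (2 * n) (by omega), hL (2 * n) (by omega)]
    push_cast
    field_simp
    ring

lemma ball_lim {Y : Finset (Fin 4 → ℤ)} {C : ℤ} (hY : CoreHyp Y C) {a1 a3 : ℝ} 
    (hL : ∀ n : ℕ, 1 ≤ n → (LL Y n : ℝ) = a1 * n + a3 * n ^ 3) :
    Tendsto (fun n : ℕ => (Set.ncard {x : Fin 4 → ℤ | fY Y x ≤ n} : ℝ) / (n : ℝ) ^ 4) atTop (nhds (a3 / 4)) := by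
  have hcl : ∀ n : ℕ, (Set.ncard {x : Fin 4 → ℤ | fY Y x ≤ n} : ℝ) = 
      LL Y 0 + a1 * (n ^ 2 / 2 + n / 2) + a3 * (n ^ 4 / 4 + n ^ 3 / 2 + n ^ 2 / 4) := by
    intro n
    rw [fball_eq hY]
    push_cast
    induction n with
    | zero => simp
    | succ n ih => 
      rw [Finset.sum_range_succ, ih, hL (n + 1) (by omega)]
      push_cast
      ring
  have h0 : Tendsto (fun N : ℕ => ((N : ℝ))⁻¹) atTop (nhds 0) := tendsto_inv_atTop_nhds_zero_nat
  have h1 : Tendsto (fun n : ℕ => LL Y 0 * (((n : ℝ))⁻¹) ^ 4 + a1 / 2 * (((n : ℝ))⁻¹) ^ 2 + a1 / 2 * (((n : ℝ))⁻¹) ^ 3 +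
      a3 / 4 + a3 / 2 * ((n : ℝ))⁻¹ + a3 / 4 * (((n : ℝ))⁻¹) ^ 2) atTop (nhds (LL Y 0 * 0 ^ 4 + a1 / 2 * 0 ^ 2 + a1 / 2 * 0 ^ 3 +
      a3 / 4 + a3 / 2 * 0 + a3 / 4 * 0 ^ 2)) := by
    exact (((((h0.pow 4).const_mul _).add ((h0.pow 2).const_mul _)).add ((h0.pow 3).const_mul _)).add
      tendsto_const_nhds).add (h0.const_mul _) |>.add ((h0.pow 2).const_mul _)
  have e : (LL Y 0 * 0 ^ 4 + a1 / 2 * 0 ^ 2 + a1 / 2 * 0 ^ 3 + a3 / 4 + a3 / 2 * 0 + a3 / 4 * 0 ^ 2 : ℝ) = a3 / 4 := by ring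
  rw [e] at h1
  apply h1.congr'
  filter_upwards [eventually_gt_atTop 0] with n hn
  have hn0 : (n : ℝ) ≠ 0 := by exact_mod_cast hn.ne'
  rw [hcl]
  field_simp
  ring

end

section


/-- A dual pair of lattice polytopes. -/
structure DP (P Q : Set (Fin 4 → ℝ)) : Prop where
  latP : IsLatticePolytope P
  latQ : IsLatticePolytope Q
  zeroP : (0 : Fin 4 → ℝ) ∈ interior P
  zeroQ : (0 : Fin 4 → ℝ) ∈ interior Q
  memP : ∀ x, x ∈ P ↔ ∀ y ∈ Q, -1 ≤ y ⬝ᵥ x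
  memQ : ∀ y, y ∈ Q ↔ ∀ x ∈ P, -1 ≤ y ⬝ᵥ x

lemma DP.symm {P Q : Set (Fin 4 → ℝ)} (h : DP P Q) : DP Q P :=
  ⟨h.latQ, h.latP, h.zeroQ, h.zeroP, fun x => by rw [h.memQ]; simp only [dotProduct_comm],
    fun x => by rw [h.memP]; simp only [dotProduct_comm]⟩

lemma IsLatticePolytope.isCompact {P : Set (Fin 4 → ℝ)} (h : IsLatticePolytope P) : IsCompact P := by
  obtain ⟨V, rfl⟩ := h
  exact (V.finite_toSet.image _).isCompact_convexHull ℝ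

lemma IsLatticePolytope.convex {P : Set (Fin 4 → ℝ)} (h : IsLatticePolytope P) : Convex ℝ P := by
  obtain ⟨V, rfl⟩ := h
  exact convex_convexHull ℝ _

lemma clm_eq_dot (f : (Fin 4 → ℝ) →L[ℝ] ℝ) (x : Fin 4 → ℝ) : f x = (fun i => f (Pi.single i 1)) ⬝ᵥ x := by
  have := LinearMap.pi_apply_eq_sum_univ (f : (Fin 4 → ℝ) →ₗ[ℝ] ℝ) x
  simp only [ContinuousLinearMap.coe_coe, smul_eq_mul] at this
  rw [this, dotProduct]
  refine Finset.sum_congr rfl fun i _ => ?_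
  rw [mul_comm]
  congr 2
  ext j
  simp [Pi.single_apply, eq_comm]

lemma DP.of_reflexive {P : Set (Fin 4 → ℝ)} (h : IsReflexive P) : DP P (polarDual P) := by
  obtain ⟨h1, h2, h3⟩ := h
  refine ⟨h1, h3, h2, ?_, ?_, fun y => Iff.rfl⟩
  · obtain ⟨R, hR⟩ := h1.isCompact.isBounded.exists_norm_le
    rw [mem_interior_iff_mem_nhds, Metric.mem_nhds_iff]
    refine ⟨1 / (4 * (|R| + 1)), by positivity, ?_⟩
    intro y hy x hx
    have hx1 : ∀ i, |x i| ≤ |R| + 1 := fun i => by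
      have := (norm_le_pi_norm x i).trans (hR x hx)
      rw [Real.norm_eq_abs] at this
      linarith [le_abs_self R]
    have hy1 : ∀ i, |y i| ≤ 1 / (4 * (|R| + 1)) := fun i => by
      have h1 := norm_le_pi_norm y i
      rw [mem_ball_zero_iff] at hy
      rw [Real.norm_eq_abs] at h1
      linarith
    have hxy : ∀ i, -(1 / 4) ≤ y i * x i := fun i => by
      have : |y i * x i| ≤ 1 / 4 := by
        rw [abs_mul]
        calc |y i| * |x i| ≤ 1 / (4 * (|R| + 1)) * (|R| + 1) := 
              mul_le_mul (hy1 i) (hx1 i) (abs_nonneg _) (by positivity)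
          _ = 1 / 4 := by field_simp
      linarith [neg_abs_le (y i * x i)]
    rw [Fin.sum_univ_four]
    linarith [hxy 0, hxy 1, hxy 2, hxy 3]
  · intro x
    constructor
    · intro hx y hy
      exact hy x hx
    · intro hx
      by_contra hxP
      obtain ⟨f, u, hf, hu⟩ := geometric_hahn_banach_closed_point h1.convex h1.isCompact.isClosed hxP
      have hu0 : 0 < u := by have := hf 0 (interior_subset h2); simpa using this
      let y : Fin 4 → ℝ := fun i => - (f (Pi.single i 1)) / u
      have hy : ∀ z, y ⬝ᵥ z = - f z / u := by
        intro z
        rw [clm_eq_dot f z]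
        simp only [y, dotProduct, neg_div, Finset.sum_div, ← Finset.sum_neg_distrib]
        exact Finset.sum_congr rfl fun i _ => by ring
      have hyQ : y ∈ polarDual P := by
        intro z hz
        have := hy z
        rw [dotProduct] at this
        rw [this, neg_div, neg_le_neg_iff, div_le_one hu0]
        exact (hf z hz).le
      have := hx y hyQ
      rw [hy, neg_div, neg_le_neg_iff, div_le_one hu0] at this
      linarith

/-- The finset of lattice points which are extreme points. -/
lemma exists_ext {Q : Set (Fin 4 → ℝ)} (h : IsLatticePolytope Q) : ∃ E : Finset (Fin 4 → ℤ), 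
    (∀ y, y ∈ E ↔ coeLat y ∈ Q.extremePoints ℝ) ∧ Q = convexHull ℝ (coeLat '' (E : Set (Fin 4 → ℤ))) := by
  classical
  have hc := h.isCompact
  have hcv := h.convex
  obtain ⟨W, hW⟩ := h
  have hsub : Q.extremePoints ℝ ⊆ coeLat '' (W : Set (Fin 4 → ℤ)) := by
    rw [hW]; exact extremePoints_convexHull_subset
  have hinj : Function.Injective (coeLat : (Fin 4 → ℤ) → Fin 4 → ℝ) := by
    intro a b hab
    ext i
    have := congrFun hab i
    simpa [coeLat] using this
  let E := W.filter fun y => coeLat y ∈ Q.extremePoints ℝ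
  have hE : ∀ y, y ∈ E ↔ coeLat y ∈ Q.extremePoints ℝ := by
    intro y
    simp only [E, Finset.mem_filter, and_iff_right_iff_imp]
    intro hy
    obtain ⟨z, hz, hzy⟩ := hsub hy
    rw [← hinj hzy]; exact hz
  refine ⟨E, hE, ?_⟩
  have himg : coeLat '' (E : Set (Fin 4 → ℤ)) = Q.extremePoints ℝ := by
    ext z
    constructor
    · rintro ⟨y, hy, rfl⟩; exact (hE y).1 hy
    · intro hz
      obtain ⟨y, hy, rfl⟩ := hsub hz
      exact ⟨y, (hE y).2 hz, rfl⟩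
  have h1 := closure_convexHull_extremePoints hc hcv
  rw [← himg] at h1
  have h2 : IsClosed (convexHull ℝ (coeLat '' (E : Set (Fin 4 → ℤ)))) := 
    ((E.finite_toSet.image _).isCompact_convexHull ℝ).isClosed
  rw [h2.closure_eq] at h1
  exact h1.symm

lemma convex_dot_ge (x : Fin 4 → ℝ) (r : ℝ) : Convex ℝ {y : Fin 4 → ℝ | r ≤ y ⬝ᵥ x} := by
  intro a ha b hb s t hs ht hst
  simp only [Set.mem_ofPred_eq, add_dotProduct, smul_dotProduct, smul_eq_mul] at *
  have h1 := mul_le_mul_of_nonneg_left ha hs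
  have h2 := mul_le_mul_of_nonneg_left hb ht
  have h3 : r = s * r + t * r := by rw [← add_mul, hst, one_mul]
  linarith

/-- A dual pair with finset `E` of extreme points of `Q`, and `V` a finset generating `P`. -/
structure DPE (P Q : Set (Fin 4 → ℝ)) (E V : Finset (Fin 4 → ℤ)) : Prop extends DP P Q where
  ext : ∀ y, y ∈ E ↔ coeLat y ∈ Q.extremePoints ℝ
  hullQ : Q = convexHull ℝ (coeLat '' (E : Set (Fin 4 → ℤ)))
  hullP : P = convexHull ℝ (coeLat '' (V : Set (Fin 4 → ℤ)))

section
variable {P Q : Set (Fin 4 → ℝ)} {E V : Finset (Fin 4 → ℤ)}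

lemma DP.exists_DPE (h : DP P Q) : ∃ E V, DPE P Q E V := by
  obtain ⟨E, h1, h2⟩ := exists_ext h.latQ
  obtain ⟨V, hV⟩ := h.latP
  exact ⟨E, V, h, h1, h2, hV⟩

lemma DPE.memE (h : DPE P Q E V) {y : Fin 4 → ℤ} (hy : y ∈ E) : coeLat y ∈ Q := by
  rw [h.hullQ]; exact subset_convexHull ℝ _ ⟨y, hy, rfl⟩

lemma DPE.memV (h : DPE P Q E V) {x : Fin 4 → ℤ} (hx : x ∈ V) : coeLat x ∈ P := by
  rw [h.hullP]; exact subset_convexHull ℝ _ ⟨x, hx, rfl⟩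

lemma DPE.forall_Q (h : DPE P Q E V) {x : Fin 4 → ℝ} {r : ℝ} : (∀ y ∈ Q, r ≤ y ⬝ᵥ x) ↔ ∀ y ∈ E, r ≤ coeLat y ⬝ᵥ x := by
  constructor
  · intro h1 y hy; exact h1 _ (h.memE hy)
  · intro h1 y hy
    have : Q ⊆ {y : Fin 4 → ℝ | r ≤ y ⬝ᵥ x} := by
      rw [h.hullQ]
      apply convexHull_min _ (convex_dot_ge x r)
      rintro _ ⟨z, hz, rfl⟩
      exact h1 z hz
    exact this hy

lemma DPE.forall_P (h : DPE P Q E V) {y : Fin 4 → ℝ} {r : ℝ} : (∀ x ∈ P, r ≤ y ⬝ᵥ x) ↔ ∀ x ∈ V, r ≤ y ⬝ᵥ coeLat x := by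
  constructor
  · intro h1 y hy; exact h1 _ (h.memV hy)
  · intro h1 x hx
    have : P ⊆ {x : Fin 4 → ℝ | r ≤ x ⬝ᵥ y} := by
      rw [h.hullP]
      apply convexHull_min _ (convex_dot_ge y r)
      rintro _ ⟨z, hz, rfl⟩
      rw [Set.mem_ofPred_eq, dotProduct_comm]
      exact h1 z hz
    rw [dotProduct_comm]
    exact this hx

lemma DPE.memP_iff (h : DPE P Q E V) (x : Fin 4 → ℝ) : x ∈ P ↔ ∀ y ∈ E, -1 ≤ coeLat y ⬝ᵥ x := by
  rw [h.memP, h.forall_Q]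

lemma DPE.memQ_iff (h : DPE P Q E V) (y : Fin 4 → ℝ) : y ∈ Q ↔ ∀ x ∈ V, -1 ≤ y ⬝ᵥ coeLat x := by
  rw [h.memQ, h.forall_P]

/-- Extreme points: no direction is orthogonal to the facet. -/
lemma DPE.ext_ne (h : DPE P Q E V) {y : Fin 4 → ℤ} (hy : y ∈ E) {u : Fin 4 → ℝ} (hu : u ≠ 0) :
    ∃ x ∈ V, y ⬝ᵥ x = -1 ∧ u ⬝ᵥ coeLat x ≠ 0 := by
  by_contra! hc
  have hyQ := h.memE hy
  rw [h.memQ_iff] at hyQ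
  have hev : ∀ᶠ t : ℝ in nhdsWithin 0 (Set.Ioi 0), ∀ x ∈ V, -1 ≤ (coeLat y + t • u) ⬝ᵥ coeLat x ∧ 
      -1 ≤ (coeLat y - t • u) ⬝ᵥ coeLat x := by
    rw [Filter.eventually_all_finset]
    intro x hx
    simp only [add_dotProduct, sub_dotProduct, smul_dotProduct, smul_eq_mul]
    by_cases h1 : y ⬝ᵥ x = -1
    · rw [hc x hx h1, coeLat_dot, h1]
      simp
    · have h2 := hyQ x hx
      have h3 : -1 < coeLat y ⬝ᵥ coeLat x := by
        apply lt_of_le_of_ne h2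
        rw [coeLat_dot]
        intro h4
        apply h1
        exact_mod_cast h4.symm
      have c1 : Tendsto (fun t : ℝ => coeLat y ⬝ᵥ coeLat x + t * (u ⬝ᵥ coeLat x)) (nhds 0) 
          (nhds (coeLat y ⬝ᵥ coeLat x + 0 * (u ⬝ᵥ coeLat x))) := Continuous.tendsto (by fun_prop) _
      have c2 : Tendsto (fun t : ℝ => coeLat y ⬝ᵥ coeLat x - t * (u ⬝ᵥ coeLat x)) (nhds 0) 
          (nhds (coeLat y ⬝ᵥ coeLat x - 0 * (u ⬝ᵥ coeLat x))) := Continuous.tendsto (by fun_prop) _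
      have e1 : ∀ᶠ t : ℝ in nhdsWithin 0 (Set.Ioi 0), (-1 : ℝ) < coeLat y ⬝ᵥ coeLat x + t * (u ⬝ᵥ coeLat x) :=
        (c1.mono_left nhdsWithin_le_nhds).eventually (lt_mem_nhds (a := (-1 : ℝ)) (by simpa using h3))
      have e2 : ∀ᶠ t : ℝ in nhdsWithin 0 (Set.Ioi 0), (-1 : ℝ) < coeLat y ⬝ᵥ coeLat x - t * (u ⬝ᵥ coeLat x) :=
        (c2.mono_left nhdsWithin_le_nhds).eventually (lt_mem_nhds (a := (-1 : ℝ)) (by simpa using h3))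
      filter_upwards [e1, e2] with t h1 h2 using ⟨h1.le, h2.le⟩
  obtain ⟨t, h1, ht⟩ := (hev.and self_mem_nhdsWithin).exists
  have ht' : (0 : ℝ) < t := ht
  have hp : coeLat y + t • u ∈ Q := (h.memQ_iff _).2 fun x hx => (h1 x hx).1
  have hm : coeLat y - t • u ∈ Q := (h.memQ_iff _).2 fun x hx => (h1 x hx).2
  have hext := (h.ext y).1 hy
  rw [mem_extremePoints] at hext
  have := (hext.2 _ hp _ hm ⟨1/2, 1/2, by norm_num, by norm_num, by norm_num, by
    ext i; simp; ring⟩).1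
  apply hu
  have h5 : t • u = 0 := by simpa using this
  simpa [ht'.ne'] using h5

lemma ext_between {Q : Set (Fin 4 → ℝ)} {a b c : Fin 4 → ℝ} (hb : b ∈ Q.extremePoints ℝ) (ha : a ∈ Q) (hc : c ∈ Q)
    (hab : a ≠ b) {t : ℝ} (ht0 : 0 < t) (ht1 : t < 1) (h : b = (1 - t) • a + t • c) : False := by
  rw [mem_extremePoints] at hb
  exact hab (hb.2 a ha c hc ⟨1 - t, t, by linarith, ht0, by ring, h.symm⟩).1

/-- three distinct extreme points are not collinear -/
lemma ext_ncol {Q : Set (Fin 4 → ℝ)} {a b c : Fin 4 → ℝ} (ha : a ∈ Q.extremePoints ℝ) (hb : b ∈ Q.extremePoints ℝ)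
    (hc : c ∈ Q.extremePoints ℝ) (hab : a ≠ b) (hac : a ≠ c) (hbc : b ≠ c) (t : ℝ) (h : a - c = t • (a - b)) : False := by
  have haQ := extremePoints_subset ha
  have hbQ := extremePoints_subset hb
  have hcQ := extremePoints_subset hc
  have hi : ∀ i, a i - c i = t * (a i - b i) := fun i => by have := congrFun h i; simpa using this
  rcases lt_trichotomy t 0 with h1 | h1 | h1
  · -- a between b and c
    have h2 : 0 < 1 - t := by linarith
    refine ext_between (t := 1 / (1 - t)) ha hbQ hcQ hab.symm (by positivity) (by rw [div_lt_one h2]; linarith) ?_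
    ext i
    simp only [Pi.add_apply, Pi.smul_apply, smul_eq_mul]
    have := hi i
    field_simp
    linarith
  · apply hac
    rw [h1, zero_smul, sub_eq_zero] at h
    exact h
  · rcases lt_trichotomy t 1 with h2 | h2 | h2
    · refine ext_between (t := t) hc haQ hbQ hac h1 h2 ?_
      ext i
      simp only [Pi.add_apply, Pi.smul_apply, smul_eq_mul]
      linarith [hi i]
    · apply hbc
      rw [h2, one_smul] at h
      exact sub_right_injective h.symm
    · refine ext_between (t := 1 / t) hb haQ hcQ hab (by positivity) (by rw [div_lt_one h1]; exact h2) ?_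
      ext i
      simp only [Pi.add_apply, Pi.smul_apply, smul_eq_mul]
      have := hi i
      field_simp
      linarith
end

end

section


lemma coeLat_inj {d : ℕ} : Function.Injective (coeLat : (Fin d → ℤ) → Fin d → ℝ) := by
  intro a b hab
  ext i
  have := congrFun hab i
  simpa [coeLat] using this

lemma coeLat_neg (a : Fin 4 → ℤ) : coeLat (-a) = - coeLat a := by
  ext i; simp [coeLat]

lemma coeLat_sub (a b : Fin 4 → ℤ) : coeLat (a - b) = coeLat a - coeLat b := by
  ext i; simp [coeLat]

lemma coeLat_add (a b : Fin 4 → ℤ) : coeLat (a + b) = coeLat a + coeLat b := by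
  ext i; simp [coeLat]

lemma hull_weights {V : Finset (Fin 4 → ℤ)} {z : Fin 4 → ℝ} (hz : z ∈ convexHull ℝ (coeLat '' (V : Set (Fin 4 → ℤ)))) :
    ∃ w : (Fin 4 → ℤ) → ℝ, (∀ x ∈ V, 0 ≤ w x) ∧ ∑ x ∈ V, w x = 1 ∧ ∑ x ∈ V, w x • coeLat x = z := by
  classical
  rw [← Finset.coe_image, Finset.mem_convexHull'] at hz
  obtain ⟨w, h1, h2, h3⟩ := hz
  refine ⟨fun x => w (coeLat x), fun x hx => h1 _ (Finset.mem_image_of_mem _ hx), ?_, ?_⟩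
  · rw [← h2, Finset.sum_image coeLat_inj.injOn]
  · rw [← h3, Finset.sum_image coeLat_inj.injOn]

/-- the negatives -/
def YE (E : Finset (Fin 4 → ℤ)) : Finset (Fin 4 → ℤ) := E.map (Equiv.neg _).toEmbedding

lemma mem_YE {E : Finset (Fin 4 → ℤ)} {y : Fin 4 → ℤ} : y ∈ YE E ↔ -y ∈ E := by
  simp only [YE, Finset.mem_map, Equiv.coe_toEmbedding, Equiv.neg_apply]
  constructor
  · rintro ⟨z, hz, rfl⟩; simpa using hz
  · intro h; exact ⟨-y, h, by simp⟩

section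
variable {P Q : Set (Fin 4 → ℝ)} {E V : Finset (Fin 4 → ℤ)}

lemma DPE.E_nonempty (h : DPE P Q E V) : E.Nonempty := by
  have h0 := interior_subset h.zeroQ
  rw [h.hullQ] at h0
  have := convexHull_nonempty_iff.1 ⟨_, h0⟩
  simpa using this

lemma DPE.bound (h : DPE P Q E V) : ∃ C : ℤ, 0 < C ∧ ∀ x : Fin 4 → ℝ, ∃ y ∈ E, (∀ y' ∈ E, coeLat y ⬝ᵥ x ≤ coeLat y' ⬝ᵥ x) ∧ 
    ∀ i, |x i| ≤ C * (-(coeLat y ⬝ᵥ x)) := by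
  have h0 := h.zeroQ
  rw [mem_interior_iff_mem_nhds, Metric.mem_nhds_iff] at h0
  obtain ⟨ε, hε, hb⟩ := h0
  obtain ⟨C, hC⟩ := exists_nat_gt (1 / ε)
  have hC0 : (0 : ℝ) < C := lt_trans (by positivity) hC
  refine ⟨C, by exact_mod_cast hC0, fun x => ?_⟩
  obtain ⟨y, hy, hmin⟩ := Finset.exists_min_image E (fun y => coeLat y ⬝ᵥ x) h.E_nonempty
  refine ⟨y, hy, hmin, fun i => ?_⟩
  have h1 := (h.forall_Q (x := x) (r := coeLat y ⬝ᵥ x)).2 hmin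
  have hz : ∀ s : ℝ, |s| ≤ 1 → Pi.single i (s / C) ∈ Q := by
    intro s hs
    apply hb
    rw [mem_ball_zero_iff, Pi.norm_single, Real.norm_eq_abs, abs_div, Nat.abs_cast, div_lt_iff₀ hC0]
    rw [div_lt_iff₀ hε] at hC
    linarith
  have h2 : ∀ s : ℝ, |s| ≤ 1 → coeLat y ⬝ᵥ x ≤ s / C * x i := by
    intro s hs
    have := h1 _ (hz s hs)
    rwa [single_dotProduct] at this
  have h3 := h2 1 (by simp)
  have h4 := h2 (-1) (by simp)
  rw [Int.cast_natCast]
  have e1 : 1 / (C : ℝ) * x i = x i / C := by ring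
  have e2 : -1 / (C : ℝ) * x i = - x i / C := by ring
  rw [e1, le_div_iff₀ hC0] at h3
  rw [e2, le_div_iff₀ hC0] at h4
  rw [abs_le]
  constructor <;> linarith

lemma DPE.coreHyp (h : DPE P Q E V) : ∃ C, CoreHyp (YE E) C := by
  obtain ⟨C, hC, hb⟩ := h.bound
  refine ⟨C, hC.le, ?_, ?_, ?_⟩
  · intro x i
    obtain ⟨y, hy, -, h1⟩ := hb (coeLat x)
    refine ⟨-y, by simpa [mem_YE] using hy, ?_⟩
    have := h1 i
    rw [coeLat_dot] at this
    rw [neg_dotProduct]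
    simp only [coeLat] at this
    exact_mod_cast this
  · intro y₁ h1 y₂ h2 y₃ h3 h12 h13 h23
    by_contra! hc
    have e : ∀ y, y ∈ YE E → coeLat (-y) ∈ Q.extremePoints ℝ := fun y hy => (h.ext _).1 (mem_YE.1 hy)
    obtain ⟨i, hi⟩ : ∃ i, (y₁ - y₂) i ≠ 0 := by
      by_contra! h0
      exact h12 (sub_eq_zero.1 (funext h0))
    refine ext_ncol (e _ h1) (e _ h2) (e _ h3) (fun h => h12 (neg_injective (coeLat_inj h))) 
      (fun h => h13 (neg_injective (coeLat_inj h))) (fun h => h23 (neg_injective (coeLat_inj h))) 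
      (((y₁ - y₃) i : ℤ) / ((y₁ - y₂) i : ℤ) : ℝ) ?_
    ext j
    have hi' : (((y₁ - y₂) i : ℤ) : ℝ) ≠ 0 := by exact_mod_cast hi
    have := hc i j
    have h5 : (((y₁ - y₂) i * (y₁ - y₃) j - (y₁ - y₂) j * (y₁ - y₃) i : ℤ) : ℝ) = 0 := by exact_mod_cast this
    simp only [Pi.sub_apply, Pi.smul_apply, smul_eq_mul, coeLat, Pi.neg_apply, Int.cast_neg, Int.cast_sub, Int.cast_mul] at *
    field_simp
    linarith
  · intro y hy
    obtain ⟨x, hx, h1, -⟩ := h.ext_ne (mem_YE.1 hy) (u := fun _ => 1) (by intro h; have := congrFun h 0; simp at this)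
    refine ⟨x, ?_⟩
    rw [neg_dotProduct] at h1
    linarith

lemma DPE.fanHyp (h : DPE P Q E V) : ∃ (k : ℕ) (W : Fin k → Fin 4 → ℤ), FanHyp (YE E) W := by
  obtain ⟨C, hC, hb⟩ := h.bound
  refine ⟨V.card, fun i => (V.equivFin.symm i : Fin 4 → ℤ), ?_, ?_, ?_⟩
  · obtain ⟨y, hy⟩ := h.E_nonempty
    exact ⟨-y, by simpa [mem_YE] using hy⟩
  · intro y hy i
    have h1 := (h.memQ_iff _).1 (h.memE (mem_YE.1 hy)) _ (V.equivFin.symm i).2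
    rw [coeLat_dot, neg_dotProduct] at h1
    have : -1 ≤ -(y ⬝ᵥ ((V.equivFin.symm i : V) : Fin 4 → ℤ)) := by exact_mod_cast h1
    linarith
  · intro x
    obtain ⟨y, hy, hmin, h1⟩ := hb x
    have hC' : (0 : ℝ) < C := by exact_mod_cast hC
    have hf : 0 ≤ -(coeLat y ⬝ᵥ x) := by
      have := (abs_nonneg _).trans (h1 0)
      exact nonneg_of_mul_nonneg_right this hC'
    have hyY : -y ∈ YE E := by simpa [mem_YE] using hy
    rcases hf.eq_or_lt with h2 | h2
    · have hx : x = 0 := by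
        ext i
        have := h1 i
        rw [← h2, mul_zero] at this
        exact abs_nonpos_iff.1 this
      exact ⟨0, by simp, by simp [hx], -y, hyY, by simp [hx]⟩
    · set f := -(coeLat y ⬝ᵥ x) with hfd
      have hxP : f⁻¹ • x ∈ P := by
        rw [h.memP_iff]
        intro y' hy'
        have := hmin y' hy'
        rw [dotProduct_smul, smul_eq_mul, inv_mul_eq_div, le_div_iff₀ h2]
        linarith
      rw [h.hullP] at hxP
      obtain ⟨w, hw0, hw1, hw2⟩ := hull_weights hxP
      have hs : ∀ {M : Type} [AddCommMonoid M] (g : (Fin 4 → ℤ) → M), ∑ i : Fin V.card, g (V.equivFin.symm i) = ∑ v ∈ V, g v := by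
        intro M _ g
        rw [← Finset.sum_coe_sort V g]
        exact Equiv.sum_comp V.equivFin.symm (fun v => g v)
      refine ⟨fun i => f * w (V.equivFin.symm i), fun i => mul_nonneg h2.le (hw0 _ (V.equivFin.symm i).2), ?_, -y, hyY, ?_⟩
      · rw [comb_apply, hs (fun v => (f * w v) • coeLat v)]
        simp only [mul_smul]
        rw [← Finset.smul_sum, hw2, smul_inv_smul₀ h2.ne']
      · rw [hs (fun v => f * w v), ← Finset.mul_sum, hw1, coeLat_neg, neg_dotProduct, mul_one]

lemma DPE.fY_le_iff (h : DPE P Q E V) (x : Fin 4 → ℤ) (n : ℤ) : fY (YE E) x ≤ n ↔ ∀ y ∈ E, -n ≤ y ⬝ᵥ x := by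
  obtain ⟨k, W, hF⟩ := h.fanHyp
  constructor
  · intro h1 y hy
    have := fY_le (Y := YE E) (x := x) (y := -y) (by simpa [mem_YE] using hy)
    rw [neg_dotProduct] at this
    linarith
  · intro h1
    obtain ⟨y, hy, hy'⟩ := fY_mem hF.ne x
    have := h1 _ (mem_YE.1 hy)
    rw [neg_dotProduct] at this
    linarith

lemma DPE.mem_smul_iff (h : DPE P Q E V) (x : Fin 4 → ℝ) {n : ℕ} (hn : 1 ≤ n) : x ∈ (n : ℝ) • P ↔ ∀ y ∈ E, -(n : ℝ) ≤ coeLat y ⬝ᵥ x := by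
  have hn' : (0 : ℝ) < n := by exact_mod_cast hn
  rw [Set.mem_smul_set_iff_inv_smul_mem₀ hn'.ne', h.memP_iff]
  refine forall₂_congr fun y _ => ?_
  rw [dotProduct_smul, smul_eq_mul, inv_mul_eq_div, le_div_iff₀ hn', neg_one_mul]

lemma DPE.lat_smul (h : DPE P Q E V) {n : ℕ} (hn : 1 ≤ n) : latticePoints ((n : ℝ) • P) = {x | fY (YE E) x ≤ n} := by
  ext x
  rw [latticePoints, Set.mem_ofPred_eq, Set.mem_ofPred_eq, h.mem_smul_iff _ hn, h.fY_le_iff]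
  refine forall₂_congr fun y _ => ?_
  rw [coeLat_dot]
  exact_mod_cast Iff.rfl

lemma DPE.not_mem_interior (h : DPE P Q E V) {x : Fin 4 → ℝ} {y : Fin 4 → ℝ} (hy : y ∈ Q) (hyx : y ⬝ᵥ x = -1) : x ∉ interior P := by
  intro hx
  have hc : Tendsto (fun t : ℝ => (1 + t) • x) (nhdsWithin 0 (Set.Ioi 0)) (nhds x) := by
    have : Tendsto (fun t : ℝ => (1 + t) • x) (nhds 0) (nhds ((1 + 0 : ℝ) • x)) := Continuous.tendsto (by fun_prop) _
    rw [add_zero, one_smul] at this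
    exact this.mono_left nhdsWithin_le_nhds
  have hev := hc.eventually (mem_interior_iff_mem_nhds.1 hx)
  obtain ⟨t, h1, ht⟩ := (hev.and self_mem_nhdsWithin).exists
  have ht' : (0 : ℝ) < t := ht
  have := (h.memP _).1 h1 y hy
  rw [dotProduct_smul, hyx, smul_eq_mul] at this
  linarith

lemma DPE.frontier_lat (h : DPE P Q E V) : latticePoints (frontier P) = {x | fY (YE E) x = (1 : ℕ)} := by
  obtain ⟨k, W, hF⟩ := h.fanHyp
  ext x
  rw [latticePoints, Set.mem_ofPred_eq, Set.mem_ofPred_eq, h.latP.isCompact.isClosed.frontier_eq]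
  have hP : coeLat x ∈ P ↔ fY (YE E) x ≤ 1 := by
    have := h.lat_smul (n := 1) le_rfl
    rw [Nat.cast_one, one_smul] at this
    have h1 := Set.ext_iff.1 this x
    simpa [latticePoints] using h1
  rw [Set.mem_sdiff, hP]
  push_cast
  constructor
  · rintro ⟨h1, h2⟩
    by_contra h3
    have h4 : fY (YE E) x ≤ 0 := by omega
    rw [h.fY_le_iff] at h4
    apply h2
    have hop : IsOpen (⋂ y ∈ E, {z : Fin 4 → ℝ | -1 < coeLat y ⬝ᵥ z}) := by
      refine isOpen_biInter_finset fun y _ => ?_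
      exact isOpen_lt continuous_const (by fun_prop)
    have hsub : (⋂ y ∈ E, {z : Fin 4 → ℝ | -1 < coeLat y ⬝ᵥ z}) ⊆ P := by
      intro z hz
      rw [h.memP_iff]
      intro y hy
      have := Set.mem_iInter₂.1 hz y hy
      exact le_of_lt this
    apply interior_maximal hsub hop
    refine Set.mem_iInter₂.2 fun y hy => ?_
    rw [Set.mem_ofPred_eq, coeLat_dot]
    have : -1 < y ⬝ᵥ x := by have := h4 y hy; omega
    exact_mod_cast this
  · intro h1
    refine ⟨h1.le, ?_⟩
    obtain ⟨y, hy, hy'⟩ := fY_mem hF.ne x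
    refine h.not_mem_interior (h.memE (mem_YE.1 hy)) ?_
    rw [coeLat_dot, neg_dotProduct, ← hy', h1]
    simp

/-- codimension two candidate face -/
def FP (P : Set (Fin 4 → ℝ)) (y₁ y₂ : Fin 4 → ℤ) : Set (Fin 4 → ℝ) :=
  {x | x ∈ P ∧ coeLat y₁ ⬝ᵥ x = -1 ∧ coeLat y₂ ⬝ᵥ x = -1}

lemma DPE.FF_eq (h : DPE P Q E V) (y₁ y₂ : Fin 4 → ℤ) {m : ℕ} (hm : 1 ≤ m) :
    FF (YE E) (-y₁) (-y₂) m = (latticePoints ((m : ℝ) • FP P y₁ y₂)).ncard := by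
  rw [FF]
  congr 1
  ext x
  have hm' : (0 : ℝ) < m := by exact_mod_cast hm
  rw [latticePoints, Set.mem_ofPred_eq, Set.mem_ofPred_eq, Set.mem_smul_set_iff_inv_smul_mem₀ hm'.ne', FP, Set.mem_ofPred_eq, 
    ← Set.mem_smul_set_iff_inv_smul_mem₀ hm'.ne', h.mem_smul_iff _ hm]
  have h1 : ∀ y : Fin 4 → ℤ, coeLat y ⬝ᵥ ((m : ℝ)⁻¹ • coeLat x) = -1 ↔ (-y) ⬝ᵥ x = m := by
    intro y
    rw [dotProduct_smul, smul_eq_mul, inv_mul_eq_div, div_eq_iff hm'.ne', neg_one_mul, coeLat_dot, neg_dotProduct, neg_eq_iff_eq_neg]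
    exact_mod_cast Iff.rfl
  rw [h1, h1, and_comm (a := ∀ y ∈ E, _), and_assoc]
  refine and_congr Iff.rfl (and_congr Iff.rfl ?_)
  constructor
  · intro h2 y hy
    have := h2 (-y) (by simpa [mem_YE] using hy)
    rw [neg_dotProduct] at this
    rw [coeLat_dot]
    have : -(m : ℤ) ≤ y ⬝ᵥ x := by omega
    exact_mod_cast this
  · intro h2 y hy
    have := h2 _ (mem_YE.1 hy)
    rw [coeLat_dot, neg_dotProduct] at this
    have : -(m : ℤ) ≤ -(y ⬝ᵥ x) := by exact_mod_cast this
    omega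

lemma lat_eq_card {d : ℕ} (S : Set (Fin d → ℝ)) {n : ℕ} (hn : 0 < n) :
    (latticePoints ((n : ℝ) • S)).ncard = Nat.card ↑(S ∩ (n : ℝ)⁻¹ • (Submodule.span ℤ (Set.range (Pi.basisFun ℝ (Fin d))) : Set (Fin d → ℝ))) := by
  have hn' : (0 : ℝ) < n := by exact_mod_cast hn
  rw [Nat.card_coe_set_eq]
  refine Set.ncard_congr (fun x _ => (n : ℝ)⁻¹ • coeLat x) ?_ ?_ ?_
  · intro x hx
    refine ⟨(Set.mem_smul_set_iff_inv_smul_mem₀ hn'.ne' _ _).1 hx, Set.smul_mem_smul_set ?_⟩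
    rw [SetLike.mem_coe, Module.Basis.mem_span_iff_repr_mem]
    intro i
    exact ⟨x i, by simp [coeLat]⟩
  · intro a b _ _ hab
    exact coeLat_inj (smul_right_injective _ (inv_ne_zero hn'.ne') hab)
  · rintro _ ⟨hS, z, hz, rfl⟩
    rw [SetLike.mem_coe, Module.Basis.mem_span_iff_repr_mem] at hz
    choose c hc using hz
    have : coeLat c = z := by ext i; simpa [coeLat] using hc i
    refine ⟨c, ?_, by rw [this]⟩
    rw [latticePoints, Set.mem_ofPred_eq, this, Set.mem_smul_set_iff_inv_smul_mem₀ hn'.ne']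
    exact hS

lemma vol_lim {P : Set (Fin 4 → ℝ)} (hP : IsLatticePolytope P) : 
    Tendsto (fun n : ℕ => ((latticePoints ((n : ℝ) • P)).ncard : ℝ) / (n : ℝ) ^ 4) atTop (nhds (volume P).toReal) := by
  have h := tendsto_card_div_pow_atTop_volume P hP.isCompact.isBounded 
    hP.isCompact.measurableSet (hP.convex.addHaar_frontier volume)
  refine h.congr' ?_
  filter_upwards [eventually_gt_atTop 0] with n hn
  rw [lat_eq_card P hn, Fintype.card_fin]

theorem DPE.main (h : DPE P Q E V) (A : (Fin 4 → ℤ) → (Fin 4 → ℤ) → ℝ)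
    (hA : ∀ y₁ ∈ E, ∀ y₂ ∈ E, y₁ ≠ y₂ → 
      Tendsto (fun m : ℕ => 2 * ((latticePoints ((m : ℝ) • FP P y₁ y₂)).ncard : ℝ) / (m : ℝ) ^ 2) atTop (nhds (A y₁ y₂))) :
    12 * ((latticePoints (frontier P)).ncard : ℝ) = 2 * (24 * (volume P).toReal) + 
      1 / 2 * ∑ y₁ ∈ E, ∑ y₂ ∈ E, if y₁ ≠ y₂ then (gl (y₁ - y₂) : ℝ) * A y₁ y₂ else 0 := by
  obtain ⟨C, hY⟩ := h.coreHyp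
  obtain ⟨k, W, hF⟩ := h.fanHyp
  obtain ⟨a1, a3, hL⟩ := ehrhart hF fun n => (fY_le_finite hY n).subset fun x hx => le_of_eq hx
  have hv : (volume P).toReal = a3 / 4 := by
    refine tendsto_nhds_unique (vol_lim h.latP) ((ball_lim hY hL).congr' ?_)
    filter_upwards [eventually_ge_atTop 1] with n hn
    rw [h.lat_smul hn]
  have h1 := a1_eq hY hL (fun a b => A (-a) (-b)) (by
    intro y₁ h1 y₂ h2 h12
    refine (hA _ (mem_YE.1 h1) _ (mem_YE.1 h2) (fun h => h12 (neg_injective h))).congr' ?_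
    filter_upwards [eventually_ge_atTop 1] with n hn
    rw [← h.FF_eq _ _ hn, neg_neg, neg_neg])
  have h2 : (∑ y₁ ∈ YE E, ∑ y₂ ∈ YE E, if y₁ ≠ y₂ then (gl (y₁ - y₂) : ℝ) * A (-y₁) (-y₂) else 0) = 
      ∑ y₁ ∈ E, ∑ y₂ ∈ E, if y₁ ≠ y₂ then (gl (y₁ - y₂) : ℝ) * A y₁ y₂ else 0 := by
    simp only [YE, Finset.sum_map, Equiv.coe_toEmbedding, Equiv.neg_apply, neg_neg]
    refine Finset.sum_congr rfl fun y₁ _ => Finset.sum_congr rfl fun y₂ _ => ?_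
    have : -y₁ - -y₂ = -(y₁ - y₂) := by abel
    rw [this, gl_neg]
    simp only [ne_eq, neg_inj]
  rw [h2] at h1
  have h3 := hL 1 le_rfl
  rw [LL, ← h.frontier_lat] at h3
  rw [h3, hv, ← h1]
  push_cast
  ring
end

end

section


/-- the sublattice orthogonal to two vectors -/
def kerL (y₁ y₂ : Fin 4 → ℤ) : (Fin 4 → ℤ) →ₗ[ℤ] (Fin 2 → ℤ) :=
  Matrix.mulVecLin (Matrix.of ![y₁, y₂])

lemma kerL_zero (y₁ y₂ x : Fin 4 → ℤ) : kerL y₁ y₂ x 0 = y₁ ⬝ᵥ x := by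
  simp [kerL, Matrix.mulVec]
lemma kerL_one (y₁ y₂ x : Fin 4 → ℤ) : kerL y₁ y₂ x 1 = y₂ ⬝ᵥ x := by
  simp [kerL, Matrix.mulVec]

lemma mem_ker_kerL (y₁ y₂ x : Fin 4 → ℤ) : x ∈ LinearMap.ker (kerL y₁ y₂) ↔ y₁ ⬝ᵥ x = 0 ∧ y₂ ⬝ᵥ x = 0 := by
  rw [LinearMap.mem_ker]
  constructor
  · intro h; rw [← kerL_zero y₁ y₂, ← kerL_one y₁ y₂, h]; simp
  · rintro ⟨h1, h2⟩
    ext i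
    fin_cases i
    · simpa [kerL_zero] using h1
    · simpa [kerL_one] using h2

lemma finrank_kerL {y₁ y₂ : Fin 4 → ℤ} {i j : Fin 4} (h : y₁ i * y₂ j - y₁ j * y₂ i ≠ 0) :
    Module.finrank ℤ (LinearMap.ker (kerL y₁ y₂)) = 2 := by
  have h1 := Submodule.finrank_quotient_add_finrank (LinearMap.ker (kerL y₁ y₂))
  rw [(LinearMap.quotKerEquivRange (kerL y₁ y₂)).finrank_eq] at h1
  have h2 : Module.finrank ℤ (LinearMap.range (kerL y₁ y₂)) = 2 := by
    apply le_antisymm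
    · have := Submodule.finrank_le (LinearMap.range (kerL y₁ y₂))
      simpa using this
    · let b : Fin 2 → LinearMap.range (kerL y₁ y₂) := ![⟨_, LinearMap.mem_range_self (kerL y₁ y₂) (Pi.single i 1)⟩, 
        ⟨_, LinearMap.mem_range_self (kerL y₁ y₂) (Pi.single j 1)⟩]
      have hb : LinearIndependent ℤ b := by
        rw [LinearIndependent.pair_iff]
        intro s t hst
        have h3 := congrArg Subtype.val hst
        have e0 := congrFun h3 0
        have e1 := congrFun h3 1
        simp [kerL_zero, kerL_one] at e0 e1
        constructor
        · apply (mul_eq_zero.1 (_ : s * (y₁ i * y₂ j - y₁ j * y₂ i) = 0)).resolve_right h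
          linear_combination y₂ j * e0 - y₁ j * e1
        · apply (mul_eq_zero.1 (_ : t * (y₁ i * y₂ j - y₁ j * y₂ i) = 0)).resolve_right h
          linear_combination y₁ i * e1 - y₂ i * e0
      have := hb.fintype_card_le_finrank
      simpa using this
  simp at h1
  omega

/-- coordinates on the orthogonal plane -/
def plc (b₀ b₁ : Fin 4 → ℤ) : (Fin 2 → ℝ) →ₗ[ℝ] (Fin 4 → ℝ) :=
  Fintype.linearCombination ℝ ![coeLat b₀, coeLat b₁]

lemma plc_apply (b₀ b₁ : Fin 4 → ℤ) (c : Fin 2 → ℝ) : plc b₀ b₁ c = c 0 • coeLat b₀ + c 1 • coeLat b₁ := by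
  simp [plc, Fintype.linearCombination_apply]

lemma exists_plane_basis {y₁ y₂ : Fin 4 → ℤ} {i j : Fin 4} (h : y₁ i * y₂ j - y₁ j * y₂ i ≠ 0) :
    ∃ b₀ b₁ : Fin 4 → ℤ, Function.Injective (plc b₀ b₁) ∧ 
     (∀ x, y₁ ⬝ᵥ x = 0 → y₂ ⬝ᵥ x = 0 → ∃ s t : ℤ, x = s • b₀ + t • b₁) := by
  let b := Module.finBasisOfFinrankEq ℤ _ (finrank_kerL h)
  refine ⟨b 0, b 1, ?_, ?_⟩
  · have hli := b.linearIndependent.map' (LinearMap.ker (kerL y₁ y₂)).subtype (Submodule.ker_subtype _)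
    have hli2 : ∀ s t : ℤ, s • (b 0 : Fin 4 → ℤ) + t • (b 1 : Fin 4 → ℤ) = 0 → s = 0 ∧ t = 0 := by
      have : (LinearMap.ker (kerL y₁ y₂)).subtype ∘ b = ![(b 0 : Fin 4 → ℤ), (b 1 : Fin 4 → ℤ)] := by
        ext k; fin_cases k <;> rfl
      rw [this, LinearIndependent.pair_iff] at hli
      exact hli
    obtain ⟨k, hk⟩ : ∃ k, (b 0 : Fin 4 → ℤ) k ≠ 0 := by
      by_contra! h0
      have : (b 0 : Fin 4 → ℤ) = 0 := funext h0
      have := (hli2 1 0 (by simp [this])).1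
      omega
    obtain ⟨l, hl⟩ : ∃ l, (b 0 : Fin 4 → ℤ) k * (b 1 : Fin 4 → ℤ) l - (b 1 : Fin 4 → ℤ) k * (b 0 : Fin 4 → ℤ) l ≠ 0 := by
      by_contra! h0
      have := hli2 (-(b 1 : Fin 4 → ℤ) k) ((b 0 : Fin 4 → ℤ) k) (by
        ext l
        have := h0 l
        simp
        linarith)
      exact hk this.2
    rw [← LinearMap.ker_eq_bot, LinearMap.ker_eq_bot']
    intro c hc
    rw [plc_apply] at hc
    have e1 := congrFun hc k
    have e2 := congrFun hc l
    simp [coeLat] at e1 e2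
    have hl' : ((b 0 : Fin 4 → ℤ) k : ℝ) * ((b 1 : Fin 4 → ℤ) l : ℝ) - ((b 1 : Fin 4 → ℤ) k : ℝ) * ((b 0 : Fin 4 → ℤ) l : ℝ) ≠ 0 := by
      exact_mod_cast hl
    have c0 : c 0 = 0 := by
      apply (mul_eq_zero.1 (_ : c 0 * _ = 0)).resolve_right hl'
      linear_combination ((b 1 : Fin 4 → ℤ) l : ℝ) * e1 - ((b 1 : Fin 4 → ℤ) k : ℝ) * e2
    have c1 : c 1 = 0 := by
      apply (mul_eq_zero.1 (_ : c 1 * _ = 0)).resolve_right hl'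
      linear_combination ((b 0 : Fin 4 → ℤ) k : ℝ) * e2 - ((b 0 : Fin 4 → ℤ) l : ℝ) * e1
    ext q; fin_cases q
    · exact c0
    · exact c1
  · intro x h1 h2
    have hx : x ∈ LinearMap.ker (kerL y₁ y₂) := (mem_ker_kerL _ _ _).2 ⟨h1, h2⟩
    have := b.sum_repr ⟨x, hx⟩
    rw [Fin.sum_univ_two] at this
    exact ⟨_, _, (congrArg Subtype.val this).symm⟩

lemma exists_minor {y₁ y₂ v : Fin 4 → ℤ} (h1 : y₁ ⬝ᵥ v = -1) (h2 : y₂ ⬝ᵥ v = -1) (h12 : y₁ ≠ y₂) :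
    ∃ i j, y₁ i * y₂ j - y₁ j * y₂ i ≠ 0 := by
  by_contra! hc
  apply h12
  ext i
  have : ∑ j, (y₁ i * y₂ j - y₁ j * y₂ i) * v j = 0 := Finset.sum_eq_zero fun j _ => by rw [hc, zero_mul]
  have e : ∑ j, (y₁ i * y₂ j - y₁ j * y₂ i) * v j = y₁ i * (y₂ ⬝ᵥ v) - y₂ i * (y₁ ⬝ᵥ v) := by
    simp only [dotProduct, Finset.mul_sum, ← Finset.sum_sub_distrib]
    exact Finset.sum_congr rfl fun j _ => by ring
  rw [e, h1, h2] at this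
  linarith

theorem lim_exists {F : Set (Fin 4 → ℝ)} (hc : IsCompact F) (hcv : Convex ℝ F) {y₁ y₂ v : Fin 4 → ℤ}
    (hF : ∀ x ∈ F, coeLat y₁ ⬝ᵥ x = -1 ∧ coeLat y₂ ⬝ᵥ x = -1) (h12 : y₁ ≠ y₂) (hv : coeLat v ∈ F) :
    ∃ A : ℝ, Tendsto (fun m : ℕ => 2 * ((latticePoints ((m : ℝ) • F)).ncard : ℝ) / (m : ℝ) ^ 2) atTop (nhds A) ∧
      (dimSet F ≤ 1 → A = 0) := by
  have hv1 := hF _ hv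
  rw [coeLat_dot, coeLat_dot] at hv1
  have hv' : y₁ ⬝ᵥ v = -1 ∧ y₂ ⬝ᵥ v = -1 := by exact_mod_cast hv1
  obtain ⟨i, j, hij⟩ := exists_minor hv'.1 hv'.2 h12
  obtain ⟨b₀, b₁, hinj, hrep⟩ := exists_plane_basis hij
  let g : (Fin 2 → ℝ) →ᵃ[ℝ] (Fin 4 → ℝ) := (plc b₀ b₁).toAffineMap + AffineMap.const ℝ _ (coeLat v)
  have hg : ∀ c, g c = plc b₀ b₁ c + coeLat v := fun c => rfl
  have hgi : Topology.IsClosedEmbedding g := by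
    have h1 := LinearMap.isClosedEmbedding_of_injective (f := plc b₀ b₁) (LinearMap.ker_eq_bot.2 hinj)
    exact (Homeomorph.addRight (coeLat v)).isClosedEmbedding.comp h1
  let S : Set (Fin 2 → ℝ) := g ⁻¹' F
  have hSc : IsCompact S := hgi.isCompact_preimage hc
  have hScv : Convex ℝ S := hcv.affine_preimage g
  have hcard : ∀ m : ℕ, 0 < m → (latticePoints ((m : ℝ) • F)).ncard = (latticePoints ((m : ℝ) • S)).ncard := by
    intro m hm
    have hm' : (0 : ℝ) < m := by exact_mod_cast hm
    have hco : ∀ c : Fin 2 → ℤ, coeLat ((c 0 • b₀ + c 1 • b₁ + (m : ℤ) • v)) = plc b₀ b₁ (coeLat c) + (m : ℝ) • coeLat v := by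
      intro c
      rw [plc_apply]
      ext k; simp [coeLat]
    have hmem : ∀ c : Fin 2 → ℤ, coeLat c ∈ (m : ℝ) • S ↔ coeLat (c 0 • b₀ + c 1 • b₁ + (m : ℤ) • v) ∈ (m : ℝ) • F := by
      intro c
      rw [Set.mem_smul_set_iff_inv_smul_mem₀ hm'.ne', Set.mem_smul_set_iff_inv_smul_mem₀ hm'.ne', hco, smul_add, inv_smul_smul₀ hm'.ne', 
        ← map_smul]
      exact Iff.rfl
    symm
    refine Set.ncard_congr (fun c _ => c 0 • b₀ + c 1 • b₁ + (m : ℤ) • v) ?_ ?_ ?_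
    · intro c hc; exact (hmem c).1 hc
    · intro c d _ _ hcd
      have := congrArg coeLat hcd
      rw [hco, hco] at this
      exact coeLat_inj (hinj (add_right_cancel this))
    · intro x hx
      have hx' : coeLat x ∈ (m : ℝ) • F := hx
      obtain ⟨z, hz, hzx⟩ := hx'
      have hzx : (m : ℝ) • z = coeLat x := hzx
      have k1 : ∀ y : Fin 4 → ℤ, coeLat y ⬝ᵥ z = -1 → y ⬝ᵥ v = -1 → y ⬝ᵥ (x - (m : ℤ) • v) = 0 := by
        intro y hy hyv
        have h1 : coeLat y ⬝ᵥ coeLat x = - m := by rw [← hzx, dotProduct_smul, hy, smul_eq_mul, mul_neg_one]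
        rw [coeLat_dot] at h1
        have h2 : y ⬝ᵥ x = - (m : ℤ) := by exact_mod_cast h1
        rw [dotProduct_sub, dotProduct_smul, hyv, h2]; simp
      obtain ⟨s, t, hst⟩ := hrep _ (k1 y₁ (hF z hz).1 hv'.1) (k1 y₂ (hF z hz).2 hv'.2)
      have hx2 : x = s • b₀ + t • b₁ + (m : ℤ) • v := by rw [← hst]; abel
      refine ⟨![s, t], ?_, ?_⟩
      · have := (hmem ![s, t]).2 (by simp only [Matrix.cons_val_zero, Matrix.cons_val_one, ← hx2]; exact hx)
        exact this
      · simp only [Matrix.cons_val_zero, Matrix.cons_val_one, ← hx2]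
  refine ⟨2 * volume.real S, ?_, ?_⟩
  · have h1 := tendsto_card_div_pow_atTop_volume S hSc.isBounded hSc.measurableSet (hScv.addHaar_frontier volume)
    refine (h1.const_mul 2).congr' ?_
    filter_upwards [eventually_gt_atTop 0] with n hn
    rw [hcard n hn, lat_eq_card S hn, Fintype.card_fin, mul_div_assoc]
  · intro hd
    have hne : affineSpan ℝ S ≠ ⊤ := by
      intro ht
      have h1 : affineSpan ℝ (g '' S) ≤ affineSpan ℝ F := affineSpan_mono ℝ (Set.image_preimage_subset _ _)
      rw [← AffineSubspace.map_span, ht] at h1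
      have h2 := AffineSubspace.direction_le h1
      rw [AffineSubspace.map_direction, AffineSubspace.direction_top] at h2
      have h3 := Submodule.finrank_mono h2
      have h4 : g.linear = plc b₀ b₁ := by ext; simp [g]
      rw [h4, Submodule.map_top, LinearMap.finrank_range_of_inj hinj, Module.finrank_fin_fun] at h3
      rw [dimSet] at hd
      omega
    have h0 : volume S = 0 := measure_mono_null (subset_affineSpan ℝ S) (Measure.addHaar_affineSubspace volume _ hne)
    rw [measureReal_def, h0]; simp

lemma seg_count {y₁ y₂ : Fin 4 → ℤ} (h12 : y₁ ≠ y₂) {m : ℕ} (hm : 0 < m) :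
    ((latticePoints ((m : ℝ) • segment ℝ (coeLat y₁) (coeLat y₂))).ncard : ℝ) = m * gl (y₁ - y₂) + 1 := by
  have hd : y₁ - y₂ ≠ 0 := sub_ne_zero.2 h12
  set p := prv (y₁ - y₂) with hp
  set l := gl (y₁ - y₂) with hl
  have hl1 : 1 ≤ l := gl_pos hd
  have hlp : y₁ - y₂ = l • p := gl_smul _
  obtain ⟨z, hz⟩ := prv_prim hd
  rw [← hp] at hz
  have hm' : (0 : ℝ) < m := by exact_mod_cast hm
  have hset : latticePoints ((m : ℝ) • segment ℝ (coeLat y₁) (coeLat y₂)) = 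
      (fun t : ℤ => (m : ℤ) • y₂ + t • p) '' (Set.Icc 0 (m * l)) := by
    have hl0 : (0 : ℝ) < l := by exact_mod_cast (by omega : 0 < l)
    have hy1 : coeLat y₁ = coeLat y₂ + (l : ℝ) • coeLat p := by
      have : y₁ = y₂ + l • p := by rw [← hlp]; abel
      rw [this]; ext k; simp [coeLat]
    have hpr : ∀ i, ((y₁ i : ℤ) : ℝ) = y₂ i + l * p i := fun i => by have := congrFun hy1 i; simpa [coeLat] using this
    ext x
    constructor
    · rintro ⟨w, hw, hwx⟩
      rw [segment_symm, segment_eq_image] at hw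
      obtain ⟨s, ⟨hs0, hs1⟩, rfl⟩ := hw
      have hx : coeLat x = (m : ℝ) • coeLat y₂ + (m * s * l) • coeLat p := by
        rw [← hwx]; ext k
        simp only [coeLat, Pi.add_apply, Pi.smul_apply, smul_eq_mul, hpr]
        ring
      have ht : (((x - (m : ℤ) • y₂) ⬝ᵥ z : ℤ) : ℝ) = m * s * l := by
        rw [← coeLat_dot, coeLat_sub, hx]
        have : coeLat ((m : ℤ) • y₂) = (m : ℝ) • coeLat y₂ := by ext k; simp [coeLat]
        rw [this, add_sub_cancel_left, smul_dotProduct, coeLat_dot, hz]; simp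
      refine ⟨(x - (m : ℤ) • y₂) ⬝ᵥ z, ⟨?_, ?_⟩, ?_⟩
      · have : (0 : ℝ) ≤ (((x - (m : ℤ) • y₂) ⬝ᵥ z : ℤ) : ℝ) := by rw [ht]; positivity
        exact_mod_cast this
      · have : (((x - (m : ℤ) • y₂) ⬝ᵥ z : ℤ) : ℝ) ≤ m * l := by 
          rw [ht, mul_assoc]
          exact mul_le_mul_of_nonneg_left (by nlinarith) hm'.le
        exact_mod_cast this
      · apply coeLat_inj
        rw [hx, ← ht]
        ext k; simp [coeLat]
    · rintro ⟨t, ⟨h0, h1⟩, rfl⟩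
      have h0' : (0 : ℝ) ≤ t := by exact_mod_cast h0
      have h1' : (t : ℝ) ≤ m * l := by exact_mod_cast h1
      rw [latticePoints, Set.mem_ofPred_eq, segment_symm, segment_eq_image]
      refine ⟨_, ⟨t / (m * l), ⟨by positivity, by rw [div_le_one (by positivity)]; exact h1'⟩, rfl⟩, ?_⟩
      ext k
      simp [coeLat, hpr]
      field_simp
      ring
  rw [hset, Set.ncard_image_of_injective, ← Finset.coe_Icc, Set.ncard_coe_finset, Int.card_Icc]
  · have : (0 : ℤ) ≤ m * l + 1 - 0 := by
      have : (0 : ℤ) ≤ m * l := mul_nonneg (by positivity) (by omega)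
      omega
    have h2 := Int.toNat_of_nonneg this
    have h3 : (((m * l + 1 - 0 : ℤ).toNat : ℤ) : ℝ) = ((m * l + 1 - 0 : ℤ) : ℝ) := by rw [h2]
    push_cast at h3
    simpa using h3
  · intro s t hst
    have := congrArg (fun w => w ⬝ᵥ z) (add_left_cancel hst)
    simp only [smul_dotProduct, hz, smul_eq_mul, mul_one] at this
    exact this

lemma seg_normVol {y₁ y₂ : Fin 4 → ℤ} (h12 : y₁ ≠ y₂) : normVol 1 (segment ℝ (coeLat y₁) (coeLat y₂)) = gl (y₁ - y₂) := by
  apply Tendsto.limUnder_eq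
  have h : Tendsto (fun m : ℕ => (gl (y₁ - y₂) : ℝ) + 1 / (m : ℝ)) atTop (nhds ((gl (y₁ - y₂) : ℝ) + 0)) :=
    tendsto_const_nhds.add tendsto_one_div_atTop_nhds_zero_nat
  rw [add_zero] at h
  refine h.congr' ?_
  filter_upwards [eventually_gt_atTop 0] with m hm
  have hm' : (m : ℝ) ≠ 0 := by positivity
  rw [seg_count h12 hm]
  simp
  field_simp

end

section


lemma wt_eq {E : Finset (Fin 4 → ℤ)} {x : Fin 4 → ℝ} {w : (Fin 4 → ℤ) → ℝ} (hx : ∀ z ∈ E, -1 ≤ coeLat z ⬝ᵥ x)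
    (h0 : ∀ z ∈ E, 0 ≤ w z) (h1 : ∑ z ∈ E, w z = 1) (h : (∑ z ∈ E, w z • coeLat z) ⬝ᵥ x = -1) {z : Fin 4 → ℤ} (hz : z ∈ E)
    (hw : w z ≠ 0) : coeLat z ⬝ᵥ x = -1 := by
  rw [sum_dotProduct] at h
  have h2 : ∑ z ∈ E, w z * (coeLat z ⬝ᵥ x + 1) = 0 := by
    have : ∀ z ∈ E, w z * (coeLat z ⬝ᵥ x + 1) = (w z • coeLat z) ⬝ᵥ x + w z := fun z _ => by
      rw [smul_dotProduct, smul_eq_mul]; ring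
    rw [Finset.sum_congr rfl this, Finset.sum_add_distrib, h, h1]; ring
  rw [Finset.sum_eq_zero_iff_of_nonneg (fun z hz => mul_nonneg (h0 z hz) (by linarith [hx z hz]))] at h2
  have := (mul_eq_zero.1 (h2 z hz)).resolve_left hw
  linarith

lemma exists_wt_ne {E : Finset (Fin 4 → ℤ)} {w : (Fin 4 → ℤ) → ℝ} (h1 : ∑ z ∈ E, w z = 1) : ∃ z ∈ E, w z ≠ 0 := by
  by_contra! h
  rw [Finset.sum_eq_zero h] at h1
  norm_num at h1

lemma dimSet_empty : dimSet (∅ : Set (Fin 4 → ℝ)) = 0 := by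
  simp [dimSet]

lemma nonempty_of_dimSet {S : Set (Fin 4 → ℝ)} (h : dimSet S ≠ 0) : S.Nonempty := by
  by_contra hn
  rw [Set.not_nonempty_iff_eq_empty] at hn
  exact h (hn ▸ dimSet_empty)

lemma dimSet_eq_vec (S : Set (Fin 4 → ℝ)) : dimSet S = Module.finrank ℝ (vectorSpan ℝ S) := by
  rw [dimSet, direction_affineSpan]

lemma dimSet_top {S : Set (Fin 4 → ℝ)} (h : (interior S).Nonempty) : dimSet S = 4 := by
  have : affineSpan ℝ S = ⊤ := by
    have h1 := isOpen_interior.affineSpan_eq_top h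
    rw [eq_top_iff, ← h1]
    exact affineSpan_mono ℝ interior_subset
  rw [dimSet, this, AffineSubspace.direction_top, finrank_top, Module.finrank_fin_fun]

/-- vector span is killed by functionals constant on the set -/
lemma vec_dot {S : Set (Fin 4 → ℝ)} {y : Fin 4 → ℝ} {r : ℝ} (h : ∀ x ∈ S, y ⬝ᵥ x = r) {d : Fin 4 → ℝ} (hd : d ∈ vectorSpan ℝ S) :
    y ⬝ᵥ d = 0 := by
  have : vectorSpan ℝ S ≤ LinearMap.ker (dotProductBilin ℝ ℝ y) := by
    rw [vectorSpan_def, Submodule.span_le]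
    rintro _ ⟨a, ha, b, hb, rfl⟩
    simp [h a ha, h b hb]
  have := this hd
  simpa using this

/-- linear span of a two-dimensional set -/
lemma annih_line {S : Set (Fin 4 → ℝ)} (hS : dimSet S = 2) {y u w : Fin 4 → ℝ} (hy : ∀ x ∈ S, y ⬝ᵥ x = -1)
    (hu : ∀ x ∈ S, u ⬝ᵥ x = 0) (hw : ∀ x ∈ S, w ⬝ᵥ x = 0) (hu0 : u ≠ 0) : ∃ t : ℝ, w = t • u := by
  obtain ⟨x0, hx0⟩ := nonempty_of_dimSet (S := S) (by omega)
  let W := Submodule.span ℝ S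
  have h1 : vectorSpan ℝ S < W := by
    refine lt_of_le_of_ne ?_ ?_
    · rw [vectorSpan_def, Submodule.span_le]
      rintro _ ⟨a, ha, b, hb, rfl⟩
      exact W.sub_mem (Submodule.subset_span ha) (Submodule.subset_span hb)
    · intro he
      have hx : x0 ∈ vectorSpan ℝ S := by rw [he]; exact Submodule.subset_span hx0
      have := vec_dot hy hx
      rw [hy x0 hx0] at this
      norm_num at this
  have h2 := Submodule.finrank_lt_finrank_of_lt h1
  rw [← dimSet_eq_vec, hS] at h2
  have h3 := Subspace.finrank_add_finrank_dualAnnihilator_eq W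
  rw [Module.finrank_fin_fun] at h3
  have hm : ∀ v : Fin 4 → ℝ, (∀ x ∈ S, v ⬝ᵥ x = 0) → dotProductEquiv ℝ (Fin 4) v ∈ W.dualAnnihilator := by
    intro v hv
    rw [Submodule.mem_dualAnnihilator]
    intro x hx
    have : W ≤ LinearMap.ker (dotProductEquiv ℝ (Fin 4) v) := by
      rw [Submodule.span_le]
      intro z hz
      simpa using hv z hz
    exact this hx
  let U : Submodule ℝ (Fin 4 → ℝ) := W.dualAnnihilator.comap (dotProductEquiv ℝ (Fin 4)).toLinearMap
  have hU : Module.finrank ℝ U = Module.finrank ℝ W.dualAnnihilator := by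
    have h4 := LinearEquiv.finrank_map_eq (dotProductEquiv ℝ (Fin 4)) U
    rw [← h4]
    congr 2 <;> rw [Submodule.map_comap_eq_of_surjective (dotProductEquiv ℝ (Fin 4)).surjective]
  have h4 : Module.finrank ℝ U ≤ 1 := by omega
  have h5 : (⟨u, hm u hu⟩ : U) ≠ 0 := by
    intro h
    apply hu0
    have := congrArg Subtype.val h
    simpa using this
  obtain ⟨v, hv⟩ := finrank_le_one_iff.1 h4
  obtain ⟨a, ha⟩ := hv ⟨u, hm u hu⟩
  obtain ⟨b, hb⟩ := hv ⟨w, hm w hw⟩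
  have ha0 : a ≠ 0 := by
    rintro rfl
    rw [zero_smul] at ha
    exact h5 ha.symm
  refine ⟨b / a, ?_⟩
  have e1 := congrArg Subtype.val ha
  have e2 := congrArg Subtype.val hb
  simp only [Submodule.coe_smul] at e1 e2
  rw [← e1, ← e2, smul_smul, div_mul_cancel₀ _ ha0]

lemma exists_annih {S : Set (Fin 4 → ℝ)} (hS : dimSet S = 2) : ∃ u : Fin 4 → ℝ, u ≠ 0 ∧ ∀ x ∈ S, u ⬝ᵥ x = 0 := by
  obtain ⟨x0, hx0⟩ := nonempty_of_dimSet (S := S) (by omega)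
  let W := vectorSpan ℝ S ⊔ Submodule.span ℝ {x0}
  have h1 : Module.finrank ℝ W ≤ 3 := by
    refine (Submodule.finrank_add_le_finrank_add_finrank _ _).trans ?_
    have : Module.finrank ℝ (Submodule.span ℝ {x0}) ≤ 1 := by
      have := finrank_span_le_card (R := ℝ) ({x0} : Set (Fin 4 → ℝ))
      simpa using this
    rw [← dimSet_eq_vec, hS]
    omega
  have h2 : W < ⊤ := by
    rw [lt_top_iff_ne_top]
    intro h
    rw [h, finrank_top, Module.finrank_fin_fun] at h1
    omega
  obtain ⟨f, hf0, hf⟩ := W.exists_le_ker_of_lt_top h2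
  refine ⟨(dotProductEquiv ℝ (Fin 4)).symm f, by simpa using hf0, fun x hx => ?_⟩
  have h3 : x ∈ W := by
    have : x = (x -ᵥ x0) + x0 := by simp
    rw [this]
    exact Submodule.add_mem_sup (vsub_mem_vectorSpan ℝ hx hx0) (Submodule.mem_span_singleton_self x0)
  have h4 := hf h3
  rw [LinearMap.mem_ker] at h4
  rw [← dotProductEquiv_apply_apply, LinearEquiv.apply_symm_apply]
  exact h4

/-- rank two orthogonal plane -/
lemma finrank_plane {a b : Fin 4 → ℝ} {i j : Fin 4} (h : a i * b j - a j * b i ≠ 0) :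
    Module.finrank ℝ (LinearMap.ker (Matrix.mulVecLin (Matrix.of ![a, b]))) = 2 := by
  have hs : LinearMap.range (Matrix.mulVecLin (Matrix.of ![a, b])) = ⊤ := by
    rw [LinearMap.range_eq_top]
    intro w
    refine ⟨Pi.single i ((w 0 * b j - w 1 * a j) / (a i * b j - a j * b i)) + Pi.single j ((a i * w 1 - b i * w 0) / (a i * b j - a j * b i)), ?_⟩
    ext k
    fin_cases k
    · simp [Matrix.mulVec, dotProduct_add]
      rw [mul_div_assoc', mul_div_assoc', ← add_div, div_eq_iff h]
      ring
    · simp [Matrix.mulVec, dotProduct_add]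
      rw [mul_div_assoc', mul_div_assoc', ← add_div, div_eq_iff h]
      ring
  have := LinearMap.finrank_range_add_finrank_ker (Matrix.mulVecLin (Matrix.of ![a, b]))
  rw [hs, finrank_top, Module.finrank_fin_fun, Module.finrank_fin_fun] at this
  omega

lemma mem_plane {a b x : Fin 4 → ℝ} : x ∈ LinearMap.ker (Matrix.mulVecLin (Matrix.of ![a, b])) ↔ a ⬝ᵥ x = 0 ∧ b ⬝ᵥ x = 0 := by
  rw [LinearMap.mem_ker]
  constructor
  · intro h
    have e0 := congrFun h 0
    have e1 := congrFun h 1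
    simp [Matrix.mulVec] at e0 e1
    exact ⟨e0, e1⟩
  · rintro ⟨h1, h2⟩
    ext k
    fin_cases k
    · simpa [Matrix.mulVec] using h1
    · simpa [Matrix.mulVec] using h2

lemma exists_minor_real {a b x : Fin 4 → ℝ} (h1 : a ⬝ᵥ x = -1) (h2 : b ⬝ᵥ x = -1) (h12 : a ≠ b) :
    ∃ i j, a i * b j - a j * b i ≠ 0 := by
  by_contra! hc
  apply h12
  ext i
  have : ∑ j, (a i * b j - a j * b i) * x j = 0 := Finset.sum_eq_zero fun j _ => by rw [hc, zero_mul]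
  have e : ∑ j, (a i * b j - a j * b i) * x j = a i * (b ⬝ᵥ x) - b i * (a ⬝ᵥ x) := by
    simp only [dotProduct, Finset.mul_sum, ← Finset.sum_sub_distrib]
    exact Finset.sum_congr rfl fun j _ => by ring
  rw [e, h1, h2] at this
  linarith

lemma dimSet_seg {a b : Fin 4 → ℝ} (h : a ≠ b) : dimSet (segment ℝ a b) = 1 := by
  rw [dimSet, ← convexHull_pair, affineSpan_convexHull, direction_affineSpan, vectorSpan_pair, finrank_span_singleton]
  rw [vsub_eq_sub]; exact sub_ne_zero.2 h

lemma expo {P Q : Set (Fin 4 → ℝ)} (h : DP P Q) {θ : Set (Fin 4 → ℝ)} (he : IsExposed ℝ P θ) (hn : θ.Nonempty) (hd : dimSet θ ≠ 4) :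
    ∃ y ∈ Q, θ = {x | x ∈ P ∧ y ⬝ᵥ x = -1} := by
  obtain ⟨l, hl⟩ := he hn
  obtain ⟨x0, hx0⟩ := hn
  have hx0' := hx0
  rw [hl] at hx0'
  have h0 : 0 ∈ P := interior_subset h.zeroP
  have hM : 0 ≤ l x0 := by simpa using hx0'.2 0 h0
  rcases hM.eq_or_lt with hM | hM
  · exfalso
    have hl0 : ∀ v, l v ≤ 0 := by
      intro v
      have hc : Tendsto (fun t : ℝ => t • v) (nhdsWithin 0 (Set.Ioi 0)) (nhds 0) := by
        have : Tendsto (fun t : ℝ => t • v) (nhds 0) (nhds ((0 : ℝ) • v)) := Continuous.tendsto (by fun_prop) _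
        rw [zero_smul] at this
        exact this.mono_left nhdsWithin_le_nhds
      obtain ⟨t, h1, ht⟩ := ((hc.eventually (mem_interior_iff_mem_nhds.1 h.zeroP)).and self_mem_nhdsWithin).exists
      have ht' : (0 : ℝ) < t := ht
      have := hx0'.2 _ h1
      rw [← hM, map_smul, smul_eq_mul] at this
      by_contra! hv
      have := mul_pos ht' hv
      linarith
    have hl1 : ∀ v, l v = 0 := fun v => le_antisymm (hl0 v) (by have := hl0 (-v); rw [map_neg] at this; linarith)
    apply hd
    have : θ = P := by rw [hl]; ext x; simp [hl1]
    rw [this]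
    exact dimSet_top ⟨0, h.zeroP⟩
  · let u : Fin 4 → ℝ := fun i => l (Pi.single i 1)
    have hu : ∀ x, l x = u ⬝ᵥ x := clm_eq_dot l
    have hy : ∀ x, ((-(l x0)⁻¹) • u) ⬝ᵥ x = - (l x / l x0) := fun x => by
      rw [smul_dotProduct, ← hu, smul_eq_mul]; ring
    refine ⟨(-(l x0)⁻¹) • u, ?_, ?_⟩
    · rw [h.memQ]
      intro x hx
      rw [hy, neg_le_neg_iff, div_le_one hM]
      exact hx0'.2 x hx
    · ext x
      rw [Set.mem_ofPred_eq, hy, neg_inj, div_eq_one_iff_eq hM.ne']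
      constructor
      · intro hx
        rw [hl] at hx
        exact ⟨hx.1, le_antisymm (hx0'.2 x hx.1) (hx.2 _ hx0'.1)⟩
      · rintro ⟨h1, h2⟩
        rw [hl]
        exact ⟨h1, fun z hz => by rw [h2]; exact hx0'.2 z hz⟩

lemma expo_of {P Q : Set (Fin 4 → ℝ)} (h : DP P Q) {y : Fin 4 → ℝ} (hy : y ∈ Q) : IsExposed ℝ P {x | x ∈ P ∧ y ⬝ᵥ x = -1} := by
  rintro ⟨x0, hx0, hx0'⟩
  refine ⟨LinearMap.toContinuousLinearMap (dotProductEquiv ℝ (Fin 4) (-y)), ?_⟩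
  ext x
  simp only [Set.mem_ofPred_eq, LinearMap.coe_toContinuousLinearMap', dotProductEquiv_apply_apply, neg_dotProduct, neg_le_neg_iff]
  refine and_congr_right fun hx => ⟨fun h1 z hz => ?_, fun h1 => ?_⟩
  · rw [h1]; exact (h.memP z).1 hz y hy
  · exact le_antisymm (hx0' ▸ h1 x0 hx0) ((h.memP x).1 hx y hy)

lemma DP.mem_dualFace {P Q : Set (Fin 4 → ℝ)} (h : DP P Q) {θ : Set (Fin 4 → ℝ)} {y : Fin 4 → ℝ} :
    y ∈ dualFace P θ ↔ y ∈ Q ∧ ∀ x ∈ θ, y ⬝ᵥ x = -1 := by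
  rw [h.memQ]
  exact Iff.rfl

end

section


section
variable {P Q : Set (Fin 4 → ℝ)} {E V : Finset (Fin 4 → ℤ)}

lemma FP_swap (P : Set (Fin 4 → ℝ)) (y₁ y₂ : Fin 4 → ℤ) : FP P y₂ y₁ = FP P y₁ y₂ := by
  ext x
  exact and_congr_right fun _ => and_comm

lemma DPE.FP_convex (h : DPE P Q E V) (y₁ y₂ : Fin 4 → ℤ) : Convex ℝ (FP P y₁ y₂) := by
  intro a ha b hb s t hs ht hst
  refine ⟨h.latP.convex ha.1 hb.1 hs ht hst, ?_, ?_⟩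
  · rw [dotProduct_add, dotProduct_smul, dotProduct_smul, ha.2.1, hb.2.1, smul_eq_mul, smul_eq_mul]; linarith
  · rw [dotProduct_add, dotProduct_smul, dotProduct_smul, ha.2.2, hb.2.2, smul_eq_mul, smul_eq_mul]; linarith

lemma DPE.FP_compact (h : DPE P Q E V) (y₁ y₂ : Fin 4 → ℤ) : IsCompact (FP P y₁ y₂) := by
  have hc : ∀ y : Fin 4 → ℤ, Continuous fun x : Fin 4 → ℝ => coeLat y ⬝ᵥ x := fun y => by
    unfold dotProduct; fun_prop
  exact h.latP.isCompact.inter_right ((isClosed_eq (hc y₁) continuous_const).inter (isClosed_eq (hc y₂) continuous_const))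

lemma dim_FP_le {y₁ y₂ : Fin 4 → ℤ} (h12 : y₁ ≠ y₂) : dimSet (FP P y₁ y₂) ≤ 2 := by
  rcases (FP P y₁ y₂).eq_empty_or_nonempty with he | ⟨x, hx⟩
  · rw [he, dimSet_empty]; omega
  · obtain ⟨i, j, hij⟩ := exists_minor_real hx.2.1 hx.2.2 (fun he => h12 (coeLat_inj he))
    rw [dimSet_eq_vec, ← finrank_plane hij]
    apply Submodule.finrank_mono
    intro d hd
    rw [mem_plane]
    exact ⟨vec_dot (fun x hx => hx.2.1) hd, vec_dot (fun x hx => hx.2.2) hd⟩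

lemma DPE.FP_vertex (h : DPE P Q E V) {y₁ y₂ : Fin 4 → ℤ} (h1 : y₁ ∈ E) (h2 : y₂ ∈ E) (hn : (FP P y₁ y₂).Nonempty) :
    ∃ v ∈ V, coeLat v ∈ FP P y₁ y₂ := by
  obtain ⟨x, hx, hx1, hx2⟩ := hn
  have hx' := hx
  rw [h.hullP] at hx'
  obtain ⟨w, w0, w1, rfl⟩ := hull_weights hx'
  obtain ⟨v, hv, hwv⟩ := exists_wt_ne w1
  have key : ∀ y ∈ E, coeLat y ⬝ᵥ (∑ x ∈ V, w x • coeLat x) = -1 → coeLat y ⬝ᵥ coeLat v = -1 := fun y hy hyx => by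
    rw [dotProduct_comm]
    refine wt_eq (fun z hz => ?_) w0 w1 (by rw [dotProduct_comm]; exact hyx) hv hwv
    rw [dotProduct_comm]
    exact (h.memP _).1 (h.memV hz) _ (h.memE hy)
  exact ⟨v, hv, h.memV hv, key _ h1 hx1, key _ h2 hx2⟩

open Classical in
/-- two-dimensional area of the candidate face -/
def arF (P : Set (Fin 4 → ℝ)) (y₁ y₂ : Fin 4 → ℤ) : ℝ :=
  if dimSet (FP P y₁ y₂) = 2 then normVol 2 (FP P y₁ y₂) else 0

lemma DPE.arF_tendsto (h : DPE P Q E V) {y₁ y₂ : Fin 4 → ℤ} (h1 : y₁ ∈ E) (h2 : y₂ ∈ E) (h12 : y₁ ≠ y₂) :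
    Tendsto (fun m : ℕ => 2 * ((latticePoints ((m : ℝ) • FP P y₁ y₂)).ncard : ℝ) / (m : ℝ) ^ 2) atTop (nhds (arF P y₁ y₂)) := by
  rcases (FP P y₁ y₂).eq_empty_or_nonempty with he | hn
  · have : arF P y₁ y₂ = 0 := by
      rw [arF, if_neg]; rw [he, dimSet_empty]; omega
    rw [this, he]
    have : latticePoints (∅ : Set (Fin 4 → ℝ)) = ∅ := by
      ext x; simp [latticePoints]
    simp [this]
  · obtain ⟨v, hv, hvF⟩ := h.FP_vertex h1 h2 hn
    obtain ⟨A, hA, hA0⟩ := lim_exists (h.FP_compact y₁ y₂) (h.FP_convex y₁ y₂) (fun x hx => hx.2) h12 hvF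
    have hd := dim_FP_le (P := P) h12
    have : arF P y₁ y₂ = A := by
      rw [arF]
      split_ifs with hif
      · exact Tendsto.limUnder_eq (by simpa using hA)
      · exact (hA0 (by omega)).symm
    rw [this]
    exact hA

lemma DPE.K1 (h : DPE P Q E V) {θ : Set (Fin 4 → ℝ)} (hθ : dimSet θ = 2) {y₁ y₂ y₃ : Fin 4 → ℤ} (h1 : y₁ ∈ E) (h2 : y₂ ∈ E) (h3 : y₃ ∈ E)
    (h12 : y₁ ≠ y₂) (e1 : ∀ x ∈ θ, coeLat y₁ ⬝ᵥ x = -1) (e2 : ∀ x ∈ θ, coeLat y₂ ⬝ᵥ x = -1) (e3 : ∀ x ∈ θ, coeLat y₃ ⬝ᵥ x = -1) :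
    y₃ = y₁ ∨ y₃ = y₂ := by
  by_contra! hc
  have i : ∀ {a b : Fin 4 → ℤ}, a ≠ b → coeLat a ≠ coeLat b := fun hab he => hab (coeLat_inj he)
  obtain ⟨t, ht⟩ := annih_line hθ (u := coeLat y₁ - coeLat y₂) (w := coeLat y₁ - coeLat y₃) e1
    (fun x hx => by rw [sub_dotProduct, e1 x hx, e2 x hx, sub_self])
    (fun x hx => by rw [sub_dotProduct, e1 x hx, e3 x hx, sub_self]) (sub_ne_zero.2 (i h12))
  exact ext_ncol ((h.ext _).1 h1) ((h.ext _).1 h2) ((h.ext _).1 h3) (i h12) (i hc.1.symm) (i hc.2.symm) t ht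

/-- points of the dual polytope on the hyperplane given by points of the polytope -/
lemma DPE.mem_seg (h : DPE P Q E V) {θ : Set (Fin 4 → ℝ)} (hθP : θ ⊆ P) {y₁ y₂ : Fin 4 → ℤ}
    (h1 : y₁ ∈ E) (h2 : y₂ ∈ E)
    (e1 : ∀ x ∈ θ, coeLat y₁ ⬝ᵥ x = -1) (e2 : ∀ x ∈ θ, coeLat y₂ ⬝ᵥ x = -1)
    (hk : ∀ y₃ ∈ E, (∀ x ∈ θ, coeLat y₃ ⬝ᵥ x = -1) → y₃ = y₁ ∨ y₃ = y₂) (y : Fin 4 → ℝ) :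
    (y ∈ Q ∧ ∀ x ∈ θ, y ⬝ᵥ x = -1) ↔ y ∈ segment ℝ (coeLat y₁) (coeLat y₂) := by
  constructor
  · rintro ⟨hy, hyx⟩
    rw [h.hullQ] at hy
    obtain ⟨w, w0, w1, rfl⟩ := hull_weights hy
    have hs : ∀ z ∈ E, w z ≠ 0 → z = y₁ ∨ z = y₂ := fun z hz hwz => hk z hz fun x hx =>
      wt_eq (fun z' hz' => (h.memP x).1 (hθP hx) _ (h.memE hz')) w0 w1 (hyx x hx) hz hwz
    have hm : ∀ z ∈ E, w z ≠ 0 → coeLat z ∈ segment ℝ (coeLat y₁) (coeLat y₂) := fun z hz hwz => by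
      rcases hs z hz hwz with rfl | rfl
      · exact left_mem_segment _ _ _
      · exact right_mem_segment _ _ _
    classical
    rw [← Finset.sum_filter_ne_zero] at w1
    have : ∑ x ∈ E, w x • (coeLat x : Fin 4 → ℝ) = ∑ x ∈ E with w x ≠ 0, w x • coeLat x := by
      symm
      apply Finset.sum_subset (Finset.filter_subset _ _)
      intro x hx hx'
      have : w x = 0 := by
        by_contra hw
        exact hx' (Finset.mem_filter.2 ⟨hx, hw⟩)
      rw [this, zero_smul]
    rw [this]
    exact (convex_segment _ _).sum_mem (fun x hx => w0 x (Finset.mem_filter.1 hx).1) w1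
      (fun x hx => hm x (Finset.mem_filter.1 hx).1 (Finset.mem_filter.1 hx).2)
  · rintro ⟨s, t, hs, ht, hst, rfl⟩
    refine ⟨h.latQ.convex (h.memE h1) (h.memE h2) hs ht hst, fun x hx => ?_⟩
    rw [add_dotProduct, smul_dotProduct, smul_dotProduct, e1 x hx, e2 x hx, smul_eq_mul, smul_eq_mul]
    linarith

lemma DPE.FP_ne (h : DPE P Q E V) {y₁ y₂ z₁ z₂ : Fin 4 → ℤ} (h1 : y₁ ∈ E) (h2 : y₂ ∈ E) (h3 : z₁ ∈ E) (h4 : z₂ ∈ E)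
    (h12 : y₁ ≠ y₂) (h34 : z₁ ≠ z₂) (hd : dimSet (FP P y₁ y₂) = 2) (he : FP P y₁ y₂ = FP P z₁ z₂) :
    (y₁ = z₁ ∧ y₂ = z₂) ∨ (y₁ = z₂ ∧ y₂ = z₁) := by
  have k1 := h.K1 hd h1 h2 h3 h12 (fun x hx => hx.2.1) (fun x hx => hx.2.2) (fun x hx => (he ▸ hx : x ∈ FP P z₁ z₂).2.1)
  have k2 := h.K1 hd h1 h2 h4 h12 (fun x hx => hx.2.1) (fun x hx => hx.2.2) (fun x hx => (he ▸ hx : x ∈ FP P z₁ z₂).2.2)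
  rcases k1 with rfl | rfl <;> rcases k2 with rfl | rfl <;> simp_all

lemma DPE.dual_FP (h : DPE P Q E V) {y₁ y₂ : Fin 4 → ℤ} (h1 : y₁ ∈ E) (h2 : y₂ ∈ E) (h12 : y₁ ≠ y₂)
    (hd : dimSet (FP P y₁ y₂) = 2) : dualFace P (FP P y₁ y₂) = segment ℝ (coeLat y₁) (coeLat y₂) := by
  ext y
  rw [h.mem_dualFace, h.mem_seg (fun x hx => hx.1) h1 h2 (fun x hx => hx.2.1) (fun x hx => hx.2.2)]
  exact fun y₃ h3 e3 => h.K1 hd h1 h2 h3 h12 (fun x hx => hx.2.1) (fun x hx => hx.2.2) e3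

lemma DPE.dual_seg (h : DPE P Q E V) {y₁ y₂ : Fin 4 → ℤ} (h1 : y₁ ∈ E) (h2 : y₂ ∈ E) :
    dualFace Q (segment ℝ (coeLat y₁) (coeLat y₂)) = FP P y₁ y₂ := by
  ext x
  rw [h.toDP.symm.mem_dualFace]
  refine and_congr_right fun hx => ⟨fun hy => ?_, ?_⟩
  · have a := hy _ (left_mem_segment _ _ _)
    have b := hy _ (right_mem_segment _ _ _)
    rw [dotProduct_comm] at a b
    exact ⟨a, b⟩
  · rintro ⟨e1, e2⟩ _ ⟨s, t, hs, ht, hst, rfl⟩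
    rw [dotProduct_comm, add_dotProduct, smul_dotProduct, smul_dotProduct, e1, e2, smul_eq_mul, smul_eq_mul]
    linarith

lemma DPE.two_face (h : DPE P Q E V) (θ : Set (Fin 4 → ℝ)) :
    IsFaceOfDim P 2 θ ↔ ∃ y₁ ∈ E, ∃ y₂ ∈ E, y₁ ≠ y₂ ∧ dimSet (FP P y₁ y₂) = 2 ∧ FP P y₁ y₂ = θ := by
  constructor
  · rintro ⟨he, hn, hd⟩
    obtain ⟨y, hy, rfl⟩ := expo h.toDP he hn (by omega)
    rw [h.hullQ] at hy
    obtain ⟨w, w0, w1, rfl⟩ := hull_weights hy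
    have hs : ∀ z ∈ E, w z ≠ 0 → ∀ x ∈ {x | x ∈ P ∧ (∑ z ∈ E, w z • coeLat z) ⬝ᵥ x = -1}, coeLat z ⬝ᵥ x = -1 :=
      fun z hz hwz x hx => wt_eq (fun z' hz' => (h.memP x).1 hx.1 _ (h.memE hz')) w0 w1 hx.2 hz hwz
    have hconv : ∀ x ∈ P, (∀ z ∈ E, w z ≠ 0 → coeLat z ⬝ᵥ x = -1) → (∑ z ∈ E, w z • coeLat z) ⬝ᵥ x = -1 := by
      intro x hx hz
      rw [sum_dotProduct, ← w1, ← Finset.sum_neg_distrib]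
      refine Finset.sum_congr rfl fun z hzE => ?_
      rw [smul_dotProduct, smul_eq_mul]
      by_cases hw : w z = 0
      · rw [hw]; ring
      · rw [hz z hzE hw]; ring
    obtain ⟨y₁, h1, hw1⟩ := exists_wt_ne w1
    have : ∃ y₂ ∈ E, w y₂ ≠ 0 ∧ y₁ ≠ y₂ := by
      by_contra! hc
      obtain ⟨u, hu, hux⟩ := exists_annih hd
      obtain ⟨x, hxV, hx1, hx2⟩ := h.ext_ne h1 hu
      apply hx2
      apply hux
      refine ⟨h.memV hxV, hconv _ (h.memV hxV) fun z hz hwz => ?_⟩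
      rw [← hc z hz hwz, coeLat_dot, hx1]; norm_num
    obtain ⟨y₂, h2, hw2, h12⟩ := this
    have hF : FP P y₁ y₂ = {x | x ∈ P ∧ (∑ z ∈ E, w z • coeLat z) ⬝ᵥ x = -1} := by
      ext x
      constructor
      · rintro ⟨hx, e1, e2⟩
        refine ⟨hx, hconv x hx fun z hz hwz => ?_⟩
        rcases h.K1 hd h1 h2 hz h12 (hs _ h1 hw1) (hs _ h2 hw2) (hs _ hz hwz) with rfl | rfl
        · exact e1
        · exact e2
      · intro hx
        exact ⟨hx.1, hs _ h1 hw1 x hx, hs _ h2 hw2 x hx⟩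
    exact ⟨y₁, h1, y₂, h2, h12, hF ▸ hd, hF⟩
  · rintro ⟨y₁, h1, y₂, h2, h12, hd, rfl⟩
    refine ⟨?_, nonempty_of_dimSet (by omega), hd⟩
    have hm : (2⁻¹ : ℝ) • coeLat y₁ + (2⁻¹ : ℝ) • coeLat y₂ ∈ Q :=
      h.latQ.convex (h.memE h1) (h.memE h2) (by norm_num) (by norm_num) (by norm_num)
    have := expo_of h.toDP hm
    convert this using 1
    ext x
    refine and_congr_right fun hx => ?_
    have a := (h.memP x).1 hx _ (h.memE h1)
    have b := (h.memP x).1 hx _ (h.memE h2)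
    rw [add_dotProduct, smul_dotProduct, smul_dotProduct, smul_eq_mul, smul_eq_mul]
    constructor
    · rintro ⟨e1, e2⟩; rw [e1, e2]; norm_num
    · intro e; constructor <;> linarith
end

end

section


section
variable {P Q : Set (Fin 4 → ℝ)} {E V : Finset (Fin 4 → ℤ)}

lemma DPE.generic_pt (h : DPE P Q E V) {y₁ y₂ : Fin 4 → ℤ} (h1 : y₁ ∈ E) (h2 : y₂ ∈ E) (h12 : y₁ ≠ y₂)
    (hd : dimSet (FP P y₁ y₂) = 2) : ∃ x ∈ FP P y₁ y₂, ∀ y ∈ E, y ≠ y₁ → y ≠ y₂ → -1 < coeLat y ⬝ᵥ x := by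
  classical
  suffices ∀ S : Finset (Fin 4 → ℤ), S ⊆ E → ∃ x ∈ FP P y₁ y₂, ∀ y ∈ S, y ≠ y₁ → y ≠ y₂ → -1 < coeLat y ⬝ᵥ x from
    this E subset_rfl
  intro S
  induction S using Finset.induction_on with
  | empty =>
    intro _
    obtain ⟨x, hx⟩ := nonempty_of_dimSet (S := FP P y₁ y₂) (by omega)
    exact ⟨x, hx, by simp⟩
  | insert y S hy ih =>
    intro hS
    obtain ⟨x, hx, hxS⟩ := ih fun z hz => hS (Finset.mem_insert_of_mem hz)
    have hyE : y ∈ E := hS (Finset.mem_insert_self _ _)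
    by_cases hyy : y = y₁ ∨ y = y₂
    · refine ⟨x, hx, fun z hz hz1 hz2 => ?_⟩
      rcases Finset.mem_insert.1 hz with rfl | hz
      · tauto
      · exact hxS z hz hz1 hz2
    · have : ∃ x' ∈ FP P y₁ y₂, coeLat y ⬝ᵥ x' ≠ -1 := by
        by_contra! hc
        exact hyy (h.K1 hd h1 h2 hyE h12 (fun x hx => hx.2.1) (fun x hx => hx.2.2) hc)
      obtain ⟨x', hx', hne⟩ := this
      refine ⟨(2⁻¹ : ℝ) • x + (2⁻¹ : ℝ) • x', h.FP_convex y₁ y₂ hx hx' (by norm_num) (by norm_num) (by norm_num), fun z hz hz1 hz2 => ?_⟩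
      rw [dotProduct_add, dotProduct_smul, dotProduct_smul, smul_eq_mul, smul_eq_mul]
      have b1 := (h.memP x).1 hx.1 _ (h.memE (hS hz))
      have b2 := (h.memP x').1 hx'.1 _ (h.memE (hS hz))
      rcases Finset.mem_insert.1 hz with rfl | hz
      · have := lt_of_le_of_ne b2 hne.symm
        linarith
      · have := hxS z hz hz1 hz2
        linarith

lemma DPE.one_face (h : DPE P Q E V) (θ : Set (Fin 4 → ℝ)) :
    IsFaceOfDim Q 1 θ ↔ ∃ y₁ ∈ E, ∃ y₂ ∈ E, y₁ ≠ y₂ ∧ dimSet (FP P y₁ y₂) = 2 ∧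
      segment ℝ (coeLat y₁) (coeLat y₂) = θ := by
  have ci : ∀ {a b : Fin 4 → ℤ}, a ≠ b → coeLat a ≠ coeLat b := fun hab he => hab (coeLat_inj he)
  constructor
  · rintro ⟨he, hn, hd⟩
    obtain ⟨x0, hx0, rfl⟩ := expo h.toDP.symm he hn (by omega)
    have hseg : ∀ y₁ ∈ E, ∀ y₂ ∈ E, coeLat y₁ ⬝ᵥ x0 = -1 → coeLat y₂ ⬝ᵥ x0 = -1 →
        (∀ y₃ ∈ E, coeLat y₃ ⬝ᵥ x0 = -1 → y₃ = y₁ ∨ y₃ = y₂) →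
        {y | y ∈ Q ∧ x0 ⬝ᵥ y = -1} = segment ℝ (coeLat y₁) (coeLat y₂) := by
      intro y₁ h1 y₂ h2 e1 e2 hk
      ext y
      rw [← h.mem_seg (θ := {x0}) (by simpa using hx0) h1 h2 (by simpa using e1) (by simpa using e2) (by simpa using hk) y]
      simp [dotProduct_comm]
    have hy1 : ∃ y₁ ∈ E, coeLat y₁ ⬝ᵥ x0 = -1 := by
      obtain ⟨y, hy, hyx⟩ := hn
      rw [h.hullQ] at hy
      obtain ⟨w, w0, w1, rfl⟩ := hull_weights hy
      obtain ⟨z, hz, hwz⟩ := exists_wt_ne w1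
      exact ⟨z, hz, wt_eq (fun z' hz' => (h.memP x0).1 hx0 _ (h.memE hz')) w0 w1 (by rw [dotProduct_comm]; exact hyx) hz hwz⟩
    obtain ⟨y₁, h1, e1⟩ := hy1
    have hy2 : ∃ y₂ ∈ E, coeLat y₂ ⬝ᵥ x0 = -1 ∧ y₁ ≠ y₂ := by
      by_contra! hc
      rw [hseg y₁ h1 y₁ h1 e1 e1 (fun y h3 e3 => Or.inl (hc y h3 e3).symm), segment_same, dimSet_eq_vec] at hd
      rw [vectorSpan_singleton, finrank_bot] at hd
      omega
    obtain ⟨y₂, h2, e2, h12⟩ := hy2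
    have hk : ∀ y₃ ∈ E, coeLat y₃ ⬝ᵥ x0 = -1 → y₃ = y₁ ∨ y₃ = y₂ := by
      intro y₃ h3 e3
      by_contra! hc
      have m : ∀ y ∈ E, coeLat y ⬝ᵥ x0 = -1 → coeLat y ∈ {y | y ∈ Q ∧ x0 ⬝ᵥ y = -1} := fun y hy e =>
        ⟨h.memE hy, by rw [dotProduct_comm]; exact e⟩
      have v2 := vsub_mem_vectorSpan ℝ (m _ h1 e1) (m _ h2 e2)
      have v3 := vsub_mem_vectorSpan ℝ (m _ h1 e1) (m _ h3 e3)
      rw [dimSet_eq_vec] at hd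
      have hne : (⟨_, v2⟩ : vectorSpan ℝ {y | y ∈ Q ∧ x0 ⬝ᵥ y = -1}) ≠ 0 := by
        intro h0
        have := congrArg Subtype.val h0
        exact sub_ne_zero.2 (ci h12) this
      obtain ⟨t, ht⟩ := (finrank_eq_one_iff_of_nonzero' _ hne).1 hd ⟨_, v3⟩
      have ht' := congrArg Subtype.val ht
      exact ext_ncol ((h.ext _).1 h1) ((h.ext _).1 h2) ((h.ext _).1 h3) (ci h12) (ci hc.1.symm) (ci hc.2.symm) t ht'.symm
    refine ⟨y₁, h1, y₂, h2, h12, le_antisymm (dim_FP_le h12) ?_, (hseg y₁ h1 y₂ h2 e1 e2 hk).symm⟩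
    obtain ⟨i, j, hij⟩ := exists_minor_real e1 e2 (ci h12)
    rw [dimSet_eq_vec, ← finrank_plane hij]
    apply Submodule.finrank_mono
    intro d hd'
    rw [mem_plane] at hd'
    have hev : ∀ᶠ t : ℝ in nhdsWithin 0 (Set.Ioi 0), ∀ y ∈ E, -1 ≤ coeLat y ⬝ᵥ (x0 + t • d) := by
      rw [Filter.eventually_all_finset]
      intro y hy
      by_cases hyy : coeLat y ⬝ᵥ x0 = -1
      · refine Eventually.of_forall fun t => ?_
        rcases hk y hy hyy with rfl | rfl
        · rw [dotProduct_add, dotProduct_smul, hd'.1, hyy]; simp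
        · rw [dotProduct_add, dotProduct_smul, hd'.2, hyy]; simp
      · have hlt : -1 < coeLat y ⬝ᵥ x0 := lt_of_le_of_ne ((h.memP x0).1 hx0 _ (h.memE hy)) (Ne.symm hyy)
        have hc : Tendsto (fun t : ℝ => coeLat y ⬝ᵥ (x0 + t • d)) (nhds 0) (nhds (coeLat y ⬝ᵥ (x0 + (0 : ℝ) • d))) := by
          apply Continuous.tendsto
          unfold dotProduct; fun_prop
        rw [zero_smul, add_zero] at hc
        exact ((hc.mono_left nhdsWithin_le_nhds).eventually (lt_mem_nhds hlt)).mono fun t ht => le_of_lt ht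
    obtain ⟨t, h3, ht⟩ := (hev.and self_mem_nhdsWithin).exists
    have ht' : (0 : ℝ) < t := ht
    have a1 : x0 + t • d ∈ FP P y₁ y₂ := by
      refine ⟨(h.memP_iff _).2 h3, ?_, ?_⟩
      · rw [dotProduct_add, dotProduct_smul, hd'.1, e1]; simp
      · rw [dotProduct_add, dotProduct_smul, hd'.2, e2]; simp
    have a2 := vsub_mem_vectorSpan ℝ a1 (⟨hx0, e1, e2⟩ : x0 ∈ FP P y₁ y₂)
    rw [vsub_eq_sub, add_sub_cancel_left] at a2
    exact (Submodule.smul_mem_iff _ ht'.ne').1 a2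
  · rintro ⟨y₁, h1, y₂, h2, h12, hd, rfl⟩
    refine ⟨?_, ⟨_, left_mem_segment _ _ _⟩, dimSet_seg (ci h12)⟩
    obtain ⟨x0, hx0, hg⟩ := h.generic_pt h1 h2 h12 hd
    convert expo_of h.toDP.symm hx0.1 using 1
    ext y
    rw [← h.mem_seg (θ := {x0}) (by simpa using hx0.1) h1 h2 (by simpa using hx0.2.1) (by simpa using hx0.2.2) _ y]
    · simp [dotProduct_comm]
    · intro y₃ h3 e3
      by_contra! hc
      exact (hg y₃ h3 hc.1 hc.2).ne' (e3 x0 rfl)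

lemma fiber_sum {α β : Type*} [DecidableEq α] [DecidableEq β] (T : Finset (α × α)) (g : α × α → β) (f : β → ℝ)
    (hs : ∀ p ∈ T, p.swap ∈ T ∧ g p.swap = g p ∧ p.1 ≠ p.2)
    (hg : ∀ p ∈ T, ∀ q ∈ T, g p = g q → p = q ∨ p = q.swap) :
    ∑ p ∈ T, f (g p) = 2 * ∑ b ∈ T.image g, f b := by
  rw [Finset.sum_comp, Finset.mul_sum]
  refine Finset.sum_congr rfl fun b hb => ?_
  obtain ⟨q, hq, rfl⟩ := Finset.mem_image.1 hb
  have : {a ∈ T | g a = g q} = {q, q.swap} := by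
    ext p
    simp only [Finset.mem_filter, Finset.mem_insert, Finset.mem_singleton]
    constructor
    · rintro ⟨h1, h2⟩; exact hg p h1 q hq h2
    · rintro (rfl | rfl)
      · exact ⟨hq, rfl⟩
      · exact ⟨(hs q hq).1, (hs q hq).2.1⟩
  rw [this, Finset.card_pair, nsmul_eq_mul]
  · norm_num
  · intro he
    exact (hs q hq).2.2 (congrArg Prod.fst he)

open Classical in
/-- ordered pairs of adjacent facets -/
def prT (P : Set (Fin 4 → ℝ)) (E : Finset (Fin 4 → ℤ)) : Finset ((Fin 4 → ℤ) × (Fin 4 → ℤ)) :=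
  (E ×ˢ E).filter fun p => p.1 ≠ p.2 ∧ dimSet (FP P p.1 p.2) = 2

lemma mem_prT {p : (Fin 4 → ℤ) × (Fin 4 → ℤ)} : p ∈ prT P E ↔ (p.1 ∈ E ∧ p.2 ∈ E) ∧ p.1 ≠ p.2 ∧ dimSet (FP P p.1 p.2) = 2 := by
  rw [prT, Finset.mem_filter, Finset.mem_product]

lemma DPE.main' (h : DPE P Q E V) : 12 * ((latticePoints (frontier P)).ncard : ℝ) = 2 * (24 * (volume P).toReal) +
    1 / 2 * ∑ p ∈ prT P E, (gl (p.1 - p.2) : ℝ) * normVol 2 (FP P p.1 p.2) := by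
  rw [h.main (arF P) (fun y₁ h1 y₂ h2 h12 => h.arF_tendsto h1 h2 h12), prT, Finset.sum_filter, Finset.sum_product]
  congr 2
  refine Finset.sum_congr rfl fun y₁ h1 => Finset.sum_congr rfl fun y₂ h2 => ?_
  by_cases h12 : y₁ = y₂
  · simp [h12]
  · by_cases hd : dimSet (FP P y₁ y₂) = 2 <;> simp [h12, hd, arF]

lemma DPE.two (h : DPE P Q E V) : {θ | IsFaceOfDim P 2 θ}.Finite ∧
    12 * ((latticePoints (frontier P)).ncard : ℝ) = 2 * (24 * (volume P).toReal) +
      ∑ᶠ θ ∈ {θ | IsFaceOfDim P 2 θ}, normVol 2 θ * normVol 1 (dualFace P θ) := by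
  classical
  have hset : {θ | IsFaceOfDim P 2 θ} = ((prT P E).image fun p => FP P p.1 p.2 : Finset _) := by
    ext θ
    rw [Set.mem_ofPred_eq, h.two_face]
    simp only [Finset.coe_image, Set.mem_image, SetLike.mem_coe, mem_prT, Prod.exists]
    constructor
    · rintro ⟨y₁, h1, y₂, h2, h12, hd, rfl⟩; exact ⟨y₁, y₂, ⟨⟨h1, h2⟩, h12, hd⟩, rfl⟩
    · rintro ⟨y₁, y₂, ⟨⟨h1, h2⟩, h12, hd⟩, rfl⟩; exact ⟨y₁, h1, y₂, h2, h12, hd, rfl⟩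
  rw [hset]
  refine ⟨Finset.finite_toSet _, ?_⟩
  rw [h.main', finsum_mem_coe_finset]
  have := fiber_sum (prT P E) (fun p => FP P p.1 p.2) (fun θ => normVol 2 θ * normVol 1 (dualFace P θ)) ?_ ?_
  · rw [Finset.sum_congr rfl (g := fun p => normVol 2 (FP P p.1 p.2) * normVol 1 (dualFace P (FP P p.1 p.2))), this]
    · ring
    · intro p hp
      obtain ⟨⟨h1, h2⟩, h12, hd⟩ := mem_prT.1 hp
      rw [h.dual_FP h1 h2 h12 hd, seg_normVol h12, mul_comm]
  · intro p hp
    obtain ⟨⟨h1, h2⟩, h12, hd⟩ := mem_prT.1 hp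
    exact ⟨mem_prT.2 ⟨⟨h2, h1⟩, h12.symm, by rw [← hd]; exact congrArg _ (FP_swap P _ _)⟩, FP_swap P _ _, h12⟩
  · intro p hp q hq hpq
    obtain ⟨⟨h1, h2⟩, h12, hd⟩ := mem_prT.1 hp
    obtain ⟨⟨h3, h4⟩, h34, hd'⟩ := mem_prT.1 hq
    rcases h.FP_ne h1 h2 h3 h4 h12 h34 hd hpq with ⟨a, b⟩ | ⟨a, b⟩
    · exact Or.inl (Prod.ext a b)
    · exact Or.inr (Prod.ext a b)

lemma DPE.one (h : DPE P Q E V) : {θ | IsFaceOfDim Q 1 θ}.Finite ∧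
    12 * ((latticePoints (frontier P)).ncard : ℝ) = 2 * (24 * (volume P).toReal) +
      ∑ᶠ θ ∈ {θ | IsFaceOfDim Q 1 θ}, normVol 1 θ * normVol 2 (dualFace Q θ) := by
  classical
  have hset : {θ | IsFaceOfDim Q 1 θ} = ((prT P E).image fun p => segment ℝ (coeLat p.1) (coeLat p.2) : Finset (Set (Fin 4 → ℝ))) := by
    ext θ
    rw [Set.mem_ofPred_eq, h.one_face]
    simp only [Finset.coe_image, Set.mem_image, SetLike.mem_coe, mem_prT, Prod.exists]
    constructor
    · rintro ⟨y₁, h1, y₂, h2, h12, hd, rfl⟩; exact ⟨y₁, y₂, ⟨⟨h1, h2⟩, h12, hd⟩, rfl⟩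
    · rintro ⟨y₁, y₂, ⟨⟨h1, h2⟩, h12, hd⟩, rfl⟩; exact ⟨y₁, h1, y₂, h2, h12, hd, rfl⟩
  rw [hset]
  refine ⟨Finset.finite_toSet _, ?_⟩
  rw [h.main', finsum_mem_coe_finset]
  have := fiber_sum (prT P E) (fun p => segment ℝ (coeLat p.1) (coeLat p.2)) (fun θ => normVol 1 θ * normVol 2 (dualFace Q θ)) ?_ ?_
  · rw [Finset.sum_congr rfl (g := fun p => normVol 1 (segment ℝ (coeLat p.1) (coeLat p.2)) *
      normVol 2 (dualFace Q (segment ℝ (coeLat p.1) (coeLat p.2)))), this]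
    · ring
    · intro p hp
      obtain ⟨⟨h1, h2⟩, h12, hd⟩ := mem_prT.1 hp
      rw [h.dual_seg h1 h2, seg_normVol h12]
  · intro p hp
    obtain ⟨⟨h1, h2⟩, h12, hd⟩ := mem_prT.1 hp
    exact ⟨mem_prT.2 ⟨⟨h2, h1⟩, h12.symm, by rw [← hd]; exact congrArg _ (FP_swap P _ _)⟩, segment_symm ℝ _ _, h12⟩
  · intro p hp q hq hpq
    obtain ⟨⟨h1, h2⟩, h12, hd⟩ := mem_prT.1 hp
    obtain ⟨⟨h3, h4⟩, h34, hd'⟩ := mem_prT.1 hq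
    have hpq' : FP P p.1 p.2 = FP P q.1 q.2 := by
      rw [← h.dual_seg h1 h2, ← h.dual_seg h3 h4]; exact congrArg _ hpq
    rcases h.FP_ne h1 h2 h3 h4 h12 h34 hd hpq' with ⟨a, b⟩ | ⟨a, b⟩
    · exact Or.inl (Prod.ext a b)
    · exact Or.inr (Prod.ext a b)
end

theorem final_identity (Δ : Set (Fin 4 → ℝ)) (hΔ : IsReflexive Δ) :
    12 * (((latticePoints (frontier Δ)).ncard : ℝ) + ((latticePoints (frontier (polarDual Δ))).ncard : ℝ)) =
    2 * ((Nat.factorial 4 : ℝ) * (volume Δ).toReal + (Nat.factorial 4 : ℝ) * (volume (polarDual Δ)).toReal) +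
    ∑ᶠ θ ∈ {θ : Set (Fin 4 → ℝ) | IsFaceOfDim Δ 1 θ ∨ IsFaceOfDim Δ 2 θ},
      normVol (dimSet θ) θ * normVol (3 - dimSet θ) (dualFace Δ θ) := by
  have hD := DP.of_reflexive hΔ
  obtain ⟨E, V, h⟩ := hD.exists_DPE
  obtain ⟨E', V', h'⟩ := hD.symm.exists_DPE
  obtain ⟨f2, m2⟩ := h.two
  obtain ⟨f1, m1⟩ := h'.one
  have hu : {θ : Set (Fin 4 → ℝ) | IsFaceOfDim Δ 1 θ ∨ IsFaceOfDim Δ 2 θ} = {θ | IsFaceOfDim Δ 1 θ} ∪ {θ | IsFaceOfDim Δ 2 θ} := rfl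
  have hdj : Disjoint {θ | IsFaceOfDim Δ 1 θ} {θ | IsFaceOfDim Δ 2 θ} := by
    rw [Set.disjoint_left]
    rintro θ ⟨_, _, a⟩ ⟨_, _, b⟩
    omega
  rw [hu, finsum_mem_union hdj f1 f2, mul_add, m2, m1]
  have e1 : ∑ᶠ θ ∈ {θ | IsFaceOfDim Δ 1 θ}, normVol (dimSet θ) θ * normVol (3 - dimSet θ) (dualFace Δ θ) =
      ∑ᶠ θ ∈ {θ | IsFaceOfDim Δ 1 θ}, normVol 1 θ * normVol 2 (dualFace Δ θ) :=
    finsum_mem_congr rfl fun θ hθ => by rw [hθ.2.2]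
  have e2 : ∑ᶠ θ ∈ {θ | IsFaceOfDim Δ 2 θ}, normVol (dimSet θ) θ * normVol (3 - dimSet θ) (dualFace Δ θ) =
      ∑ᶠ θ ∈ {θ | IsFaceOfDim Δ 2 θ}, normVol 2 θ * normVol 1 (dualFace Δ θ) :=
    finsum_mem_congr rfl fun θ hθ => by rw [hθ.2.2]
  rw [e1, e2]
  have : (Nat.factorial 4 : ℝ) = 24 := by norm_num [Nat.factorial]
  rw [this]
  ring

end

theorem reflexive_4d_symmetric_identity (Δ : Set (Fin 4 → ℝ))
    (hΔ : IsReflexive Δ) (hdim : dimSet Δ = 4) :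
    12 * (((latticePoints (frontier Δ)).ncard : ℝ) +
        ((latticePoints (frontier (polarDual Δ))).ncard : ℝ)) =
      2 * ((Nat.factorial 4 : ℝ) * (volume Δ).toReal +
          (Nat.factorial 4 : ℝ) * (volume (polarDual Δ)).toReal) +
        ∑ᶠ θ ∈ {θ : Set (Fin 4 → ℝ) | IsFaceOfDim Δ 1 θ ∨ IsFaceOfDim Δ 2 θ},
          normVol (dimSet θ) θ * normVol (3 - dimSet θ) (dualFace Δ θ) := by
  exact final_identity Δ hΔ

end
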